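/- Set c_k := ω_d^{−2/d}·Γ(k + 2/d)/Γ(k). Then for each fixed k ∈ ℕ, as n → ∞, n^{2/d}·γ_{n,k} converges in L¹ to σ² + (c_k/(2d))·∫_Ω |∇h(x)|² κ(x)^{1−2/d} dx. (This is the intermediate L¹ limit established in the proof of Theorem 5.3.) -/

import Mathlib

open MeasureTheory ProbabilityTheory Filter Topology
open scoped RealInnerProductSpace

noncomputable section

/-- Euclidean space `ℝ^d`. -/
abbrev EucSp (d : ℕ) := EuclideanSpace ℝ (Fin d)

/-- The property that `J i n k ω` is (a.s.) the index of the `k`-th nearest neighbour of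
`X i ω` among `X 0 ω, …, X (n-1) ω`: it is an index `j < n`, `j ≠ i`, such that exactly
`k − 1` indices `ℓ < n`, `ℓ ≠ i`, satisfy `|X ℓ − X i| < |X j − X i|`. -/
def IsNNIndex {d : ℕ} {Ωp : Type*} [MeasureSpace Ωp]
    (X : ℕ → Ωp → EucSp d) (J : ℕ → ℕ → ℕ → Ωp → ℕ) : Prop :=
  ∀ i n k : ℕ, i < n → 1 ≤ k → k < n → ∀ᵐ ω ∂ℙ,
    J i n k ω < n ∧ J i n k ω ≠ i ∧
      ((Finset.range n).filter fun ℓ => ℓ ≠ i ∧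
        dist (X ℓ ω) (X i ω) < dist (X (J i n k ω) ω) (X i ω)).card = k - 1

/-- The Gamma statistic `γ_{n,k} = (2n)⁻¹ Σ_{i<n} (Y_{j(i,n,k),n} − Y_{i,n})²`, where
`Y_{i,n} = h(X_i) + n^{−1/d} e_i`. -/
def gammaStat {d : ℕ} {Ωp : Type*} (h : EucSp d → ℝ) (X : ℕ → Ωp → EucSp d)
    (e : ℕ → Ωp → ℝ) (J : ℕ → ℕ → ℕ → Ωp → ℕ) (n k : ℕ) (ω : Ωp) : ℝ :=
  (2 * (n : ℝ))⁻¹ * ∑ i ∈ Finset.range n,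
    ((h (X (J i n k ω) ω) + (n : ℝ) ^ (-1 / (d : ℝ)) * e (J i n k ω) ω)
      - (h (X i ω) + (n : ℝ) ^ (-1 / (d : ℝ)) * e i ω)) ^ 2

/-- The constant `c_k = ω_d^{−2/d} Γ(k + 2/d)/Γ(k) = E[ρ_k²]`, the second moment of the
`k`-th nearest-neighbour distance to the origin in a rate-one homogeneous Poisson
process. -/
def nnMoment (d k : ℕ) : ℝ :=
  (volume (Metric.closedBall (0 : EucSp d) 1)).toReal ^ (-2 / (d : ℝ)) *
    Real.Gamma (k + 2 / (d : ℝ)) / Real.Gamma k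



/-- binomial-type weight -/
def wt (j : ℕ) (c : ℝ) (m : ℕ) (t : ℝ) : ℝ := c * t ^ j * (1 - t) ^ m

/-- rescaled weight -/
def hw (j : ℕ) (c : ℝ) (m : ℕ) (n : ℕ) (s : ℝ) : ℝ :=
  if s < n then (1 / (n : ℝ)) * wt j c m (s / n) else 0

/-- admissible weight sequences -/
structure GoodW (j : ℕ) (c : ℕ → ℝ) (m : ℕ → ℕ) : Prop where
  nn : ∀ n, 0 ≤ c n
  lim : Tendsto (fun n : ℕ => c n / (n : ℝ) ^ (j + 1)) atTop (𝓝 (1 / (j.factorial : ℝ)))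
  mlim : Tendsto (fun n : ℕ => (m n : ℝ) / (n : ℝ)) atTop (𝓝 1)

lemma measurable_wt (j : ℕ) (c : ℝ) (m : ℕ) : Measurable (wt j c m) := by
  unfold wt; fun_prop

lemma measurable_hw (j : ℕ) (c : ℝ) (m n : ℕ) : Measurable (hw j c m n) := by
  unfold hw
  exact Measurable.ite measurableSet_Iio
    (((measurable_wt j c m).comp (by fun_prop)).const_mul _) measurable_const

lemma wt_nonneg {j : ℕ} {c : ℝ} {m : ℕ} {t : ℝ} (hc : 0 ≤ c) (h0 : 0 ≤ t) (h1 : t ≤ 1) :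
    0 ≤ wt j c m t := by
  unfold wt
  have : 0 ≤ 1 - t := by linarith
  positivity

lemma wt_le {j : ℕ} {c : ℝ} {m : ℕ} {t : ℝ} (hc : 0 ≤ c) (h0 : 0 ≤ t) (h1 : t ≤ 1) :
    wt j c m t ≤ c := by
  unfold wt
  have h2 : 0 ≤ 1 - t := by linarith
  have h3 : t ^ j ≤ 1 := pow_le_one₀ h0 h1
  have h4 : (1 - t) ^ m ≤ 1 := pow_le_one₀ h2 (by linarith)
  have h5 : t ^ j * (1 - t) ^ m ≤ 1 := mul_le_one₀ h3 (by positivity) h4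
  rw [mul_assoc]
  nlinarith

lemma hw_nonneg {j : ℕ} {c : ℝ} {m n : ℕ} {s : ℝ} (hc : 0 ≤ c) (h0 : 0 ≤ s) :
    0 ≤ hw j c m n s := by
  unfold hw
  split_ifs with h
  · have hn : (0 : ℝ) < n := lt_of_le_of_lt h0 h
    have := wt_nonneg (j := j) (m := m) hc (div_nonneg h0 hn.le) ((div_le_one hn).2 h.le)
    positivity
  · rfl

lemma GoodW.bound {j : ℕ} {c : ℕ → ℝ} {m : ℕ → ℕ} (hg : GoodW j c m) :
    ∃ K : ℝ, 0 < K ∧ ∀ᶠ n in atTop, ∀ s : ℝ, 0 ≤ s →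
      hw j (c n) (m n) n s ≤ K * (s ^ j * Real.exp (-(s / 2))) := by
  refine ⟨2 / (j.factorial : ℝ), by positivity, ?_⟩
  have e1 : ∀ᶠ n : ℕ in atTop, c n / (n : ℝ) ^ (j + 1) < 2 / (j.factorial : ℝ) := by
    apply hg.lim.eventually_lt_const
    apply div_lt_div_of_pos_right (by norm_num) (by positivity)
  have e2 : ∀ᶠ n : ℕ in atTop, (1 : ℝ) / 2 < (m n : ℝ) / n :=
    hg.mlim.eventually_const_lt (by norm_num)
  filter_upwards [e1, e2, eventually_gt_atTop 0] with n h1 h2 hn s hs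
  unfold hw
  split_ifs with h
  · have hn' : (0 : ℝ) < n := by exact_mod_cast hn
    unfold wt
    have hb : (1 - s / n) ^ (m n) ≤ Real.exp (-(s / 2)) := by
      have h3 : 1 - s / n ≤ Real.exp (-(s / n)) := by
        have := Real.add_one_le_exp (-(s / n)); linarith
      have h4 : 0 ≤ 1 - s / n := by
        have := (div_le_one hn').2 h.le; linarith
      calc (1 - s / n) ^ (m n) ≤ (Real.exp (-(s / n))) ^ (m n) := pow_le_pow_left₀ h4 h3 _
        _ = Real.exp (-(s * ((m n : ℝ) / n))) := by
            rw [← Real.exp_nat_mul]; congr 1; field_simp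
        _ ≤ _ := by
            apply Real.exp_le_exp.2
            nlinarith
    have : 1 / (n : ℝ) * (c n * (s / n) ^ j * (1 - s / n) ^ (m n))
        = (c n / (n : ℝ) ^ (j + 1)) * (s ^ j * (1 - s / n) ^ (m n)) := by
      rw [div_pow]; field_simp; ring
    rw [this]
    have h4 : 0 ≤ 1 - s / n := by
      have := (div_le_one hn').2 h.le; linarith
    have := hg.nn n
    gcongr
  · positivity

lemma GoodW.hw_tendsto {j : ℕ} {c : ℕ → ℝ} {m : ℕ → ℕ} (hg : GoodW j c m) (s : ℝ) :
    Tendsto (fun n => hw j (c n) (m n) n s) atTop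
      (𝓝 (1 / (j.factorial : ℝ) * (s ^ j * Real.exp (-s)))) := by
  have key : Tendsto (fun n : ℕ => (c n / (n : ℝ) ^ (j + 1)) * (s ^ j * (1 - s / n) ^ (m n)))
      atTop (𝓝 (1 / (j.factorial : ℝ) * (s ^ j * Real.exp (-s)))) := by
    refine hg.lim.mul (tendsto_const_nhds.mul ?_)
    -- (1 - s/n)^m = ((1-s/n)^n)^(m/n)
    have h1 : Tendsto (fun n : ℕ => (1 - s / n) ^ n) atTop (𝓝 (Real.exp (-s))) := by
      have := Real.tendsto_one_add_div_pow_exp (-s)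
      simpa [neg_div, sub_eq_add_neg] using this
    have h2 : Tendsto (fun n : ℕ => ((1 - s / n) ^ n) ^ ((m n : ℝ) / n)) atTop
        (𝓝 (Real.exp (-s) ^ (1 : ℝ))) :=
      h1.rpow hg.mlim (Or.inl (Real.exp_pos _).ne')
    rw [Real.rpow_one] at h2
    refine h2.congr' ?_
    filter_upwards [eventually_gt_atTop 0, eventually_gt_atTop ⌈|s|⌉₊] with n hn hs
    have hn' : (0 : ℝ) < n := by exact_mod_cast hn
    have hs' : |s| < n := by
      exact (Nat.le_ceil _).trans_lt (by exact_mod_cast hs)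
    have h4 : 0 ≤ 1 - s / n := by
      have := (div_le_one hn').2 ((le_abs_self s).trans hs'.le); linarith
    rw [← Real.rpow_natCast (1 - s / n) n, ← Real.rpow_mul h4, ← Real.rpow_natCast _ (m n)]
    congr 1
    field_simp
  refine key.congr' ?_
  filter_upwards [eventually_gt_atTop 0, eventually_gt_atTop ⌈|s|⌉₊] with n hn hs
  have hn' : (0 : ℝ) < n := by exact_mod_cast hn
  have hs' : s < n := by
    exact ((le_abs_self s).trans (Nat.le_ceil _)).trans_lt (by exact_mod_cast hs)
  unfold hw wt
  rw [if_pos hs', div_pow]; field_simp; ring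

lemma integrable_gam (j : ℕ) {q : ℝ} (hq : 0 ≤ q) {b : ℝ} (hb : 0 < b) :
    IntegrableOn (fun s : ℝ => s ^ q * (s ^ j * Real.exp (-(s * b)))) (Set.Ioi 0) := by
  have := integrableOn_rpow_mul_exp_neg_mul_rpow (s := q + j) (p := 1) (b := b)
    (by have : (0:ℝ) ≤ j := by positivity
        linarith) (by norm_num) hb
  refine this.congr_fun ?_ measurableSet_Ioi
  intro s hs
  have hs : (0 : ℝ) < s := hs
  simp only [Real.rpow_one]
  rw [Real.rpow_add hs, Real.rpow_natCast]
  rw [show -b * s = -(s * b) by ring]; ring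

lemma integrable_gam2 (j : ℕ) {q : ℝ} (hq : 0 ≤ q) :
    IntegrableOn (fun s : ℝ => s ^ q * (s ^ j * Real.exp (-(s / 2)))) (Set.Ioi 0) := by
  have := integrable_gam j hq (b := 1 / 2) (by norm_num)
  refine this.congr_fun ?_ measurableSet_Ioi
  intro s hs
  simp only [mul_one_div]

lemma integral_gam (j : ℕ) {q : ℝ} (hq : 0 ≤ q) :
    ∫ s in Set.Ioi (0:ℝ), s ^ q * (1 / (j.factorial : ℝ) * (s ^ j * Real.exp (-s)))
      = Real.Gamma ((j : ℝ) + 1 + q) / Real.Gamma ((j : ℝ) + 1) := by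
  rw [Real.Gamma_nat_eq_factorial, Real.Gamma_eq_integral (by positivity),
    div_eq_inv_mul (∫ x in _, _), ← integral_const_mul]
  apply setIntegral_congr_fun measurableSet_Ioi
  intro s hs
  have hs : (0 : ℝ) < s := hs
  simp only
  rw [show (j : ℝ) + 1 + q - 1 = q + j by ring, Real.rpow_add hs, Real.rpow_natCast]
  ring

lemma GoodW.tendsto_moment {j : ℕ} {c : ℕ → ℝ} {m : ℕ → ℕ} (hg : GoodW j c m)
    {q : ℝ} (hq : 0 ≤ q) :
    Tendsto (fun n : ℕ => ∫ s in Set.Ioi (0:ℝ), s ^ q * hw j (c n) (m n) n s) atTop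
      (𝓝 (Real.Gamma ((j : ℝ) + 1 + q) / Real.Gamma ((j : ℝ) + 1))) := by
  obtain ⟨K, hK, hb⟩ := hg.bound
  rw [← integral_gam j hq]
  refine tendsto_integral_filter_of_dominated_convergence
    (fun s => K * (s ^ q * (s ^ j * Real.exp (-(s / 2))))) ?_ ?_ ?_ ?_
  · refine Eventually.of_forall fun n => ?_
    exact ((by fun_prop : Measurable fun s : ℝ => s ^ q).mul
      (measurable_hw _ _ _ _)).aestronglyMeasurable
  · filter_upwards [hb] with n hn
    filter_upwards [ae_restrict_mem measurableSet_Ioi] with s hs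
    have hs : (0 : ℝ) < s := hs
    have h1 := hn s hs.le
    have h2 := hw_nonneg (j := j) (m := m n) (n := n) (hg.nn n) hs.le
    have h3 : 0 ≤ s ^ q := by positivity
    rw [Real.norm_of_nonneg (by positivity)]
    calc _ ≤ s ^ q * (K * (s ^ j * Real.exp (-(s / 2)))) := by gcongr
      _ = _ := by ring
  · exact (integrable_gam2 j hq).const_mul K
  · exact Eventually.of_forall fun s => (hg.hw_tendsto s).const_mul _

lemma integrable_zero (j : ℕ) :
    IntegrableOn (fun s : ℝ => (s ^ j * Real.exp (-(s / 2)))) (Set.Ioi 0) := by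
  simpa using integrable_gam2 j (q := 0) le_rfl

lemma GoodW.diff {j : ℕ} {c c' : ℕ → ℝ} {m m' : ℕ → ℕ} (hg : GoodW j c m)
    (hg' : GoodW j c' m') :
    Tendsto (fun n : ℕ => ∫⁻ s in Set.Ioi (0:ℝ),
      ENNReal.ofReal |hw j (c n) (m n) n s - hw j (c' n) (m' n) n s|) atTop (𝓝 0) := by
  obtain ⟨K, hK, hb⟩ := hg.bound
  obtain ⟨K', hK', hb'⟩ := hg'.bound
  have h0 : (0 : ENNReal) = ∫⁻ s in Set.Ioi (0:ℝ), 0 := by simp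
  rw [h0]
  refine tendsto_lintegral_filter_of_dominated_convergence
    (fun s => ENNReal.ofReal ((K + K') * (s ^ j * Real.exp (-(s / 2))))) ?_ ?_ ?_ ?_
  · refine Eventually.of_forall fun n => ?_
    have h1 := measurable_hw j (c n) (m n) n
    have h2 := measurable_hw j (c' n) (m' n) n
    fun_prop
  · filter_upwards [hb, hb'] with n hn hn'
    filter_upwards [ae_restrict_mem measurableSet_Ioi] with s hs
    have hs : (0 : ℝ) < s := hs
    have h1 := hn s hs.le
    have h2 := hn' s hs.le
    have h3 := hw_nonneg (j := j) (m := m n) (n := n) (hg.nn n) hs.le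
    have h4 := hw_nonneg (j := j) (m := m' n) (n := n) (hg'.nn n) hs.le
    apply ENNReal.ofReal_le_ofReal
    have h5 : 0 ≤ s ^ j * Real.exp (-(s / 2)) := by positivity
    rw [abs_le]; constructor <;> nlinarith
  · exact ((integrable_zero j).const_mul _).lintegral_lt_top.ne
  · refine Eventually.of_forall fun s => ?_
    have := (hg.hw_tendsto s).sub (hg'.hw_tendsto s)
    rw [sub_self] at this
    have := (ENNReal.continuous_ofReal.tendsto _).comp this.abs
    simpa [Function.comp_def] using this

lemma goodW_exact (j : ℕ) : GoodW j (fun n => ((n - 1 : ℕ) : ℝ) * ((n - 2).choose j : ℕ))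
    (fun n => n - 2 - j) := by
  have hsub : ∀ a : ℕ, Tendsto (fun n : ℕ => ((n - a : ℕ) : ℝ) / n) atTop (𝓝 1) := by
    intro a
    have h1 : Tendsto (fun n : ℕ => 1 - (a : ℝ) / n) atTop (𝓝 (1 - 0)) :=
      tendsto_const_nhds.sub (tendsto_const_div_atTop_nhds_zero_nat _)
    rw [sub_zero] at h1
    refine h1.congr' ?_
    filter_upwards [eventually_gt_atTop a, eventually_gt_atTop 0] with n hn hn0
    have : (n : ℝ) ≠ 0 := by positivity
    rw [Nat.cast_sub hn.le]; field_simp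
  refine ⟨fun n => by positivity, ?_, ?_⟩
  · have h2 : Tendsto (fun n : ℕ => ((n - 2 : ℕ).choose j : ℝ) / ((n - 2 : ℕ) : ℝ) ^ j) atTop
        (𝓝 (1 / (j.factorial : ℝ))) := by
      have h3 : Tendsto (fun n : ℕ => ((n).choose j : ℝ) / (n : ℝ) ^ j) atTop
          (𝓝 (1 / (j.factorial : ℝ))) := by
        have h4 := (isEquivalent_choose j)
        have h5 : Asymptotics.IsEquivalent atTop (fun n : ℕ => ((n).choose j : ℝ) / (n : ℝ) ^ j)
            (fun n : ℕ => ((n : ℝ) ^ j / j.factorial) / (n : ℝ) ^ j) := h4.div .refl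
        have h6 : Tendsto (fun n : ℕ => ((n : ℝ) ^ j / j.factorial) / (n : ℝ) ^ j) atTop
            (𝓝 (1 / (j.factorial : ℝ))) := by
          refine tendsto_const_nhds.congr' ?_
          filter_upwards [eventually_gt_atTop 0] with n hn
          have : (n : ℝ) ≠ 0 := by positivity
          field_simp
        exact h5.symm.tendsto_nhds h6
      exact h3.comp (tendsto_sub_atTop_nat 2)
    have h7 := ((hsub 1).mul (h2.mul ((hsub 2).pow j)))
    simp only [one_pow, mul_one, one_mul] at h7
    refine h7.congr' ?_
    filter_upwards [eventually_gt_atTop 2] with n hn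
    have : (n : ℝ) ≠ 0 := by positivity
    have : ((n - 2 : ℕ) : ℝ) ≠ 0 := by
      have : 0 < n - 2 := by omega
      positivity
    rw [div_pow]
    field_simp
    ring
  · simp_rw [Nat.sub_sub]
    exact hsub _

lemma goodW_upper (j : ℕ) : GoodW j (fun n => (n : ℝ) ^ (j + 1) / (j.factorial : ℝ))
    (fun n => n - 4 - 2 * j) := by
  refine ⟨fun n => by positivity, ?_, ?_⟩
  · refine tendsto_const_nhds.congr' ?_
    filter_upwards [eventually_gt_atTop 0] with n hn
    have : (n : ℝ) ≠ 0 := by positivity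
    field_simp
  · have h1 : Tendsto (fun n : ℕ => 1 - ((4 + 2 * j : ℕ) : ℝ) / n) atTop (𝓝 (1 - 0)) :=
      tendsto_const_nhds.sub (tendsto_const_div_atTop_nhds_zero_nat _)
    rw [sub_zero] at h1
    refine h1.congr' ?_
    filter_upwards [eventually_gt_atTop (4 + 2 * j)] with n hn
    have : (n : ℝ) ≠ 0 := by
      have : 0 < n := by omega
      positivity
    rw [Nat.sub_sub, Nat.cast_sub hn.le]; field_simp


section unif

variable {d : ℕ} (μ : Measure (EucSp d))

/-- measure of the open ball centred at `x` with `y` on its boundary -/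
def Fm (x y : EucSp d) : ℝ := μ.real (Metric.ball x (dist y x))

lemma Fm_nonneg (x y : EucSp d) : 0 ≤ Fm μ x y := measureReal_nonneg

lemma Fm_le_one [IsProbabilityMeasure μ] (x y : EucSp d) : Fm μ x y ≤ 1 := measureReal_le_one

lemma measurable_Fm2 [IsProbabilityMeasure μ] :
    Measurable (fun z : EucSp d × EucSp d => Fm μ z.1 z.2) := by
  unfold Fm Measure.real
  apply Measurable.ennreal_toReal
  have hs : MeasurableSet {w : (EucSp d × EucSp d) × EucSp d | dist w.2 w.1.1 < dist w.1.2 w.1.1} :=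
    measurableSet_lt (by fun_prop) (by fun_prop)
  exact measurable_measure_prodMk_left hs

lemma measurable_Fm [IsProbabilityMeasure μ] (x : EucSp d) : Measurable (fun y => Fm μ x y) := by
  have h1 : Measurable (fun y : EucSp d => (x, y)) := measurable_prodMk_left
  have h2 := (measurable_Fm2 μ).comp h1
  simp only [Function.comp_def] at h2
  exact h2

lemma continuous_ballmeas [IsProbabilityMeasure μ] (hs : ∀ x r, μ (Metric.sphere x r) = 0)
    (x : EucSp d) : Continuous (fun r : ℝ => μ.real (Metric.ball x r)) := by
  rw [continuous_iff_continuousAt]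
  intro r
  unfold ContinuousAt Measure.real
  refine (ENNReal.tendsto_toReal (measure_ne_top _ _)).comp ?_
  refine tendsto_measure_of_ae_tendsto_indicator_of_isFiniteMeasure _ Metric.isOpen_ball.measurableSet
    (fun _ => Metric.isOpen_ball.measurableSet) ?_
  have h0 : ∀ᵐ y ∂μ, y ∉ Metric.sphere x r := measure_eq_zero_iff_ae_notMem.1 (hs x r)
  filter_upwards [h0] with y hy
  have hy : dist y x ≠ r := hy
  rcases lt_or_gt_of_ne hy with h | h
  · filter_upwards [eventually_gt_nhds h] with r' hr'
    simp [Metric.mem_ball, h, hr']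
  · filter_upwards [eventually_lt_nhds h] with r' hr'
    simp only [Metric.mem_ball, h.not_gt, hr'.not_gt]

lemma exists_rad [IsProbabilityMeasure μ] (hs : ∀ x r, μ (Metric.sphere x r) = 0)
    (x : EucSp d) {u : ℝ} (h0 : 0 ≤ u) (h1 : u < 1) :
    ∃ r, μ.real (Metric.ball x r) = u := by
  have hc := continuous_ballmeas μ hs x
  have hlim : Tendsto (fun n : ℕ => μ.real (Metric.ball x n)) atTop (𝓝 1) := by
    unfold Measure.real
    have : Tendsto (fun n : ℕ => μ (Metric.ball x n)) atTop (𝓝 (μ (⋃ n : ℕ, Metric.ball x n))) := by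
      apply tendsto_measure_iUnion_atTop
      intro a b hab
      exact Metric.ball_subset_ball (by exact_mod_cast hab)
    rw [Metric.iUnion_ball_nat, measure_univ] at this
    exact (ENNReal.tendsto_toReal ENNReal.one_ne_top).comp this
  obtain ⟨n, hn⟩ := (hlim.eventually_const_lt h1).exists
  have := intermediate_value_Icc (a := 0) (b := (n : ℝ)) (by positivity) hc.continuousOn
  obtain ⟨r, -, hr⟩ := this (show u ∈ _ from ⟨by simpa using h0, hn.le⟩)
  exact ⟨r, hr⟩

lemma cdf_Fm [IsProbabilityMeasure μ] (hs : ∀ x r, μ (Metric.sphere x r) = 0)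
    (x : EucSp d) {u : ℝ} (h0 : 0 ≤ u) (h1 : u < 1) :
    μ.real {y | Fm μ x y ≤ u} = u := by
  apply le_antisymm
  · apply le_of_forall_gt_imp_ge_of_dense
    intro v hv
    rcases lt_or_ge v 1 with hv1 | hv1
    · obtain ⟨r, hr⟩ := exists_rad μ hs x (h0.trans hv.le) hv1
      rw [← hr]
      refine measureReal_mono ?_
      intro y hy
      by_contra hy2
      have hy2 : r ≤ dist y x := by simpa using hy2
      have : μ.real (Metric.ball x r) ≤ Fm μ x y :=
        measureReal_mono (Metric.ball_subset_ball hy2)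
      have hy : Fm μ x y ≤ u := hy
      linarith
    · exact measureReal_le_one.trans hv1
  · obtain ⟨r, hr⟩ := exists_rad μ hs x h0 h1
    conv_lhs => rw [← hr]
    refine measureReal_mono ?_
    intro y hy
    have hy : dist y x < r := hy
    show Fm μ x y ≤ u
    rw [← hr]
    exact measureReal_mono (Metric.ball_subset_ball hy.le)

lemma map_Fm [IsProbabilityMeasure μ] (hs : ∀ x r, μ (Metric.sphere x r) = 0)
    (x : EucSp d) {N : ℝ} (hN : 0 < N) :
    μ.map (fun y => N * Fm μ x y) = ENNReal.ofReal (1 / N) • volume.restrict (Set.Ioo 0 N) := by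
  have hm : Measurable (fun y => N * Fm μ x y) := (measurable_Fm μ x).const_mul N
  have : IsProbabilityMeasure (μ.map (fun y => N * Fm μ x y)) :=
    Measure.isProbabilityMeasure_map hm.aemeasurable
  apply Measure.ext_of_Iic
  intro t
  rw [Measure.map_apply hm measurableSet_Iic, Measure.smul_apply,
    Measure.restrict_apply measurableSet_Iic, smul_eq_mul]
  have hset : (fun y => N * Fm μ x y) ⁻¹' Set.Iic t = {y | Fm μ x y ≤ t / N} := by
    ext y
    simp [le_div_iff₀ hN, mul_comm]
  rw [hset]
  rcases lt_or_ge t 0 with ht | ht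
  · have h1 : {y | Fm μ x y ≤ t / N} = ∅ := by
      ext y
      simp only [Set.mem_ofPred_eq, Set.mem_empty_iff_false, iff_false, not_le]
      exact (div_neg_of_neg_of_pos ht hN).trans_le (Fm_nonneg μ x y)
    have h2 : Set.Iic t ∩ Set.Ioo 0 N = ∅ := by
      ext y
      simp only [Set.mem_inter_iff, Set.mem_Iic, Set.mem_Ioo, Set.mem_empty_iff_false, iff_false]
      rintro ⟨a, b, c⟩; linarith
    simp [h1, h2]
  rcases lt_or_ge t N with htN | htN
  · have h2 : Set.Iic t ∩ Set.Ioo 0 N = Set.Ioc 0 t := by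
      ext y
      simp only [Set.mem_inter_iff, Set.mem_Iic, Set.mem_Ioo, Set.mem_Ioc]
      constructor
      · rintro ⟨a, b, c⟩; exact ⟨b, a⟩
      · rintro ⟨a, b⟩; exact ⟨b, a, by linarith⟩
    have h3 := cdf_Fm μ hs x (u := t / N) (by positivity) ((div_lt_one hN).2 htN)
    rw [h2, Real.volume_Ioc, ← ENNReal.ofReal_mul (by positivity)]
    rw [Measure.real] at h3
    rw [← ENNReal.ofReal_toReal (measure_ne_top μ {y | Fm μ x y ≤ t / N}), h3]
    congr 1; ring
  · have h1 : {y | Fm μ x y ≤ t / N} = Set.univ := by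
      ext y
      simp only [Set.mem_ofPred_eq, Set.mem_univ, iff_true]
      exact (Fm_le_one μ x y).trans ((one_le_div hN).2 htN)
    have h2 : Set.Iic t ∩ Set.Ioo 0 N = Set.Ioo 0 N := by
      apply Set.inter_eq_right.2
      intro y hy; exact hy.2.le.trans htN
    rw [h1, h2, measure_univ, Real.volume_Ioo, ← ENNReal.ofReal_mul (by positivity)]
    rw [show 1 / N * (N - 0) = 1 by field_simp; simp]
    simp

lemma hw_eq_indicator (j : ℕ) (c : ℝ) (m n : ℕ) :
    Set.EqOn (hw j c m n) ((Set.Ioo 0 (n:ℝ)).indicator fun s => (1 / (n:ℝ)) * wt j c m (s / n))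
      (Set.Ioi 0) := by
  intro s hs
  have hs : (0:ℝ) < s := hs
  unfold hw
  by_cases h : s < n
  · rw [if_pos h, Set.indicator_of_mem (by exact ⟨hs, h⟩)]
  · rw [if_neg h, Set.indicator_of_notMem (by rintro ⟨_, b⟩; exact h b)]

lemma lint_Fm [IsProbabilityMeasure μ] (hs : ∀ x r, μ (Metric.sphere x r) = 0)
    (x : EucSp d) {n : ℕ} (hn : 0 < n) {f : ℝ → ENNReal} (hf : Measurable f) (g : ℝ → ℝ)
    (hg : Measurable g) :
    ∫⁻ y, f (n * Fm μ x y) * ENNReal.ofReal (g (Fm μ x y)) ∂μ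
      = ∫⁻ s in Set.Ioi (0:ℝ), f s * ENNReal.ofReal (if s < n then (1 / (n : ℝ)) * g (s / n) else 0) := by
  have hn' : (0 : ℝ) < n := by exact_mod_cast hn
  have hm : Measurable (fun y => (n : ℝ) * Fm μ x y) := (measurable_Fm μ x).const_mul _
  have h1 : ∫⁻ y, f (n * Fm μ x y) * ENNReal.ofReal (g (Fm μ x y)) ∂μ
      = ∫⁻ s, f s * ENNReal.ofReal (g (s / n)) ∂(μ.map (fun y => (n : ℝ) * Fm μ x y)) := by
    rw [lintegral_map (by fun_prop) hm]
    apply lintegral_congr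
    intro y
    rw [mul_div_cancel_left₀ _ hn'.ne']
  rw [h1, map_Fm μ hs x hn', lintegral_smul_measure, ← lintegral_indicator measurableSet_Ioo,
    ← lintegral_indicator measurableSet_Ioi, smul_eq_mul,
    ← lintegral_const_mul _ (Measurable.indicator (by fun_prop) measurableSet_Ioo)]
  apply lintegral_congr
  intro s
  by_cases hs0 : 0 < s
  · rw [Set.indicator_of_mem (s := Set.Ioi 0) hs0]
    by_cases hsn : s < n
    · rw [Set.indicator_of_mem (by exact ⟨hs0, hsn⟩), if_pos hsn,
        ENNReal.ofReal_mul (p := 1 / (n:ℝ)) (by positivity)]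
      ring
    · rw [Set.indicator_of_notMem (by rintro ⟨_, b⟩; exact hsn b), if_neg hsn]
      simp
  · rw [Set.indicator_of_notMem (s := Set.Ioi 0) (by simpa using hs0),
      Set.indicator_of_notMem (by rintro ⟨b, _⟩; exact hs0 b)]
    simp

lemma lint_wt [IsProbabilityMeasure μ] (hs : ∀ x r, μ (Metric.sphere x r) = 0)
    (x : EucSp d) {n : ℕ} (hn : 0 < n) {f : ℝ → ENNReal} (hf : Measurable f) (j : ℕ) (c : ℝ)
    (m : ℕ) :
    ∫⁻ y, f (n * Fm μ x y) * ENNReal.ofReal (wt j c m (Fm μ x y)) ∂μ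
      = ∫⁻ s in Set.Ioi (0:ℝ), f s * ENNReal.ofReal (hw j c m n s) :=
  lint_Fm μ hs x hn hf _ (measurable_wt j c m)

lemma int_wt [IsProbabilityMeasure μ] (hs : ∀ x r, μ (Metric.sphere x r) = 0)
    (x : EucSp d) {n : ℕ} (hn : 0 < n) {f : ℝ → ℝ} (hf : Measurable f) (hf0 : ∀ s, 0 ≤ s → 0 ≤ f s)
    (j : ℕ) {c : ℝ} (hc : 0 ≤ c) (m : ℕ) :
    ∫ y, f (n * Fm μ x y) * wt j c m (Fm μ x y) ∂μ
      = ∫ s in Set.Ioi (0:ℝ), f s * hw j c m n s := by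
  have hm := measurable_Fm μ x
  have hw := measurable_wt j c m
  have hw2 := measurable_hw j c m n
  have hF := Fm_nonneg μ x
  have hF1 := Fm_le_one μ x
  rw [integral_eq_lintegral_of_nonneg_ae, integral_eq_lintegral_of_nonneg_ae]
  · congr 1
    have := lint_wt μ hs x hn (f := fun s => ENNReal.ofReal (f s)) (by fun_prop) j c m
    rw [lintegral_congr (g := fun y => ENNReal.ofReal (f (n * Fm μ x y)) *
      ENNReal.ofReal (wt j c m (Fm μ x y))), this]
    · apply setLIntegral_congr_fun measurableSet_Ioi
      intro s hs
      have hs : (0:ℝ) < s := hs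
      simp only
      rw [ENNReal.ofReal_mul (hf0 s hs.le)]
    · intro y
      rw [ENNReal.ofReal_mul]
      exact hf0 _ (by have := hF y; positivity)
  · filter_upwards [ae_restrict_mem measurableSet_Ioi] with s hs
    have hs : (0:ℝ) < s := hs
    exact mul_nonneg (hf0 s hs.le) (hw_nonneg hc hs.le)
  · exact (hf.mul hw2).aestronglyMeasurable
  · refine Eventually.of_forall fun y => ?_
    exact mul_nonneg (hf0 _ (by have := hF y; positivity)) (wt_nonneg hc (hF y) (hF1 y))
  · exact ((hf.comp (hm.const_mul _)).mul (hw.comp hm)).aestronglyMeasurable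

end unif


section sym
variable {d : ℕ}

lemma sym_integrable {ψ : ℝ → ℝ} (hψ : Measurable ψ) {C ρ : ℝ} (hC : ∀ r, |ψ r| ≤ C)
    (hρ : ∀ r, ρ < r → ψ r = 0) {g : EucSp d → ℝ} (hg : Continuous g) :
    Integrable (fun u : EucSp d => ψ ‖u‖ * g u) := by
  obtain ⟨M, hM⟩ := (isCompact_closedBall (0 : EucSp d) ρ).exists_bound_of_continuousOn hg.continuousOn
  have hsupp : (fun u : EucSp d => ψ ‖u‖ * g u)
      = (Metric.closedBall (0 : EucSp d) ρ).indicator (fun u : EucSp d => ψ ‖u‖ * g u) := by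
    ext u
    by_cases hu : u ∈ Metric.closedBall (0 : EucSp d) ρ
    · rw [Set.indicator_of_mem hu]
    · rw [Set.indicator_of_notMem hu, hρ, zero_mul]
      simpa using hu
  rw [hsupp, integrable_indicator_iff Metric.isClosed_closedBall.measurableSet]
  have hfin : volume (Metric.closedBall (0 : EucSp d) ρ) < ⊤ := measure_closedBall_lt_top
  have : IsFiniteMeasure (volume.restrict (Metric.closedBall (0 : EucSp d) ρ)) :=
    ⟨by simpa using hfin⟩
  refine Integrable.of_bound (C := C * M) ?_ ?_
  · exact ((hψ.comp measurable_norm).mul hg.measurable).aestronglyMeasurable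
  · filter_upwards [ae_restrict_mem Metric.isClosed_closedBall.measurableSet] with u hu
    rw [norm_mul]
    have h1 := hM u hu
    have h2 := hC ‖u‖
    have h3 := (abs_nonneg (ψ ‖u‖)).trans h2
    exact mul_le_mul h2 h1 (norm_nonneg _) h3

lemma sym_zero (hd : 1 ≤ d) {ψ : ℝ → ℝ} (hψ : Measurable ψ) {C ρ : ℝ} (hC : ∀ r, |ψ r| ≤ C)
    (hρ : ∀ r, ρ < r → ψ r = 0) (v : EucSp d) :
    ∫ u : EucSp d, ψ ‖u‖ * (⟪v, u⟫ ^ 2 - ‖v‖ ^ 2 * ‖u‖ ^ 2 / d) = 0 := by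
  have hI : ∀ v w : EucSp d, ‖v‖ = ‖w‖ →
      ∫ u : EucSp d, ψ ‖u‖ * ⟪v, u⟫ ^ 2 = ∫ u : EucSp d, ψ ‖u‖ * ⟪w, u⟫ ^ 2 := by
    intro v w hvw
    set T := Submodule.reflection (Submodule.span ℝ {v - w})ᗮ with hT
    have hTv : T v = w := Submodule.reflection_sub hvw
    have := T.measurePreserving.integral_comp T.toHomeomorph.measurableEmbedding
      (fun u => ψ ‖u‖ * ⟪w, u⟫ ^ 2)
    rw [← this]
    congr 1
    ext u
    rw [← hTv, LinearIsometryEquiv.inner_map_map, LinearIsometryEquiv.norm_map]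
  have hd' : (0 : ℝ) < d := by exact_mod_cast hd
  have hint : ∀ v : EucSp d, Integrable (fun u : EucSp d => ψ ‖u‖ * ⟪v, u⟫ ^ 2) := fun v =>
    sym_integrable hψ hC hρ (by fun_prop)
  have hint2 : Integrable (fun u : EucSp d => ψ ‖u‖ * ‖u‖ ^ 2) :=
    sym_integrable hψ hC hρ (by fun_prop)
  have hi : ∀ i : Fin d, ∫ u : EucSp d, ψ ‖u‖ * ⟪v, u⟫ ^ 2
      = ‖v‖ ^ 2 * ∫ u : EucSp d, ψ ‖u‖ * (u i) ^ 2 := by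
    intro i
    rw [hI v (‖v‖ • EuclideanSpace.single i (1 : ℝ)) (by simp [norm_smul]), ← integral_const_mul]
    congr 1
    ext u
    rw [inner_smul_left, EuclideanSpace.inner_single_left]
    simp; ring
  have hsum : (d : ℝ) * ∫ u : EucSp d, ψ ‖u‖ * ⟪v, u⟫ ^ 2
      = ‖v‖ ^ 2 * ∫ u : EucSp d, ψ ‖u‖ * ‖u‖ ^ 2 := by
    have h1 : ∑ i : Fin d, ∫ u : EucSp d, ψ ‖u‖ * ⟪v, u⟫ ^ 2
        = ∑ i : Fin d, ‖v‖ ^ 2 * ∫ u : EucSp d, ψ ‖u‖ * (u i) ^ 2 :=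
      Finset.sum_congr rfl fun i _ => hi i
    rw [Finset.sum_const, Finset.card_univ, Fintype.card_fin, nsmul_eq_mul, ← Finset.mul_sum,
      ← integral_finsetSum] at h1
    · rw [h1]
      congr 2
      ext u
      rw [← Finset.mul_sum, EuclideanSpace.norm_sq_eq]
      simp
    · intro i _
      exact sym_integrable hψ hC hρ (by fun_prop)
  have h3 : ∀ u : EucSp d, ψ ‖u‖ * (⟪v, u⟫ ^ 2 - ‖v‖ ^ 2 * ‖u‖ ^ 2 / d)
      = ψ ‖u‖ * ⟪v, u⟫ ^ 2 - (‖v‖ ^ 2 / d) * (ψ ‖u‖ * ‖u‖ ^ 2) := by intro u; ring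
  simp_rw [h3]
  rw [integral_sub (hint v) (hint2.const_mul _), integral_const_mul]
  have : ‖v‖ ^ 2 / d * ∫ u : EucSp d, ψ ‖u‖ * ‖u‖ ^ 2 =
    (1 / d) * (‖v‖ ^ 2 * ∫ u : EucSp d, ψ ‖u‖ * ‖u‖ ^ 2) := by ring
  rw [this, ← hsum]; field_simp; simp

end sym

section tails

/-- tail integral -/
def tailI (j : ℕ) (q A : ℝ) : ℝ :=
  ∫ s in Set.Ioi (0:ℝ), (if A ≤ s then s ^ q else 0) * (s ^ j * Real.exp (-(s / 2)))

lemma tailI_integrable (j : ℕ) {q : ℝ} (hq : 0 ≤ q) (A : ℝ) :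
    IntegrableOn (fun s : ℝ => (if A ≤ s then s ^ q else 0) * (s ^ j * Real.exp (-(s / 2))))
      (Set.Ioi 0) := by
  refine (integrable_gam2 j hq).mono' ?_ ?_
  · have : Measurable (fun s : ℝ => if A ≤ s then s ^ q else 0) :=
      Measurable.ite measurableSet_Ici (by fun_prop) measurable_const
    exact (this.mul (by fun_prop)).aestronglyMeasurable
  · filter_upwards [ae_restrict_mem measurableSet_Ioi] with s hs
    have hs : (0:ℝ) < s := hs
    split_ifs
    · rw [Real.norm_of_nonneg (by positivity)]
    · simp; positivity

lemma tailI_tendsto (j : ℕ) {q : ℝ} (hq : 0 ≤ q) :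
    Tendsto (tailI j q) atTop (𝓝 0) := by
  have h0 : (0 : ℝ) = ∫ s in Set.Ioi (0:ℝ), (0:ℝ) := by simp
  rw [h0]
  unfold tailI
  refine tendsto_integral_filter_of_dominated_convergence
    (fun s => s ^ q * (s ^ j * Real.exp (-(s / 2)))) ?_ ?_ (integrable_gam2 j hq) ?_
  · exact Eventually.of_forall fun A => (tailI_integrable j hq A).aestronglyMeasurable
  · refine Eventually.of_forall fun A => ?_
    filter_upwards [ae_restrict_mem measurableSet_Ioi] with s hs
    have hs : (0:ℝ) < s := hs
    split_ifs
    · rw [Real.norm_of_nonneg (by positivity)]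
    · simp; positivity
  · refine Eventually.of_forall fun s => ?_
    refine tendsto_const_nhds.congr' ?_
    filter_upwards [eventually_gt_atTop s] with A hA
    rw [if_neg (not_le.2 hA), zero_mul]

lemma GoodW.sup_bound {j : ℕ} {c : ℕ → ℝ} {m : ℕ → ℕ} (hg : GoodW j c m) :
    ∃ K : ℝ, 0 < K ∧ ∀ᶠ n in atTop, ∀ t : ℝ, 0 ≤ t → t ≤ 1 →
      wt j (c n) (m n) t ≤ K * n := by
  obtain ⟨K, hK, hb⟩ := hg.bound
  refine ⟨K * (2 ^ j * j.factorial), by positivity, ?_⟩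
  have e2 : ∀ᶠ n : ℕ in atTop, (1 : ℝ) / 2 < (m n : ℝ) / n :=
    hg.mlim.eventually_const_lt (by norm_num)
  filter_upwards [hb, e2, eventually_gt_atTop 0] with n h1 h2 hn t ht0 ht1
  have hn' : (0 : ℝ) < n := by exact_mod_cast hn
  rcases lt_or_eq_of_le ht1 with h | h
  · have h3 := h1 (n * t) (by positivity)
    unfold hw at h3
    rw [if_pos (by nlinarith), mul_div_cancel_left₀ _ hn'.ne'] at h3
    have h4 : (n * t) ^ j * Real.exp (-(n * t / 2)) ≤ 2 ^ j * j.factorial := by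
      have h5 := Real.pow_div_factorial_le_exp (n * t / 2) (by positivity) j
      rw [div_le_iff₀ (by positivity), div_pow, div_le_iff₀ (by positivity)] at h5
      rw [Real.exp_neg, ← div_eq_mul_inv, div_le_iff₀ (Real.exp_pos _)]
      linarith
    have h6 : 1 / (n:ℝ) * wt j (c n) (m n) t ≤ K * (2 ^ j * j.factorial) :=
      h3.trans (by gcongr)
    rw [one_div, inv_mul_le_iff₀ hn'] at h6
    linarith
  · have : m n ≠ 0 := by
      rintro h0
      rw [h0] at h2; norm_num at h2
    unfold wt
    rw [h]; simp [this]; positivity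

end tails

section inner
variable {d : ℕ}

/-- common a priori bound -/
lemma TB {j : ℕ} {c : ℕ → ℝ} {m : ℕ → ℕ} (hg : GoodW j c m) {q : ℝ} (hq : 0 ≤ q)
    (μ : Measure (EucSp d)) [IsProbabilityMeasure μ] (hs : ∀ x r, μ (Metric.sphere x r) = 0) :
    ∃ K : ℝ, 0 < K ∧ ∀ᶠ n : ℕ in atTop, ∀ (x : EucSp d) (e : EucSp d → ℝ) (ε C A : ℝ), 0 ≤ ε → 0 ≤ C →
      (∀ᵐ y ∂μ, |e y| ≤ (ε + C * (if A ≤ n * Fm μ x y then 1 else 0)) * Fm μ x y ^ q) →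
      |∫ y, (n:ℝ) ^ q * e y * wt j (c n) (m n) (Fm μ x y) ∂μ| ≤ K * (ε * tailI j q 0 + C * tailI j q A) := by
  obtain ⟨K, hK, hb⟩ := hg.bound
  refine ⟨K, hK, ?_⟩
  filter_upwards [hb, eventually_gt_atTop 0] with n hn hn0 x e ε C A hε hC he
  have hn' : (0 : ℝ) < n := by exact_mod_cast hn0
  set f : ℝ → ℝ := fun s => (ε + C * (if A ≤ s then 1 else 0)) * s ^ q with hf
  have hind : Measurable (fun s : ℝ => if A ≤ s then (1:ℝ) else 0) :=
      Measurable.ite measurableSet_Ici measurable_const measurable_const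
  have hfm : Measurable f := by
    rw [hf]; fun_prop
  have hi01 : ∀ s : ℝ, 0 ≤ (if A ≤ s then (1:ℝ) else 0) ∧ (if A ≤ s then (1:ℝ) else 0) ≤ 1 := by
    intro s; split_ifs <;> norm_num
  have hf0 : ∀ s, 0 ≤ s → 0 ≤ f s := by
    intro s hs
    have := (hi01 s).1
    positivity
  have hF0 := Fm_nonneg μ x
  have hF1 := Fm_le_one μ x
  have hFm := measurable_Fm μ x
  have hwm := measurable_wt j (c n) (m n)
  have hint : Integrable (fun y => f (n * Fm μ x y) * wt j (c n) (m n) (Fm μ x y)) μ := by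
    refine Integrable.of_bound (C := ((ε + C) * (n:ℝ) ^ q) * c n) ?_ ?_
    · exact ((hfm.comp (hFm.const_mul _)).mul (hwm.comp hFm)).aestronglyMeasurable
    · refine Eventually.of_forall fun y => ?_
      have h1 := wt_nonneg (j := j) (m := m n) (hg.nn n) (hF0 y) (hF1 y)
      have h2 := wt_le (j := j) (m := m n) (hg.nn n) (hF0 y) (hF1 y)
      have h3 := hf0 (n * Fm μ x y) (by have := hF0 y; positivity)
      rw [Real.norm_of_nonneg (by positivity)]
      have h4 := hi01 (n * Fm μ x y)
      have h5 : f (n * Fm μ x y) ≤ (ε + C) * (n:ℝ) ^ q := by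
        rw [hf]
        simp only
        have h6 : (n * Fm μ x y) ^ q ≤ (n:ℝ) ^ q := by
          apply Real.rpow_le_rpow (by have := hF0 y; positivity) _ hq
          nlinarith [hF1 y]
        have h7 : ε + C * (if A ≤ n * Fm μ x y then 1 else 0) ≤ ε + C := by nlinarith [h4.2]
        have h8 : 0 ≤ (n * Fm μ x y) ^ q := by have := hF0 y; positivity
        exact mul_le_mul h7 h6 h8 (by positivity)
      exact mul_le_mul h5 h2 h1 (by positivity)
  have h1 : |∫ y, (n:ℝ) ^ q * e y * wt j (c n) (m n) (Fm μ x y) ∂μ|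
      ≤ ∫ y, f (n * Fm μ x y) * wt j (c n) (m n) (Fm μ x y) ∂μ := by
    rw [← Real.norm_eq_abs]
    apply norm_integral_le_of_norm_le hint
    filter_upwards [he] with y hy
    have h1 := wt_nonneg (j := j) (m := m n) (hg.nn n) (hF0 y) (hF1 y)
    rw [norm_mul, norm_mul, Real.norm_of_nonneg h1, Real.norm_of_nonneg (by positivity : 0 ≤ (n:ℝ) ^ q),
      Real.norm_eq_abs]
    apply mul_le_mul_of_nonneg_right _ h1
    rw [hf]; simp only
    rw [Real.mul_rpow hn'.le (hF0 y)]
    calc (n:ℝ) ^ q * |e y| ≤ (n:ℝ) ^ q * ((ε + C * (if A ≤ n * Fm μ x y then 1 else 0)) * Fm μ x y ^ q) := by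
          gcongr
      _ = _ := by ring
  refine h1.trans ?_
  rw [int_wt μ hs x hn0 hfm hf0 j (hg.nn n) (m n)]
  have hI0 := tailI_integrable j hq 0
  have hIA := tailI_integrable j hq A
  have h2 : K * (ε * tailI j q 0 + C * tailI j q A) = ∫ s in Set.Ioi (0:ℝ),
      K * (ε * ((if 0 ≤ s then s ^ q else 0) * (s ^ j * Real.exp (-(s / 2)))) +
       C * ((if A ≤ s then s ^ q else 0) * (s ^ j * Real.exp (-(s / 2))))) := by
    unfold tailI
    rw [integral_const_mul, integral_add (hI0.const_mul _) (hIA.const_mul _), integral_const_mul,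
      integral_const_mul]
  rw [h2]
  apply integral_mono_of_nonneg
  · filter_upwards [ae_restrict_mem measurableSet_Ioi] with s hs
    have hs : (0:ℝ) < s := hs
    exact mul_nonneg (hf0 s hs.le) (hw_nonneg (hg.nn n) hs.le)
  · exact ((hI0.const_mul ε).add (hIA.const_mul C)).const_mul K
  · filter_upwards [ae_restrict_mem measurableSet_Ioi] with s hs
    have hs : (0:ℝ) < s := hs
    calc f s * hw j (c n) (m n) n s ≤ f s * (K * (s ^ j * Real.exp (-(s / 2)))) :=
          mul_le_mul_of_nonneg_left (hn s hs.le) (hf0 s hs.le)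
      _ = _ := by
          rw [hf]; simp only [hs.le, if_true]
          split_ifs <;> ring

end inner


section inner2
variable {d : ℕ}

/-- volume of the unit ball -/
def omg (d : ℕ) : ℝ := (volume (Metric.closedBall (0 : EucSp d) 1)).toReal

lemma omg_pos (d : ℕ) : 0 < omg d := by
  unfold omg
  exact ENNReal.toReal_pos (Metric.measure_closedBall_pos _ _ one_pos).ne' measure_closedBall_lt_top.ne

lemma vol_cb (x : EucSp d) {r : ℝ} (hr : 0 ≤ r) :
    volume.real (Metric.closedBall x r) = omg d * r ^ d := by
  unfold omg Measure.real
  rw [Measure.addHaar_closedBall' _ _ hr, ENNReal.toReal_mul, ENNReal.toReal_ofReal (by positivity)]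
  simp [mul_comm]

lemma real_ball_eq (μ : Measure (EucSp d)) [IsProbabilityMeasure μ]
    (hs : ∀ x r, μ (Metric.sphere x r) = 0) (x : EucSp d) (r : ℝ) :
    μ.real (Metric.ball x r) = μ.real (Metric.closedBall x r) := by
  apply measureReal_congr
  rw [← Metric.ball_union_sphere]
  have : (Metric.sphere x r : Set (EucSp d)) =ᵐ[μ] (∅ : Set (EucSp d)) := ae_eq_empty.2 (hs x r)
  simpa using ((ae_eq_refl (Metric.ball x r)).union this).symm

lemma real_cb_eq {κ : EucSp d → ℝ} (hκm : Measurable κ) (hκ0 : ∀ x, 0 ≤ κ x)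
    (μ : Measure (EucSp d)) (hμ : μ = volume.withDensity fun x => ENNReal.ofReal (κ x))
    (s : Set (EucSp d)) (hs : MeasurableSet s) : μ.real s = ∫ y in s, κ y := by
  rw [hμ, Measure.real, withDensity_apply _ hs, integral_eq_lintegral_of_nonneg_ae
    (Eventually.of_forall hκ0) hκm.aestronglyMeasurable]

lemma κ_integrable {κ : EucSp d → ℝ} (hκm : Measurable κ) (hκ0 : ∀ x, 0 ≤ κ x)
    (μ : Measure (EucSp d)) [IsProbabilityMeasure μ]
    (hμ : μ = volume.withDensity fun x => ENNReal.ofReal (κ x)) : Integrable κ := by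
  refine ⟨hκm.aestronglyMeasurable, ?_⟩
  rw [hasFiniteIntegral_iff_ofReal (Eventually.of_forall hκ0)]
  have : μ Set.univ = ∫⁻ x, ENNReal.ofReal (κ x) := by
    rw [hμ, withDensity_apply _ MeasurableSet.univ, Measure.restrict_univ]
  rw [← this]; exact measure_lt_top _ _

lemma int_μ {κ : EucSp d → ℝ} (hκm : Measurable κ) (hκ0 : ∀ x, 0 ≤ κ x)
    (μ : Measure (EucSp d)) (hμ : μ = volume.withDensity fun x => ENNReal.ofReal (κ x))
    (f : EucSp d → ℝ) : ∫ y, f y ∂μ = ∫ y, κ y * f y := by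
  rw [hμ, integral_withDensity_eq_integral_toReal_smul hκm.ennreal_ofReal
    (Eventually.of_forall fun x => ENNReal.ofReal_lt_top)]
  congr 1
  ext y
  rw [ENNReal.toReal_ofReal (hκ0 y), smul_eq_mul]

/-- mean oscillation integral -/
lemma osc_eq {κ : EucSp d → ℝ} (x : EucSp d) {r : ℝ} (hr : 0 < r) :
    ∫ y in Metric.closedBall x r, ‖κ y - κ x‖ =
      omg d * r ^ d * ⨍ y in Metric.closedBall x r, ‖κ y - κ x‖ := by
  rw [setAverage_eq, vol_cb x hr.le, smul_eq_mul]
  have := omg_pos d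
  field_simp

lemma ratio {κ : EucSp d → ℝ} (hκm : Measurable κ) (hκ0 : ∀ x, 0 ≤ κ x)
    (μ : Measure (EucSp d)) [IsProbabilityMeasure μ]
    (hμ : μ = volume.withDensity fun x => ENNReal.ofReal (κ x))
    (hs : ∀ x r, μ (Metric.sphere x r) = 0) (x : EucSp d)
    (hL : Tendsto (fun r => ⨍ y in Metric.closedBall x r, ‖κ y - κ x‖) (𝓝[>] 0) (𝓝 0)) :
    Tendsto (fun r => μ.real (Metric.ball x r) / (omg d * r ^ d)) (𝓝[>] 0) (𝓝 (κ x)) := by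
  rw [tendsto_iff_norm_sub_tendsto_zero]
  refine squeeze_zero' (Eventually.of_forall fun r => norm_nonneg _) ?_ hL
  filter_upwards [self_mem_nhdsWithin] with r hr
  have hr : 0 < r := hr
  have ho := omg_pos d
  have hκi := κ_integrable hκm hκ0 μ hμ
  rw [real_ball_eq μ hs, real_cb_eq hκm hκ0 μ hμ _ Metric.isClosed_closedBall.measurableSet]
  have hfin : volume (Metric.closedBall x r) < ⊤ := measure_closedBall_lt_top
  have h1 : ∫ y in Metric.closedBall x r, (κ y - κ x) =
      (∫ y in Metric.closedBall x r, κ y) - omg d * r ^ d * κ x := by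
    rw [integral_sub hκi.integrableOn (integrableOn_const hfin.ne), setIntegral_const, vol_cb x hr.le,
      smul_eq_mul]
  have h2 := norm_integral_le_integral_norm (μ := volume.restrict (Metric.closedBall x r))
    (fun y => κ y - κ x)
  rw [h1, osc_eq x hr] at h2
  have h3 : (∫ y in Metric.closedBall x r, κ y) / (omg d * r ^ d) - κ x =
      ((∫ y in Metric.closedBall x r, κ y) - omg d * r ^ d * κ x) / (omg d * r ^ d) := by
    field_simp
  rw [h3, norm_div, Real.norm_of_nonneg (by positivity : 0 ≤ omg d * r ^ d),
    div_le_iff₀ (by positivity)]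
  linarith

lemma sq_le_rpow (hd : 1 ≤ d) {c' r F : ℝ} (hc' : 0 < c') (hr : 0 ≤ r) (h : c' * r ^ d ≤ F) :
    r ^ 2 ≤ (1 / c') ^ (2 / (d:ℝ)) * F ^ (2 / (d:ℝ)) := by
  have hd' : (d : ℝ) ≠ 0 := by positivity
  have hF : 0 ≤ F := le_trans (by positivity) h
  rw [← Real.mul_rpow (by positivity) hF]
  have h1 : r ^ 2 = (r ^ d) ^ (2 / (d:ℝ)) := by
    rw [← Real.rpow_natCast r d, ← Real.rpow_mul hr, mul_div_cancel₀ _ hd']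
    norm_num
  rw [h1]
  apply Real.rpow_le_rpow (by positivity) _ (by positivity)
  rw [one_div, le_inv_mul_iff₀ hc']; exact h

lemma n_pow (hd : 1 ≤ d) {n : ℕ} (hn : 0 < n) : ((n:ℝ) ^ (-1 / (d:ℝ))) ^ d = 1 / n := by
  have hd' : (d : ℝ) ≠ 0 := by positivity
  rw [← Real.rpow_natCast, ← Real.rpow_mul (by positivity), div_mul_cancel₀ _ hd', Real.rpow_neg_one,
    one_div]

lemma n_sq {n : ℕ} (hn : 0 < n) : (n:ℝ) ^ (2 / (d:ℝ)) * ((n:ℝ) ^ (-1 / (d:ℝ))) ^ 2 = 1 := by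
  have hn' : (0:ℝ) < n := by exact_mod_cast hn
  rw [← Real.rpow_natCast ((n:ℝ) ^ (-1 / (d:ℝ))), ← Real.rpow_mul hn'.le, ← Real.rpow_add hn']
  have : 2 / (d:ℝ) + -1 / (d:ℝ) * ((2:ℕ):ℝ) = 0 := by push_cast; ring
  rw [this, Real.rpow_zero]

lemma n_tendsto (hd : 1 ≤ d) : Tendsto (fun n : ℕ => (n:ℝ) ^ (-1 / (d:ℝ))) atTop (𝓝 0) := by
  have hd' : (0 : ℝ) < d := by exact_mod_cast hd
  have := ((tendsto_rpow_neg_atTop (y := 1 / (d:ℝ)) (by positivity)).comp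
    (tendsto_natCast_atTop_atTop (R := ℝ)))
  simpa [Function.comp_def, neg_div] using this

/-- functions that are `o(r²)` contribute nothing -/
lemma L0 (hd : 1 ≤ d) {j : ℕ} {c : ℕ → ℝ} {m : ℕ → ℕ} (hg : GoodW j c m)
    (μ : Measure (EucSp d)) [IsProbabilityMeasure μ] (hs : ∀ x r, μ (Metric.sphere x r) = 0)
    {Ωs : Set (EucSp d)} (hΩ : ∀ᵐ y ∂μ, y ∈ Ωs) (x : EucSp d) {c' : ℝ} (hc' : 0 < c')
    (hF : ∀ y ∈ Ωs, c' * dist y x ^ d ≤ Fm μ x y)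
    {e : EucSp d → ℝ} {C : ℝ} (hC0 : 0 ≤ C) (hC : ∀ y ∈ Ωs, |e y| ≤ C * dist y x ^ 2)
    (hsm : ∀ ε > 0, ∃ δ > 0, ∀ y ∈ Ωs, dist y x ≤ δ → |e y| ≤ ε * dist y x ^ 2) :
    Tendsto (fun n : ℕ => ∫ y, (n:ℝ) ^ (2 / (d:ℝ)) * e y * wt j (c n) (m n) (Fm μ x y) ∂μ)
      atTop (𝓝 0) := by
  have hq : 0 ≤ 2 / (d:ℝ) := by positivity
  obtain ⟨K, hK, hTB⟩ := TB hg hq μ hs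
  set C0 := (1 / c') ^ (2 / (d:ℝ)) with hC0def
  have hC0pos : 0 < C0 := by positivity
  set I0 := tailI j (2 / (d:ℝ)) 0
  have hI0 : 0 ≤ I0 := by
    apply setIntegral_nonneg measurableSet_Ioi
    intro s hs
    have hs : (0:ℝ) < s := hs
    simp only [hs.le, if_true]; positivity
  rw [Metric.tendsto_atTop']
  suffices H : ∀ ε > 0, ∀ᶠ n : ℕ in atTop,
      |∫ y, (n:ℝ) ^ (2 / (d:ℝ)) * e y * wt j (c n) (m n) (Fm μ x y) ∂μ| ≤ K * (ε * I0) + ε by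
    intro η hη
    have hε : 0 < η / (2 * (K * I0 + 1)) := by positivity
    obtain ⟨N, hN⟩ := eventually_atTop.1 (H _ hε)
    refine ⟨N, fun n hn => ?_⟩
    rw [Real.dist_eq, sub_zero]
    refine (hN n hn.le).trans_lt ?_
    have : K * (η / (2 * (K * I0 + 1)) * I0) + η / (2 * (K * I0 + 1)) = η / 2 := by
      field_simp
    rw [this]; linarith
  intro ε hε
  obtain ⟨δ, hδ, hδ2⟩ := hsm (ε / C0) (by positivity)
  have hA : Tendsto (fun n : ℕ => (n:ℝ) * (c' * δ ^ d)) atTop atTop :=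
    tendsto_natCast_atTop_atTop.atTop_mul_const (by positivity)
  have htail := (tailI_tendsto j hq).comp hA
  have htail2 : Tendsto (fun n : ℕ => K * (C * C0 * tailI j (2 / (d:ℝ)) ((n:ℝ) * (c' * δ ^ d)))) atTop
      (𝓝 (K * (C * C0 * 0))) := (htail.const_mul _).const_mul _
  rw [mul_zero, mul_zero] at htail2
  filter_upwards [hTB, htail2.eventually_lt_const hε] with n h1 h2
  have h3 := h1 x e ε (C * C0) ((n:ℝ) * (c' * δ ^ d)) hε.le (by positivity) ?_
  · refine h3.trans ?_
    rw [mul_add]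
    linarith
  · filter_upwards [hΩ] with y hy
    have h4 := sq_le_rpow hd hc' dist_nonneg (hF y hy)
    have hFq : 0 ≤ Fm μ x y ^ (2 / (d:ℝ)) := by have := Fm_nonneg μ x y; positivity
    rcases le_or_gt (dist y x) δ with h | h
    · refine (hδ2 y hy h).trans ?_
      calc ε / C0 * dist y x ^ 2 ≤ ε / C0 * (C0 * Fm μ x y ^ (2 / (d:ℝ))) := by gcongr
        _ = ε * Fm μ x y ^ (2 / (d:ℝ)) := by field_simp
        _ ≤ _ := by
          apply mul_le_mul_of_nonneg_right _ hFq
          have : 0 ≤ C * C0 * (if (n:ℝ) * (c' * δ ^ d) ≤ n * Fm μ x y then 1 else 0) := by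
            split_ifs <;> positivity
          linarith
    · have h5 : (n:ℝ) * (c' * δ ^ d) ≤ n * Fm μ x y := by
        apply mul_le_mul_of_nonneg_left _ (by positivity)
        refine le_trans ?_ (hF y hy)
        gcongr
      rw [if_pos h5, mul_one]
      refine (hC y hy).trans ?_
      calc C * dist y x ^ 2 ≤ C * (C0 * Fm μ x y ^ (2 / (d:ℝ))) := by gcongr
        _ ≤ _ := by nlinarith

end inner2


section inner3
variable {d : ℕ}

lemma Bq_le (hd : 1 ≤ d) (v u : EucSp d) :
    |⟪v, u⟫ ^ 2 - ‖v‖ ^ 2 * ‖u‖ ^ 2 / d| ≤ ‖v‖ ^ 2 * ‖u‖ ^ 2 := by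
  have h1 : ⟪v, u⟫ ^ 2 ≤ ‖v‖ ^ 2 * ‖u‖ ^ 2 := by
    rw [← mul_pow, ← sq_abs ⟪v, u⟫]
    exact pow_le_pow_left₀ (abs_nonneg _) (abs_real_inner_le_norm v u) 2
  have h2 : ‖v‖ ^ 2 * ‖u‖ ^ 2 / d ≤ ‖v‖ ^ 2 * ‖u‖ ^ 2 :=
    div_le_self (by positivity) (by exact_mod_cast hd)
  have h3 : 0 ≤ ‖v‖ ^ 2 * ‖u‖ ^ 2 / d := by positivity
  rw [abs_le]
  constructor
  · have := sq_nonneg ⟪v, u⟫; linarith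
  · linarith

lemma measurable_ballreal (μ : Measure (EucSp d)) [IsProbabilityMeasure μ] (x : EucSp d) :
    Measurable (fun r : ℝ => μ.real (Metric.ball x r)) := by
  apply Monotone.measurable
  intro r s hrs
  exact measureReal_mono (Metric.ball_subset_ball hrs)

lemma wt_abs_le {j : ℕ} {c : ℝ} (hc : 0 ≤ c) {m : ℕ} {t : ℝ} (h0 : 0 ≤ t) (h1 : t ≤ 1) :
    |wt j c m t| ≤ c := by
  rw [abs_of_nonneg (wt_nonneg hc h0 h1)]; exact wt_le hc h0 h1

lemma I2_inside (hd : 1 ≤ d) {j : ℕ} {c : ℕ → ℝ} {m : ℕ → ℕ} (hg : GoodW j c m)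
    {κ : EucSp d → ℝ} (hκm : Measurable κ) (hκ0 : ∀ x, 0 ≤ κ x)
    (μ : Measure (EucSp d)) [IsProbabilityMeasure μ]
    (hμ : μ = volume.withDensity fun x => ENNReal.ofReal (κ x))
    (x v : EucSp d)
    (hL : Tendsto (fun r => ⨍ y in Metric.closedBall x r, ‖κ y - κ x‖) (𝓝[>] 0) (𝓝 0))
    {R : ℝ} (hR : 0 < R) :
    Tendsto (fun n : ℕ => ∫ y, (n:ℝ) ^ (2 / (d:ℝ)) *
        (if dist y x ≤ R * (n:ℝ) ^ (-1 / (d:ℝ)) then ⟪v, y - x⟫ ^ 2 - ‖v‖ ^ 2 * ‖y - x‖ ^ 2 / d else 0)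
          * wt j (c n) (m n) (Fm μ x y) ∂μ) atTop (𝓝 0) := by
  obtain ⟨K, hK, hsup⟩ := hg.sup_bound
  have hκi := κ_integrable hκm hκ0 μ hμ
  have hρt : Tendsto (fun n : ℕ => R * (n:ℝ) ^ (-1 / (d:ℝ))) atTop (𝓝[>] 0) := by
    refine tendsto_nhdsWithin_iff.2 ⟨by simpa using (n_tendsto hd).const_mul R, ?_⟩
    filter_upwards [eventually_gt_atTop 0] with n hn
    have : (0:ℝ) < n := by exact_mod_cast hn
    rw [Set.mem_Ioi]
    positivity
  have hlim : Tendsto (fun n : ℕ => (‖v‖ ^ 2 * R ^ 2 * K * (omg d * R ^ d)) *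
      ⨍ y in Metric.closedBall x (R * (n:ℝ) ^ (-1 / (d:ℝ))), ‖κ y - κ x‖) atTop (𝓝 0) := by
    have := (hL.comp hρt).const_mul (‖v‖ ^ 2 * R ^ 2 * K * (omg d * R ^ d))
    rw [mul_zero] at this
    exact this
  refine squeeze_zero_norm' ?_ hlim
  filter_upwards [hsup, eventually_gt_atTop 0] with n hn hn0
  have hn' : (0:ℝ) < n := by exact_mod_cast hn0
  set ρ := R * (n:ℝ) ^ (-1 / (d:ℝ)) with hρ
  have hρ0 : 0 < ρ := by positivity
  set φ : EucSp d → ℝ := fun y => (n:ℝ) ^ (2 / (d:ℝ)) *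
        (if dist y x ≤ ρ then ⟪v, y - x⟫ ^ 2 - ‖v‖ ^ 2 * ‖y - x‖ ^ 2 / d else 0)
          * wt j (c n) (m n) (Fm μ x y) with hφ
  set ψ : ℝ → ℝ := fun r => if r ≤ ρ then (n:ℝ) ^ (2 / (d:ℝ)) * wt j (c n) (m n) (μ.real (Metric.ball x r)) else 0
    with hψ
  have hψm : Measurable ψ := by
    refine Measurable.ite measurableSet_Iic ?_ measurable_const
    exact ((measurable_wt j (c n) (m n)).comp (measurable_ballreal μ x)).const_mul _
  have hψb : ∀ r, |ψ r| ≤ (n:ℝ) ^ (2 / (d:ℝ)) * c n := by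
    intro r
    simp only [hψ]
    have := hg.nn n
    split_ifs
    · rw [abs_mul, abs_of_nonneg (by positivity : 0 ≤ (n:ℝ) ^ (2 / (d:ℝ)))]
      gcongr
      exact wt_abs_le (hg.nn n) measureReal_nonneg measureReal_le_one
    · rw [abs_zero]; positivity
  have hψ0 : ∀ r, ρ < r → ψ r = 0 := fun r hr => if_neg (not_le.2 hr)
  have hφψ : ∀ y, φ y = ψ ‖y - x‖ * (⟪v, y - x⟫ ^ 2 - ‖v‖ ^ 2 * ‖y - x‖ ^ 2 / d) := by
    intro y
    simp only [hφ, hψ, Fm, dist_eq_norm]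
    split_ifs <;> ring
  have hφint : Integrable φ := by
    have h1 := sym_integrable hψm hψb hψ0 (g := fun u : EucSp d => ⟪v, u⟫ ^ 2 - ‖v‖ ^ 2 * ‖u‖ ^ 2 / d)
      (by fun_prop)
    have h2 := h1.comp_sub_right x
    refine h2.congr (Eventually.of_forall fun y => (hφψ y).symm)
  have hφ0 : ∫ y, φ y = 0 := by
    rw [← sym_zero hd hψm hψb hψ0 v,
      ← integral_sub_right_eq_self (fun u : EucSp d => ψ ‖u‖ * (⟪v, u⟫ ^ 2 - ‖v‖ ^ 2 * ‖u‖ ^ 2 / d)) x]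
    exact integral_congr_ae (Eventually.of_forall fun y => hφψ y)
  have hnsq := n_sq (d := d) hn0
  have hφb : ∀ y, |φ y| ≤ (‖v‖ ^ 2 * R ^ 2 * K * n) * (Metric.closedBall x ρ).indicator (fun _ => 1) y := by
    intro y
    by_cases hy : dist y x ≤ ρ
    · rw [Set.indicator_of_mem (Metric.mem_closedBall.2 hy), mul_one]
      simp only [hφ, if_pos hy]
      rw [abs_mul, abs_mul, abs_of_nonneg (by positivity : 0 ≤ (n:ℝ) ^ (2 / (d:ℝ))),
        abs_of_nonneg (wt_nonneg (hg.nn n) (Fm_nonneg μ x y) (Fm_le_one μ x y))]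
      have h1 := Bq_le hd v (y - x)
      have h2 := hn (Fm μ x y) (Fm_nonneg μ x y) (Fm_le_one μ x y)
      have h3 : ‖y - x‖ ≤ ρ := by rwa [← dist_eq_norm]
      have h4 : wt j (c n) (m n) (Fm μ x y) ≥ 0 := wt_nonneg (hg.nn n) (Fm_nonneg μ x y) (Fm_le_one μ x y)
      calc _ ≤ (n:ℝ) ^ (2 / (d:ℝ)) * (‖v‖ ^ 2 * ρ ^ 2) * (K * n) := by
            gcongr
            exact h1.trans (by gcongr)
        _ = ((n:ℝ) ^ (2 / (d:ℝ)) * ((n:ℝ) ^ (-1 / (d:ℝ))) ^ 2) * (‖v‖ ^ 2 * R ^ 2 * K * n) := by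
            rw [hρ]; ring
        _ = _ := by rw [hnsq, one_mul]
    · have : y ∉ Metric.closedBall x ρ := by simpa using hy
      rw [Set.indicator_of_notMem this]
      simp [hφ, hy]
  have hφm : Measurable φ := by
    have h1 : φ = fun y => ψ ‖y - x‖ * (⟪v, y - x⟫ ^ 2 - ‖v‖ ^ 2 * ‖y - x‖ ^ 2 / d) := funext hφψ
    rw [h1]
    have h2 : Measurable fun y : EucSp d => ψ ‖y - x‖ := hψm.comp (by fun_prop)
    exact h2.mul (by fun_prop)
  have hκφ : Integrable fun y => κ y * φ y := by
    refine (hκi.bdd_mul (c := ‖v‖ ^ 2 * R ^ 2 * K * n) hφm.aestronglyMeasurable ?_).congr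
      (Eventually.of_forall fun y => mul_comm _ _)
    refine Eventually.of_forall fun y => (hφb y).trans ?_
    have : (Metric.closedBall x ρ).indicator (fun _ => (1:ℝ)) y ≤ 1 :=
      Set.indicator_le_self' (fun _ _ => zero_le_one) y
    exact mul_le_of_le_one_right (by positivity) this
  have h5 : ∫ y, φ y ∂μ = ∫ y, (κ y - κ x) * φ y := by
    rw [int_μ hκm hκ0 μ hμ]
    simp_rw [sub_mul]
    rw [integral_sub hκφ (hφint.const_mul _), integral_const_mul, hφ0]
    ring
  rw [h5]
  have h6 : ∀ y, ‖(κ y - κ x) * φ y‖ ≤ (‖v‖ ^ 2 * R ^ 2 * K * n) *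
      (Metric.closedBall x ρ).indicator (fun y => ‖κ y - κ x‖) y := by
    intro y
    rw [norm_mul]
    have := hφb y
    by_cases hy : y ∈ Metric.closedBall x ρ
    · rw [Set.indicator_of_mem hy] at this ⊢
      rw [mul_one] at this
      rw [mul_comm]
      exact mul_le_mul_of_nonneg_right this (norm_nonneg _)
    · rw [Set.indicator_of_notMem hy] at this ⊢
      rw [mul_zero] at this ⊢
      rw [abs_nonpos_iff.1 this]; simp
  have hosc : IntegrableOn (fun y => ‖κ y - κ x‖) (Metric.closedBall x ρ) :=
    (hκi.integrableOn.sub (integrableOn_const measure_closedBall_lt_top.ne)).norm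
  refine (norm_integral_le_of_norm_le
    ((hosc.integrable_indicator Metric.isClosed_closedBall.measurableSet).const_mul _)
    (Eventually.of_forall h6)).trans ?_
  rw [integral_const_mul, integral_indicator Metric.isClosed_closedBall.measurableSet, osc_eq x hρ0]
  have h7 : ρ ^ d = R ^ d * (1 / n) := by rw [hρ, mul_pow, n_pow hd hn0]
  rw [h7]
  apply le_of_eq
  field_simp

lemma tailI_nonneg (j : ℕ) (q A : ℝ) : 0 ≤ tailI j q A := by
  apply setIntegral_nonneg measurableSet_Ioi
  intro s hs
  have hs : (0:ℝ) < s := hs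
  split_ifs <;> positivity

lemma int_bdd (μ : Measure (EucSp d)) [IsProbabilityMeasure μ] {j : ℕ} {c : ℝ} (hc : 0 ≤ c) (m : ℕ)
    (x : EucSp d) (a : ℝ) {f : EucSp d → ℝ} (hf : Measurable f) {C : ℝ} (hC : ∀ᵐ y ∂μ, |f y| ≤ C) :
    Integrable (fun y => a * f y * wt j c m (Fm μ x y)) μ := by
  have hm : Measurable fun y => wt j c m (Fm μ x y) := (measurable_wt j c m).comp (measurable_Fm μ x)
  refine Integrable.of_bound ((hf.const_mul a).mul hm).aestronglyMeasurable (|a| * C * c) ?_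
  filter_upwards [hC] with y hy
  rw [norm_mul, norm_mul, Real.norm_eq_abs, Real.norm_eq_abs, Real.norm_eq_abs]
  have := wt_abs_le (j := j) hc (m := m) (Fm_nonneg μ x y) (Fm_le_one μ x y)
  have h0 : 0 ≤ C := (abs_nonneg _).trans hy
  gcongr

lemma I2 (hd : 1 ≤ d) {j : ℕ} {c : ℕ → ℝ} {m : ℕ → ℕ} (hg : GoodW j c m)
    {κ : EucSp d → ℝ} (hκm : Measurable κ) (hκ0 : ∀ x, 0 ≤ κ x)
    (μ : Measure (EucSp d)) [IsProbabilityMeasure μ]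
    (hμ : μ = volume.withDensity fun x => ENNReal.ofReal (κ x))
    (hs : ∀ x r, μ (Metric.sphere x r) = 0)
    {Ωs : Set (EucSp d)} (hΩ : ∀ᵐ y ∂μ, y ∈ Ωs) (x v : EucSp d) {c' : ℝ} (hc' : 0 < c')
    (hF : ∀ y ∈ Ωs, c' * dist y x ^ d ≤ Fm μ x y)
    (hL : Tendsto (fun r => ⨍ y in Metric.closedBall x r, ‖κ y - κ x‖) (𝓝[>] 0) (𝓝 0)) :
    Tendsto (fun n : ℕ => ∫ y, (n:ℝ) ^ (2 / (d:ℝ)) *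
        (⟪v, y - x⟫ ^ 2 - ‖v‖ ^ 2 * ‖y - x‖ ^ 2 / d)
          * wt j (c n) (m n) (Fm μ x y) ∂μ) atTop (𝓝 0) := by
  have hq : 0 ≤ 2 / (d:ℝ) := by positivity
  obtain ⟨K, hK, hTB⟩ := TB hg hq μ hs
  set C0 := (1 / c') ^ (2 / (d:ℝ)) with hC0def
  have hC0pos : 0 < C0 := by positivity
  have hr2 : ∀ y ∈ Ωs, ‖y - x‖ ^ 2 ≤ C0 * Fm μ x y ^ (2 / (d:ℝ)) := by
    intro y hy
    rw [← dist_eq_norm]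
    exact sq_le_rpow hd hc' dist_nonneg (hF y hy)
  have hBb : ∀ᵐ y ∂μ, |⟪v, y - x⟫ ^ 2 - ‖v‖ ^ 2 * ‖y - x‖ ^ 2 / d| ≤ ‖v‖ ^ 2 * (C0 * 1) := by
    filter_upwards [hΩ] with y hy
    refine (Bq_le hd v (y - x)).trans ?_
    gcongr
    refine (hr2 y hy).trans ?_
    gcongr
    exact Real.rpow_le_one (Fm_nonneg μ x y) (Fm_le_one μ x y) hq
  have hBm : Measurable fun y : EucSp d => ⟪v, y - x⟫ ^ 2 - ‖v‖ ^ 2 * ‖y - x‖ ^ 2 / d := by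
    fun_prop
  rw [Metric.tendsto_atTop']
  suffices H : ∀ ε > 0, ∀ᶠ n : ℕ in atTop,
      |∫ y, (n:ℝ) ^ (2 / (d:ℝ)) * (⟪v, y - x⟫ ^ 2 - ‖v‖ ^ 2 * ‖y - x‖ ^ 2 / d)
        * wt j (c n) (m n) (Fm μ x y) ∂μ| < ε by
    intro η hη
    obtain ⟨N, hN⟩ := eventually_atTop.1 (H _ hη)
    refine ⟨N, fun n hn => ?_⟩
    rw [Real.dist_eq, sub_zero]
    exact hN n hn.le
  intro ε hε
  -- choose R
  have hA : Tendsto (fun R : ℝ => c' * R ^ d) atTop atTop :=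
    (tendsto_pow_atTop (by omega)).const_mul_atTop hc'
  have htail := ((tailI_tendsto j hq).comp hA).const_mul (K * (‖v‖ ^ 2 * C0))
  rw [mul_zero] at htail
  obtain ⟨R, hR1, hR⟩ := ((htail.eventually_lt_const (half_pos hε)).and (eventually_gt_atTop 0)).exists
  have hin := I2_inside hd hg hκm hκ0 μ hμ x v hL hR
  have hin' := (Metric.tendsto_atTop'.1 hin) (ε / 2) (half_pos hε)
  obtain ⟨N, hN⟩ := hin'
  filter_upwards [hTB, eventually_gt_atTop N, eventually_gt_atTop 0] with n h1 hnN hn0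
  have h2 := hN n hnN
  rw [Real.dist_eq, sub_zero] at h2
  have hn' : (0:ℝ) < n := by exact_mod_cast hn0
  set ρ := R * (n:ℝ) ^ (-1 / (d:ℝ)) with hρ
  have hSm : MeasurableSet {y : EucSp d | dist y x ≤ ρ} := Metric.isClosed_closedBall.measurableSet
  have h3 := h1 x (fun y => if dist y x ≤ ρ then 0 else ⟪v, y - x⟫ ^ 2 - ‖v‖ ^ 2 * ‖y - x‖ ^ 2 / d)
    0 (‖v‖ ^ 2 * C0) (c' * R ^ d) le_rfl (by positivity) ?_
  · have hsplit : (fun y => (n:ℝ) ^ (2 / (d:ℝ)) * (⟪v, y - x⟫ ^ 2 - ‖v‖ ^ 2 * ‖y - x‖ ^ 2 / d)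
        * wt j (c n) (m n) (Fm μ x y)) = fun y =>
        (n:ℝ) ^ (2 / (d:ℝ)) *
        (if dist y x ≤ ρ then ⟪v, y - x⟫ ^ 2 - ‖v‖ ^ 2 * ‖y - x‖ ^ 2 / d else 0)
          * wt j (c n) (m n) (Fm μ x y) + (n:ℝ) ^ (2 / (d:ℝ)) *
        (if dist y x ≤ ρ then 0 else ⟪v, y - x⟫ ^ 2 - ‖v‖ ^ 2 * ‖y - x‖ ^ 2 / d)
          * wt j (c n) (m n) (Fm μ x y) := by
      ext y; split_ifs <;> ring
    rw [hsplit, integral_add]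
    · refine (abs_add_le _ _).trans_lt ?_
      have : K * (0 * tailI j (2 / (d:ℝ)) 0 + ‖v‖ ^ 2 * C0 * tailI j (2 / (d:ℝ)) (c' * R ^ d)) < ε / 2 := by
        refine lt_of_eq_of_lt ?_ hR1
        simp only [Function.comp_def]; ring
      linarith
    · refine int_bdd μ (hg.nn n) (m n) x _ (C := ‖v‖ ^ 2 * (C0 * 1)) (Measurable.ite hSm hBm measurable_const) ?_
      filter_upwards [hBb] with y hy
      split_ifs
      · exact hy
      · rw [abs_zero]; positivity
    · refine int_bdd μ (hg.nn n) (m n) x _ (C := ‖v‖ ^ 2 * (C0 * 1)) (Measurable.ite hSm measurable_const hBm) ?_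
      filter_upwards [hBb] with y hy
      split_ifs
      · rw [abs_zero]; positivity
      · exact hy
  · filter_upwards [hΩ] with y hy
    have hFq : 0 ≤ Fm μ x y ^ (2 / (d:ℝ)) := by have := Fm_nonneg μ x y; positivity
    by_cases h : dist y x ≤ ρ
    · simp only [if_pos h, abs_zero]
      apply mul_nonneg _ hFq
      split_ifs <;> positivity
    · simp only [if_neg h]
      have h5 : c' * R ^ d ≤ n * Fm μ x y := by
        have h6 : R ^ d = n * ρ ^ d := by
          rw [hρ, mul_pow, n_pow hd hn0]; field_simp
        rw [h6]
        calc c' * (n * ρ ^ d) = n * (c' * ρ ^ d) := by ring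
          _ ≤ n * (c' * dist y x ^ d) := by
            have := not_le.1 h
            have hρ0 : 0 < ρ := by positivity
            gcongr
          _ ≤ _ := by gcongr; exact hF y hy
      rw [if_pos h5, mul_one, zero_add]
      refine (Bq_le hd v (y - x)).trans ?_
      rw [mul_assoc]
      gcongr
      exact hr2 y hy

end inner3


section inner4
variable {d : ℕ}

lemma ratio_dev (hd : 1 ≤ d) {κ : EucSp d → ℝ} (hκm : Measurable κ) (hκ0 : ∀ x, 0 ≤ κ x)
    (μ : Measure (EucSp d)) [IsProbabilityMeasure μ]
    (hμ : μ = volume.withDensity fun x => ENNReal.ofReal (κ x))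
    (hs : ∀ x r, μ (Metric.sphere x r) = 0) (x : EucSp d) (hx : 0 < κ x)
    (hL : Tendsto (fun r => ⨍ y in Metric.closedBall x r, ‖κ y - κ x‖) (𝓝[>] 0) (𝓝 0)) :
    ∀ ε > 0, ∃ δ > 0, ∀ y, dist y x ≤ δ →
      |dist y x ^ 2 - (κ x * omg d) ^ (-(2 / (d:ℝ))) * Fm μ x y ^ (2 / (d:ℝ))| ≤ ε * dist y x ^ 2 := by
  intro ε hε
  have ho := omg_pos d
  have hd' : (0:ℝ) < d := by exact_mod_cast hd
  have hq : 0 < 2 / (d:ℝ) := by positivity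
  have h1 := ratio hκm hκ0 μ hμ hs x hL
  have h2 : Tendsto (fun r => 1 - (κ x * omg d) ^ (-(2 / (d:ℝ))) *
      (μ.real (Metric.ball x r) / (omg d * r ^ d) * omg d) ^ (2 / (d:ℝ))) (𝓝[>] 0)
      (𝓝 (1 - (κ x * omg d) ^ (-(2 / (d:ℝ))) * (κ x * omg d) ^ (2 / (d:ℝ)))) := by
    refine tendsto_const_nhds.sub (Tendsto.const_mul _ ?_)
    exact (h1.mul_const _).rpow_const (Or.inr hq.le)
  have h3 : 1 - (κ x * omg d) ^ (-(2 / (d:ℝ))) * (κ x * omg d) ^ (2 / (d:ℝ)) = 0 := by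
    rw [← Real.rpow_add (by positivity)]; simp
  rw [h3] at h2
  have h4 := (Metric.tendsto_nhdsWithin_nhds.1 h2) ε hε
  obtain ⟨δ, hδ, h5⟩ := h4
  refine ⟨δ / 2, by positivity, fun y hy => ?_⟩
  rcases eq_or_lt_of_le (dist_nonneg (x := y) (y := x)) with h0 | h0
  · have : Fm μ x y = 0 := by simp [Fm, ← h0]
    rw [this, ← h0, Real.zero_rpow hq.ne']; simp
  · have h6 := h5 (show dist y x ∈ Set.Ioi 0 from h0) (by
      rw [Real.dist_eq, sub_zero, abs_of_pos h0]; linarith)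
    rw [Real.dist_eq, sub_zero] at h6
    set r := dist y x with hr
    have h7 : Fm μ x y = (μ.real (Metric.ball x r) / (omg d * r ^ d) * omg d) * r ^ d := by
      unfold Fm; rw [← hr]; field_simp
    have h8 : Fm μ x y ^ (2 / (d:ℝ)) =
        (μ.real (Metric.ball x r) / (omg d * r ^ d) * omg d) ^ (2 / (d:ℝ)) * r ^ 2 := by
      rw [h7, Real.mul_rpow (by positivity) (by positivity)]
      congr 1
      rw [← Real.rpow_natCast r d, ← Real.rpow_mul h0.le, mul_div_cancel₀ _ hd'.ne']
      norm_num
    rw [h8]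
    have h9 : r ^ 2 - (κ x * omg d) ^ (-(2 / (d:ℝ))) *
        ((μ.real (Metric.ball x r) / (omg d * r ^ d) * omg d) ^ (2 / (d:ℝ)) * r ^ 2) =
        (1 - (κ x * omg d) ^ (-(2 / (d:ℝ))) *
      (μ.real (Metric.ball x r) / (omg d * r ^ d) * omg d) ^ (2 / (d:ℝ))) * r ^ 2 := by ring
    rw [h9, abs_mul, abs_of_nonneg (sq_nonneg r)]
    gcongr

lemma inner_lim (hd : 1 ≤ d) {j : ℕ} {c : ℕ → ℝ} {m : ℕ → ℕ} (hg : GoodW j c m)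
    {κ : EucSp d → ℝ} (hκm : Measurable κ) (hκ0 : ∀ x, 0 ≤ κ x)
    (μ : Measure (EucSp d)) [IsProbabilityMeasure μ]
    (hμ : μ = volume.withDensity fun x => ENNReal.ofReal (κ x))
    (hs : ∀ x r, μ (Metric.sphere x r) = 0)
    {Ωs : Set (EucSp d)} (hΩ : ∀ᵐ y ∂μ, y ∈ Ωs) (x v : EucSp d) (hx : 0 < κ x) {c' : ℝ} (hc' : 0 < c')
    (hF : ∀ y ∈ Ωs, c' * dist y x ^ d ≤ Fm μ x y)
    (hL : Tendsto (fun r => ⨍ y in Metric.closedBall x r, ‖κ y - κ x‖) (𝓝[>] 0) (𝓝 0))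
    {h : EucSp d → ℝ} (hhm : Measurable h) (hv : HasGradientAt h v x) {Λ : ℝ}
    (hΛ : ∀ y ∈ Ωs, |h y - h x| ≤ Λ * dist y x) :
    Tendsto (fun n : ℕ => ∫ y, (n:ℝ) ^ (2 / (d:ℝ)) * (h y - h x) ^ 2
          * wt j (c n) (m n) (Fm μ x y) ∂μ) atTop
      (𝓝 (‖v‖ ^ 2 / d * (κ x * omg d) ^ (-(2 / (d:ℝ))) *
        (Real.Gamma (j + 1 + 2 / (d:ℝ)) / Real.Gamma (j + 1)))) := by
  have ho := omg_pos d
  have hd' : (0:ℝ) < d := by exact_mod_cast hd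
  have hq : 0 < 2 / (d:ℝ) := by positivity
  set V := ‖v‖ ^ 2 / d with hV
  set b := (κ x * omg d) ^ (-(2 / (d:ℝ))) with hb
  have hb0 : 0 < b := by positivity
  set C0 := (1 / c') ^ (2 / (d:ℝ)) with hC0def
  have hC0pos : 0 < C0 := by positivity
  have hFq0 : ∀ y, 0 ≤ Fm μ x y ^ (2 / (d:ℝ)) := fun y => Real.rpow_nonneg (Fm_nonneg μ x y) _
  have hFq1 : ∀ y, Fm μ x y ^ (2 / (d:ℝ)) ≤ 1 := fun y =>
    Real.rpow_le_one (Fm_nonneg μ x y) (Fm_le_one μ x y) hq.le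
  have hr2 : ∀ y ∈ Ωs, dist y x ^ 2 ≤ C0 := by
    intro y hy
    refine (sq_le_rpow hd hc' dist_nonneg (hF y hy)).trans ?_
    exact mul_le_of_le_one_right hC0pos.le (hFq1 y)
  have hin : ∀ y, |⟪v, y - x⟫| ≤ ‖v‖ * dist y x := fun y => by
    rw [dist_eq_norm]; exact abs_real_inner_le_norm v _
  set e : EucSp d → ℝ := fun y => (h y - h x) ^ 2 - ⟪v, y - x⟫ ^ 2 +
    V * (dist y x ^ 2 - b * Fm μ x y ^ (2 / (d:ℝ))) with he
  have hsm : ∀ ε > 0, ∃ δ > 0, ∀ y ∈ Ωs, dist y x ≤ δ → |e y| ≤ ε * dist y x ^ 2 := by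
    intro ε hε
    have hVp : 0 < V + 1 := by positivity
    obtain ⟨δ1, hδ1, h1⟩ := ratio_dev hd hκm hκ0 μ hμ hs x hx hL (ε / (2 * (V + 1))) (by positivity)
    set L := |Λ| + ‖v‖ + 1 with hLdef
    have hL0 : 0 < L := by positivity
    have h2 := hv.hasFDerivAt.isLittleO
    have h3 := h2.def (c := ε / (2 * L)) (by positivity)
    obtain ⟨δ2, hδ2, h4⟩ := Metric.eventually_nhds_iff.1 h3
    refine ⟨min δ1 (δ2 / 2), by positivity, fun y hy hyd => ?_⟩
    have h5 := h1 y (hyd.trans (min_le_left _ _))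
    have h6 := h4 (show dist y x < δ2 from (hyd.trans (min_le_right _ _)).trans_lt (by linarith))
    rw [InnerProductSpace.toDual_apply_apply, ← dist_eq_norm y x, Real.norm_eq_abs] at h6
    have h7 : |(h y - h x) + ⟪v, y - x⟫| ≤ L * dist y x := by
      refine (abs_add_le _ _).trans ?_
      have a1 := hΛ y hy
      have a2 := hin y
      have a3 : Λ * dist y x ≤ |Λ| * dist y x := by gcongr; exact le_abs_self _
      have a4 : 0 ≤ dist y x := dist_nonneg
      rw [hLdef]; nlinarith
    have h8 : |(h y - h x) ^ 2 - ⟪v, y - x⟫ ^ 2| ≤ ε / 2 * dist y x ^ 2 := by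
      have : (h y - h x) ^ 2 - ⟪v, y - x⟫ ^ 2 = (h y - h x - ⟪v, y - x⟫) * ((h y - h x) + ⟪v, y - x⟫) := by
        ring
      rw [this, abs_mul]
      calc _ ≤ (ε / (2 * L) * dist y x) * (L * dist y x) := by gcongr
        _ = _ := by field_simp
    have h9 : |V * (dist y x ^ 2 - b * Fm μ x y ^ (2 / (d:ℝ)))| ≤ ε / 2 * dist y x ^ 2 := by
      have hV0 : 0 ≤ V := by positivity
      rw [abs_mul, abs_of_nonneg hV0]
      calc _ ≤ (V + 1) * (ε / (2 * (V + 1)) * dist y x ^ 2) := by gcongr; linarith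
        _ = _ := by field_simp
    refine (abs_add_le _ _).trans ?_
    linarith
  have hV0 : 0 ≤ V := by positivity
  have hhb : ∀ y ∈ Ωs, (h y - h x) ^ 2 ≤ Λ ^ 2 * C0 := by
    intro y hy
    rw [← sq_abs]
    calc |h y - h x| ^ 2 ≤ (Λ * dist y x) ^ 2 := by gcongr; exact hΛ y hy
      _ = Λ ^ 2 * dist y x ^ 2 := by ring
      _ ≤ _ := by gcongr; exact hr2 y hy
  obtain ⟨M, hM0, hM⟩ : ∃ M, 0 ≤ M ∧ ∀ y ∈ Ωs, |e y| ≤ M := by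
    refine ⟨Λ ^ 2 * C0 + ‖v‖ ^ 2 * C0 + V * (C0 + b), by positivity, fun y hy => ?_⟩
    have a1 := hhb y hy
    have a2 : ⟪v, y - x⟫ ^ 2 ≤ ‖v‖ ^ 2 * C0 := by
      rw [← sq_abs]
      calc |⟪v, y - x⟫| ^ 2 ≤ (‖v‖ * dist y x) ^ 2 := by gcongr; exact hin y
        _ = ‖v‖ ^ 2 * dist y x ^ 2 := by ring
        _ ≤ _ := by gcongr; exact hr2 y hy
    have a3 : |dist y x ^ 2 - b * Fm μ x y ^ (2 / (d:ℝ))| ≤ C0 + b := by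
      have b1 := hr2 y hy
      have b2 : b * Fm μ x y ^ (2 / (d:ℝ)) ≤ b := mul_le_of_le_one_right hb0.le (hFq1 y)
      have b3 : 0 ≤ b * Fm μ x y ^ (2 / (d:ℝ)) := mul_nonneg hb0.le (hFq0 y)
      have b4 := sq_nonneg (dist y x)
      rw [abs_le]; constructor <;> linarith
    have a4 : |V * (dist y x ^ 2 - b * Fm μ x y ^ (2 / (d:ℝ)))| ≤ V * (C0 + b) := by
      rw [abs_mul, abs_of_nonneg hV0]; gcongr
    refine (abs_add_le _ _).trans ?_
    have a5 : |(h y - h x) ^ 2 - ⟪v, y - x⟫ ^ 2| ≤ Λ ^ 2 * C0 + ‖v‖ ^ 2 * C0 := by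
      have := sq_nonneg (h y - h x)
      have := sq_nonneg ⟪v, y - x⟫
      rw [abs_le]; constructor <;> nlinarith [sq_nonneg Λ, sq_nonneg ‖v‖]
    linarith
  obtain ⟨δ, hδ, hδ2⟩ := hsm 1 one_pos
  have hC : ∀ y ∈ Ωs, |e y| ≤ (1 + M / δ ^ 2) * dist y x ^ 2 := by
    intro y hy
    rcases le_or_gt (dist y x) δ with hyd | hyd
    · refine (hδ2 y hy hyd).trans ?_
      have : 0 ≤ M / δ ^ 2 := by positivity
      gcongr; linarith
    · refine (hM y hy).trans ?_
      have : δ ^ 2 ≤ dist y x ^ 2 := by gcongr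
      calc M = M / δ ^ 2 * δ ^ 2 := by field_simp
        _ ≤ M / δ ^ 2 * dist y x ^ 2 := by gcongr
        _ ≤ _ := by gcongr; linarith
  have hl1 := L0 hd hg μ hs hΩ x hc' hF (by positivity) hC hsm
  have hl2 := I2 hd hg hκm hκ0 μ hμ hs hΩ x v hc' hF hL
  have hFm := measurable_Fm μ x
  have hem : Measurable e := by
    have : Measurable fun y => Fm μ x y ^ (2 / (d:ℝ)) := hFm.pow_const _
    have h2 : Measurable fun y : EucSp d => ⟪v, y - x⟫ ^ 2 := by fun_prop
    have h3 : Measurable fun y : EucSp d => dist y x ^ 2 := by fun_prop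
    exact (((hhm.sub_const _).pow_const _).sub h2).add ((h3.sub (this.const_mul _)).const_mul _)
  have hl3 : Tendsto (fun n : ℕ => ∫ y, (n:ℝ) ^ (2 / (d:ℝ)) * (V * b * Fm μ x y ^ (2 / (d:ℝ)))
          * wt j (c n) (m n) (Fm μ x y) ∂μ) atTop
      (𝓝 (V * b * (Real.Gamma (j + 1 + 2 / (d:ℝ)) / Real.Gamma (j + 1)))) := by
    have := (hg.tendsto_moment hq.le).const_mul (V * b)
    refine this.congr' ?_
    filter_upwards [eventually_gt_atTop 0] with n hn0
    have hn' : (0:ℝ) < n := by exact_mod_cast hn0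
    rw [← int_wt μ hs x hn0 (f := fun s => s ^ (2 / (d:ℝ))) (by fun_prop)
      (fun s hs => by positivity) j (hg.nn n) (m n), ← integral_const_mul]
    refine integral_congr_ae (Eventually.of_forall fun y => ?_)
    simp only
    rw [Real.mul_rpow hn'.le (Fm_nonneg μ x y)]
    ring
  have hsum := (hl1.add hl2).add hl3
  rw [zero_add, zero_add] at hsum
  refine hsum.congr fun n => ?_
  rw [← integral_add, ← integral_add]
  · refine integral_congr_ae (Eventually.of_forall fun y => ?_)
    simp only [he, hV, dist_eq_norm]
    ring
  · refine Integrable.add ?_ ?_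
    · refine int_bdd μ (hg.nn n) (m n) x _ (C := M) hem ?_
      filter_upwards [hΩ] with y hy using hM y hy
    · refine int_bdd μ (hg.nn n) (m n) x _ (C := ‖v‖ ^ 2 * C0) (by fun_prop) ?_
      filter_upwards [hΩ] with y hy
      refine (Bq_le hd v (y - x)).trans ?_
      gcongr
      rw [← dist_eq_norm]; exact hr2 y hy
  · refine int_bdd μ (hg.nn n) (m n) x _ (C := V * b) ((hFm.pow_const _).const_mul _) ?_
    refine Eventually.of_forall fun y => ?_
    have := hFq0 y
    rw [abs_of_nonneg (by positivity)]
    exact mul_le_of_le_one_right (by positivity) (hFq1 y)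
  · refine int_bdd μ (hg.nn n) (m n) x _ (C := M) hem ?_
    filter_upwards [hΩ] with y hy using hM y hy
  · refine int_bdd μ (hg.nn n) (m n) x _ (C := ‖v‖ ^ 2 * C0) (by fun_prop) ?_
    filter_upwards [hΩ] with y hy
    refine (Bq_le hd v (y - x)).trans ?_
    gcongr
    rw [← dist_eq_norm]; exact hr2 y hy

end inner4


section outer
variable {d : ℕ}

lemma ae_lebesgue {κ : EucSp d → ℝ} (hκi : Integrable κ) :
    ∀ᵐ x : EucSp d, Tendsto (fun r => ⨍ y in Metric.closedBall x r, ‖κ y - κ x‖) (𝓝[>] 0) (𝓝 0) := by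
  have h1 := IsUnifLocDoublingMeasure.ae_tendsto_average_norm_sub
    (μ := (volume : Measure (EucSp d))) hκi.locallyIntegrable 1
  filter_upwards [h1] with x hx
  refine hx (fun _ => x) (fun r => r) tendsto_id ?_
  filter_upwards [self_mem_nhdsWithin] with r hr
  have hr : 0 < r := hr
  simp [hr.le]

lemma κ_pos_ae {κ : EucSp d → ℝ} (hκm : Measurable κ) (hκ0 : ∀ x, 0 ≤ κ x)
    (μ : Measure (EucSp d)) [IsProbabilityMeasure μ]
    (hμ : μ = volume.withDensity fun x => ENNReal.ofReal (κ x))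
    (hs : ∀ x r, μ (Metric.sphere x r) = 0) {Ωs : Set (EucSp d)} {c : ℝ} (hc : 0 < c)
    (hball : ∀ x ∈ Ωs, ∀ r : ℝ, 0 < r → r ≤ 1 → c * r ^ d ≤ ∫ y in Metric.closedBall x r, κ y) :
    ∀ᵐ x : EucSp d, x ∈ Ωs → 0 < κ x := by
  filter_upwards [ae_lebesgue (κ_integrable hκm hκ0 μ hμ)] with x hL hx
  have ho := omg_pos d
  have h1 := ratio hκm hκ0 μ hμ hs x hL
  have h2 : c / omg d ≤ κ x := by
    refine ge_of_tendsto h1 ?_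
    filter_upwards [Ioc_mem_nhdsGT (show (0:ℝ) < 1 from one_pos)] with r hr
    have hr0 : 0 < r := hr.1
    rw [real_ball_eq μ hs, real_cb_eq hκm hκ0 μ hμ _ Metric.isClosed_closedBall.measurableSet,
      div_le_div_iff₀ ho (by positivity)]
    have := hball x hx r hr.1 hr.2
    nlinarith
  exact lt_of_lt_of_le (by positivity) h2

lemma outer_lim (hd : 1 ≤ d) {j : ℕ} {c : ℕ → ℝ} {m : ℕ → ℕ} (hg : GoodW j c m)
    {κ : EucSp d → ℝ} (hκm : Measurable κ) (hκ0 : ∀ x, 0 ≤ κ x)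
    (μ : Measure (EucSp d)) [IsProbabilityMeasure μ]
    (hμ : μ = volume.withDensity fun x => ENNReal.ofReal (κ x))
    (hs : ∀ x r, μ (Metric.sphere x r) = 0)
    {Ωs : Set (EucSp d)} (hΩm : MeasurableSet Ωs) (hΩ : ∀ᵐ y ∂μ, y ∈ Ωs) {c' : ℝ} (hc' : 0 < c')
    (hF : ∀ x ∈ Ωs, ∀ y ∈ Ωs, c' * dist y x ^ d ≤ Fm μ x y)
    {c1 : ℝ} (hc1 : 0 < c1)
    (hball : ∀ x ∈ Ωs, ∀ r : ℝ, 0 < r → r ≤ 1 → c1 * r ^ d ≤ ∫ y in Metric.closedBall x r, κ y)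
    {h : EucSp d → ℝ} (hh : ContDiff ℝ 2 h) {Λ : ℝ}
    (hΛ : ∀ x ∈ Ωs, ∀ y ∈ Ωs, |h y - h x| ≤ Λ * dist y x) :
    Tendsto (fun n : ℕ => ∫ x, ∫ y, (n:ℝ) ^ (2 / (d:ℝ)) * (h y - h x) ^ 2
          * wt j (c n) (m n) (Fm μ x y) ∂μ ∂μ) atTop
      (𝓝 (omg d ^ (-2 / (d:ℝ)) * (Real.Gamma (j + 1 + 2 / (d:ℝ)) / Real.Gamma (j + 1)) / d *
        ∫ x in Ωs, ‖gradient h x‖ ^ 2 * κ x ^ (1 - 2 / (d:ℝ)))) := by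
  have ho := omg_pos d
  have hd' : (0:ℝ) < d := by exact_mod_cast hd
  have hq : 0 < 2 / (d:ℝ) := by positivity
  have hhm : Measurable h := hh.continuous.measurable
  have hdiff : ∀ x, DifferentiableAt ℝ h x := fun x => hh.differentiable (by norm_num) x
  have habs : ∀ {p : EucSp d → Prop}, (∀ᵐ x : EucSp d, p x) → ∀ᵐ x ∂μ, p x := by
    intro p hp
    rw [hμ]
    exact (withDensity_absolutelyContinuous _ _) hp
  set G := Real.Gamma (j + 1 + 2 / (d:ℝ)) / Real.Gamma (j + 1) with hG
  have hlim : (∫ x, ‖gradient h x‖ ^ 2 / d * (κ x * omg d) ^ (-(2 / (d:ℝ))) * G ∂μ) =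
      omg d ^ (-2 / (d:ℝ)) * G / d * ∫ x in Ωs, ‖gradient h x‖ ^ 2 * κ x ^ (1 - 2 / (d:ℝ)) := by
    rw [int_μ hκm hκ0 μ hμ, ← integral_const_mul, ← setIntegral_eq_integral_of_ae_compl_eq_zero (s := Ωs)]
    · refine setIntegral_congr_ae hΩm ?_
      filter_upwards [κ_pos_ae hκm hκ0 μ hμ hs hc1 hball] with x hx hxΩ
      have hκp := hx hxΩ
      rw [Real.mul_rpow hκp.le ho.le, Real.rpow_sub hκp, Real.rpow_one, Real.rpow_neg hκp.le,
        ← neg_div]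
      field_simp
    · have h1 := hΩ
      rw [hμ, ae_withDensity_iff hκm.ennreal_ofReal] at h1
      filter_upwards [h1] with x hx hxΩ
      have : κ x = 0 := by
        by_contra h2
        apply hxΩ
        apply hx
        rw [Ne, ENNReal.ofReal_eq_zero, not_le]
        exact lt_of_le_of_ne (hκ0 x) (Ne.symm h2)
      rw [this, zero_mul]
  rw [← hlim]
  obtain ⟨K, hK, hTB⟩ := TB hg hq.le μ hs
  set C0 := (1 / c') ^ (2 / (d:ℝ)) with hC0def
  have hC0pos : 0 < C0 := by positivity
  refine tendsto_integral_filter_of_dominated_convergence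
    (fun _ => K * (Λ ^ 2 * C0 * tailI j (2 / (d:ℝ)) 0 + 0 * tailI j (2 / (d:ℝ)) 0)) ?_ ?_ (integrable_const _) ?_
  · refine Eventually.of_forall fun n => ?_
    have hm2 : Measurable fun z : EucSp d × EucSp d => (n:ℝ) ^ (2 / (d:ℝ)) * (h z.2 - h z.1) ^ 2
          * wt j (c n) (m n) (Fm μ z.1 z.2) := by
      have h1 : Measurable fun z : EucSp d × EucSp d => wt j (c n) (m n) (Fm μ z.1 z.2) := by
        have := (measurable_wt j (c n) (m n)).comp (measurable_Fm2 μ)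
        simpa only [Function.comp_def] using this
      refine Measurable.mul ?_ h1
      have h2 : Measurable fun z : EucSp d × EucSp d => h z.2 - h z.1 :=
        (hhm.comp measurable_snd).sub (hhm.comp measurable_fst)
      exact (h2.pow_const 2).const_mul _
    exact (StronglyMeasurable.integral_prod_right hm2.stronglyMeasurable).aestronglyMeasurable
  · filter_upwards [hTB] with n h1
    filter_upwards [hΩ] with x hx
    refine h1 x (fun y => (h y - h x) ^ 2) (Λ ^ 2 * C0) 0 0 (by positivity) le_rfl ?_
    filter_upwards [hΩ] with y hy
    rw [zero_mul, add_zero, abs_of_nonneg (sq_nonneg _), ← sq_abs]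
    calc |h y - h x| ^ 2 ≤ (Λ * dist y x) ^ 2 := by gcongr; exact hΛ x hx y hy
      _ = Λ ^ 2 * dist y x ^ 2 := by ring
      _ ≤ Λ ^ 2 * (C0 * Fm μ x y ^ (2 / (d:ℝ))) := by
        gcongr; exact sq_le_rpow hd hc' dist_nonneg (hF x hx y hy)
      _ = _ := by ring
  · have hpos := habs (κ_pos_ae hκm hκ0 μ hμ hs hc1 hball)
    filter_upwards [hΩ, hpos, habs (ae_lebesgue (κ_integrable hκm hκ0 μ hμ))] with x hx hx1 hL
    exact inner_lim hd hg hκm hκ0 μ hμ hs hΩ x (gradient h x) (hx1 hx) hc' (hF x hx) hL hhm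
      (hdiff x).hasGradientAt (hΛ x hx)

end outer


set_option linter.unusedSectionVars false
section prob1
variable {Ωp : Type*} [MeasurableSpace Ωp] {P : Measure Ωp} [IsProbabilityMeasure P]
  {S : Type*} [MeasurableSpace S] {W : ℕ → Ωp → S} {ρ : Measure S} [IsProbabilityMeasure ρ]

lemma fub {T : Type*} [MeasurableSpace T] (hW : ∀ i, Measurable (W i)) (hind : iIndepFun W P)
    (hlaw : ∀ i, P.map (W i) = ρ) (A : Finset ℕ) {V : Ωp → T} (hV : Measurable V)
    (hVA : IndepFun V (fun ω (ℓ : A) => W ℓ ω) P) (φ : ℕ → T → S → ENNReal)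
    (hφ : ∀ ℓ, Measurable (fun z : T × S => φ ℓ z.1 z.2)) {f : T → ENNReal} (hf : Measurable f) :
    ∫⁻ ω, f (V ω) * ∏ ℓ ∈ A, φ ℓ (V ω) (W ℓ ω) ∂P
      = ∫⁻ t, f t * ∏ ℓ ∈ A, ∫⁻ u, φ ℓ t u ∂ρ ∂(P.map V) := by
  set U : Ωp → (A → S) := fun ω ℓ => W ℓ ω with hU
  have hUm : Measurable U := measurable_pi_lambda _ fun ℓ => hW ℓ
  have hmap := (indepFun_iff_map_prod_eq_prod_map_map hV.aemeasurable hUm.aemeasurable).1 hVA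
  have hΦ : Measurable fun z : T × (A → S) => f z.1 * ∏ ℓ : A, φ ℓ z.1 (z.2 ℓ) := by
    refine (hf.comp measurable_fst).mul (Finset.measurable_prod _ fun ℓ _ => ?_)
    have h1 : Measurable fun z : T × (A → S) => (z.1, z.2 ℓ) :=
      measurable_fst.prodMk ((measurable_pi_apply ℓ).comp measurable_snd)
    exact (hφ ℓ).comp h1
  have h1 : ∫⁻ ω, f (V ω) * ∏ ℓ ∈ A, φ ℓ (V ω) (W ℓ ω) ∂P =
      ∫⁻ z, f z.1 * ∏ ℓ : A, φ ℓ z.1 (z.2 ℓ) ∂(P.map fun ω => (V ω, U ω)) := by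
    rw [lintegral_map hΦ (hV.prodMk hUm)]
    refine lintegral_congr fun ω => ?_
    rw [← Finset.prod_coe_sort A]
  rw [h1, hmap]
  have : IsProbabilityMeasure (P.map V) := Measure.isProbabilityMeasure_map hV.aemeasurable
  have : IsProbabilityMeasure (P.map U) := Measure.isProbabilityMeasure_map hUm.aemeasurable
  rw [lintegral_prod _ hΦ.aemeasurable]
  refine lintegral_congr fun t => ?_
  simp only
  have hφt : ∀ ℓ, Measurable (φ ℓ t) := fun ℓ => (hφ ℓ).comp measurable_prodMk_left
  have hpm : Measurable fun y : A → S => ∏ ℓ : A, φ ℓ t (y ℓ) :=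
    Finset.measurable_prod _ fun ℓ _ => (hφt ℓ).comp (measurable_pi_apply ℓ)
  rw [lintegral_const_mul _ hpm]
  congr 1
  rw [lintegral_map hpm hUm]
  have h2 := lintegral_prod_eq_prod_lintegral_of_indepFun A (fun ℓ ω => φ ℓ t (W ℓ ω))
    (hind.comp (fun ℓ => φ ℓ t) hφt) (fun ℓ => (hφt ℓ).comp (hW ℓ))
  have h3 : ∀ ω, ∏ ℓ : A, φ ℓ t (U ω ℓ) = ∏ ℓ ∈ A, φ ℓ t (W ℓ ω) := fun ω => by
    rw [← Finset.prod_coe_sort A]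
  simp_rw [h3]
  rw [h2]
  refine Finset.prod_congr rfl fun ℓ _ => ?_
  rw [← hlaw ℓ, lintegral_map (hφt ℓ) (hW ℓ)]

lemma indep_pair_rest (hW : ∀ i, Measurable (W i)) (hind : iIndepFun W P) (A : Finset ℕ) {i l : ℕ}
    (hi : i ∉ A) (hl : l ∉ A) :
    IndepFun (fun ω => (W i ω, W l ω)) (fun ω (ℓ : A) => W ℓ ω) P := by
  have h1 := hind.indepFun_finset {i, l} A (by
    rw [Finset.disjoint_left]; intro a ha; simp at ha; rcases ha with rfl | rfl <;> assumption) hW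
  exact h1.comp (φ := fun z : (({i, l} : Finset ℕ) → S) => (z ⟨i, by simp⟩, z ⟨l, by simp⟩))
    (ψ := id) ((measurable_pi_apply _).prodMk (measurable_pi_apply _)) measurable_id

lemma indep_quad_rest (hW : ∀ i, Measurable (W i)) (hind : iIndepFun W P) (A : Finset ℕ)
    {i l i' l' : ℕ} (hi : i ∉ A) (hl : l ∉ A) (hi' : i' ∉ A) (hl' : l' ∉ A) :
    IndepFun (fun ω => ((W i ω, W l ω), (W i' ω, W l' ω))) (fun ω (ℓ : A) => W ℓ ω) P := by
  have h1 := hind.indepFun_finset {i, l, i', l'} A (by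
    rw [Finset.disjoint_left]; intro a ha; simp at ha
    rcases ha with rfl | rfl | rfl | rfl <;> assumption) hW
  exact h1.comp (φ := fun z : (({i, l, i', l'} : Finset ℕ) → S) =>
      ((z ⟨i, by simp⟩, z ⟨l, by simp⟩), (z ⟨i', by simp⟩, z ⟨l', by simp⟩)))
    (ψ := id) (((measurable_pi_apply _).prodMk (measurable_pi_apply _)).prodMk
      ((measurable_pi_apply _).prodMk (measurable_pi_apply _))) measurable_id

lemma law_pair (hW : ∀ i, Measurable (W i)) (hind : iIndepFun W P)
    (hlaw : ∀ i, P.map (W i) = ρ) {i l : ℕ} (hil : i ≠ l) :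
    P.map (fun ω => (W i ω, W l ω)) = ρ.prod ρ := by
  rw [(indepFun_iff_map_prod_eq_prod_map_map (hW i).aemeasurable (hW l).aemeasurable).1
    (hind.indepFun hil), hlaw, hlaw]

lemma law_quad (hW : ∀ i, Measurable (W i)) (hind : iIndepFun W P)
    (hlaw : ∀ i, P.map (W i) = ρ) {i l i' l' : ℕ} (hil : i ≠ l) (hil' : i' ≠ l')
    (h1 : i ≠ i') (h2 : i ≠ l') (h3 : l ≠ i') (h4 : l ≠ l') :
    P.map (fun ω => ((W i ω, W l ω), (W i' ω, W l' ω))) = (ρ.prod ρ).prod (ρ.prod ρ) := by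
  rw [(indepFun_iff_map_prod_eq_prod_map_map ((hW i).prodMk (hW l)).aemeasurable
    ((hW i').prodMk (hW l')).aemeasurable).1
    (hind.indepFun_prodMk_prodMk hW i l i' l' h1 h2 h3 h4), law_pair hW hind hlaw hil,
    law_pair hW hind hlaw hil']

/-- indicator of a count as a sum over subsets -/
lemma count_ind (A : Finset ℕ) (p : ℕ → Prop) [DecidablePred p] (j : ℕ) :
    (if (A.filter p).card = j then (1:ENNReal) else 0) =
      ∑ B ∈ A.powersetCard j, ∏ ℓ ∈ A, (if ℓ ∈ B then (if p ℓ then 1 else 0) else (if p ℓ then 0 else 1)) := by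
  have h1 : ∀ B ∈ A.powersetCard j,
      ∏ ℓ ∈ A, (if ℓ ∈ B then (if p ℓ then (1:ENNReal) else 0) else (if p ℓ then 0 else 1)) =
        if A.filter p = B then 1 else 0 := by
    intro B hB
    have hBA := (Finset.mem_powersetCard.1 hB).1
    split_ifs with h
    · refine Finset.prod_eq_one fun ℓ hℓ => ?_
      subst h
      by_cases hp : p ℓ <;> simp [hp, hℓ]
    · by_contra h2
      rw [← Ne, Finset.prod_ne_zero_iff] at h2
      apply h
      ext ℓ
      rw [Finset.mem_filter]
      constructor
      · rintro ⟨h3, h4⟩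
        by_contra h5
        have := h2 ℓ h3
        simp [h4, h5] at this
      · intro h3
        refine ⟨hBA h3, ?_⟩
        by_contra h5
        have := h2 ℓ (hBA h3)
        simp [h3, h5] at this
  rw [Finset.sum_congr rfl h1, Finset.sum_ite_eq]
  simp [Finset.mem_powersetCard, Finset.filter_subset]

lemma prod_two (A B : Finset ℕ) (j : ℕ) (hB : B ∈ A.powersetCard j) (a b : ENNReal) :
    ∏ ℓ ∈ A, (if ℓ ∈ B then a else b) = a ^ j * b ^ (A.card - j) := by
  obtain ⟨h1, h2⟩ := Finset.mem_powersetCard.1 hB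
  rw [Finset.prod_ite, Finset.prod_const, Finset.prod_const]
  have h3 : A.filter (· ∈ B) = B := by
    ext ℓ; simp only [Finset.mem_filter]; exact ⟨fun h => h.2, fun h => ⟨h1 h, h⟩⟩
  have h4 : A.filter (· ∉ B) = A \ B := by ext ℓ; simp
  rw [h3, h4, Finset.card_sdiff_of_subset h1, h2]

end prob1

section prob2
variable {d : ℕ} {Ωp : Type*} [MeasurableSpace Ωp] {P : Measure Ωp} [IsProbabilityMeasure P]
  {W : ℕ → Ωp → EucSp d × ℝ} {μ : Measure (EucSp d)} [IsProbabilityMeasure μ]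
  {ν : Measure ℝ} [IsProbabilityMeasure ν]

/-- the number of points in `A` closer to `x` than `y` -/
def cnt (W : ℕ → Ωp → EucSp d × ℝ) (A : Finset ℕ) (i l : ℕ) (ω : Ωp) : ℕ :=
  (A.filter fun ℓ => dist (W ℓ ω).1 (W i ω).1 < dist (W l ω).1 (W i ω).1).card

lemma ind_int {s : Set (EucSp d)} (hs : MeasurableSet s) :
    ∫⁻ u : EucSp d × ℝ, s.indicator (fun _ => (1:ENNReal)) u.1 ∂(μ.prod ν) = μ s := by
  have h2 : Measurable (s.indicator (fun _ => (1:ENNReal))) := measurable_const.indicator hs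
  rw [(measurePreserving_fst (μ := μ) (ν := ν)).lintegral_comp h2, lintegral_indicator hs]
  simp

lemma in_int (x y : EucSp d) :
    ∫⁻ u : EucSp d × ℝ, (if dist u.1 x < dist y x then (1:ENNReal) else 0) ∂(μ.prod ν)
      = ENNReal.ofReal (Fm μ x y) := by
  have h1 : ∀ u : EucSp d × ℝ, (if dist u.1 x < dist y x then (1:ENNReal) else 0) =
      (Metric.ball x (dist y x)).indicator (fun _ => 1) u.1 := by
    intro u; by_cases h : dist u.1 x < dist y x <;> simp [h]
  simp_rw [h1]
  rw [ind_int measurableSet_ball]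
  simp [Fm]

lemma out_int (x y : EucSp d) :
    ∫⁻ u : EucSp d × ℝ, (if dist u.1 x < dist y x then (0:ENNReal) else 1) ∂(μ.prod ν)
      = ENNReal.ofReal (1 - Fm μ x y) := by
  have h1 : ∀ u : EucSp d × ℝ, (if dist u.1 x < dist y x then (0:ENNReal) else 1) =
      (Metric.ball x (dist y x))ᶜ.indicator (fun _ => 1) u.1 := by
    intro u; by_cases h : dist u.1 x < dist y x <;> simp [h]
  simp_rw [h1]
  rw [ind_int measurableSet_ball.compl, Fm, ← probReal_compl_eq_one_sub measurableSet_ball]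
  simp

lemma one_term (hW : ∀ i, Measurable (W i)) (hind : iIndepFun W P)
    (hlaw : ∀ i, P.map (W i) = μ.prod ν) (A : Finset ℕ) {i l : ℕ} (hi : i ∉ A) (hl : l ∉ A)
    (hil : i ≠ l) {G : (EucSp d × ℝ) × (EucSp d × ℝ) → ENNReal} (hG : Measurable G) (j : ℕ) :
    ∫⁻ ω, G (W i ω, W l ω) * (if cnt W A i l ω = j then 1 else 0) ∂P =
      ∫⁻ z, G z * (A.card.choose j * (ENNReal.ofReal (Fm μ z.1.1 z.2.1) ^ j *
        ENNReal.ofReal (1 - Fm μ z.1.1 z.2.1) ^ (A.card - j))) ∂((μ.prod ν).prod (μ.prod ν)) := by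
  have h1 : ∀ ω, G (W i ω, W l ω) * (if cnt W A i l ω = j then 1 else 0) =
      ∑ B ∈ A.powersetCard j, G (W i ω, W l ω) * ∏ ℓ ∈ A,
        (if ℓ ∈ B then (if dist (W ℓ ω).1 (W i ω).1 < dist (W l ω).1 (W i ω).1 then 1 else 0)
          else (if dist (W ℓ ω).1 (W i ω).1 < dist (W l ω).1 (W i ω).1 then 0 else 1)) := by
    intro ω
    unfold cnt
    rw [count_ind, Finset.mul_sum]
  simp_rw [h1]
  set φ : Finset ℕ → ℕ → ((EucSp d × ℝ) × (EucSp d × ℝ)) → (EucSp d × ℝ) → ENNReal :=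
    fun B ℓ z u => if ℓ ∈ B then (if dist u.1 z.1.1 < dist z.2.1 z.1.1 then 1 else 0)
          else (if dist u.1 z.1.1 < dist z.2.1 z.1.1 then 0 else 1) with hφ
  have hset : MeasurableSet {z : ((EucSp d × ℝ) × (EucSp d × ℝ)) × (EucSp d × ℝ) |
      dist z.2.1 z.1.1.1 < dist z.1.2.1 z.1.1.1} :=
    measurableSet_lt (by fun_prop) (by fun_prop)
  have hφm : ∀ B ℓ, Measurable fun z : ((EucSp d × ℝ) × (EucSp d × ℝ)) × (EucSp d × ℝ) => φ B ℓ z.1 z.2 := by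
    intro B ℓ
    simp only [hφ]
    by_cases hB : ℓ ∈ B
    · simp only [if_pos hB]
      exact Measurable.ite hset measurable_const measurable_const
    · simp only [if_neg hB]
      exact Measurable.ite hset measurable_const measurable_const
  have hVm : Measurable fun ω => (W i ω, W l ω) := (hW i).prodMk (hW l)
  rw [lintegral_finsetSum]
  · have h2 : ∀ B ∈ A.powersetCard j, ∫⁻ ω, G (W i ω, W l ω) * ∏ ℓ ∈ A,
        (if ℓ ∈ B then (if dist (W ℓ ω).1 (W i ω).1 < dist (W l ω).1 (W i ω).1 then (1:ENNReal) else 0)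
          else (if dist (W ℓ ω).1 (W i ω).1 < dist (W l ω).1 (W i ω).1 then 0 else 1)) ∂P =
        ∫⁻ z, G z * (ENNReal.ofReal (Fm μ z.1.1 z.2.1) ^ j *
        ENNReal.ofReal (1 - Fm μ z.1.1 z.2.1) ^ (A.card - j)) ∂((μ.prod ν).prod (μ.prod ν)) := by
      intro B hB
      have h3 := fub hW hind hlaw A hVm (indep_pair_rest hW hind A hi hl) (φ B) (hφm B) hG
      refine h3.trans ?_
      rw [law_pair hW hind hlaw hil]
      refine lintegral_congr fun z => ?_
      congr 1
      rw [← prod_two A B j hB]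
      refine Finset.prod_congr rfl fun ℓ hℓ => ?_
      by_cases hB : ℓ ∈ B
      · simp only [hφ, if_pos hB]; exact in_int _ _
      · simp only [hφ, if_neg hB]; exact out_int _ _
    rw [Finset.sum_congr rfl h2, Finset.sum_const, Finset.card_powersetCard, nsmul_eq_mul,
      ← lintegral_const_mul']
    · refine lintegral_congr fun z => ?_
      ring
    · exact ENNReal.natCast_ne_top _
  · intro B hB
    refine (hG.comp hVm).mul (Finset.measurable_prod _ fun ℓ _ => ?_)
    have h4 : Measurable fun ω => ((W i ω, W l ω), W ℓ ω) := hVm.prodMk (hW ℓ)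
    have h5 := (hφm B ℓ).comp h4
    simp only [Function.comp_def, hφ] at h5
    exact h5

end prob2


set_option linter.unusedSectionVars false
section prob3
variable {d : ℕ} {Ωp : Type*} [MeasurableSpace Ωp] {P : Measure Ωp} [IsProbabilityMeasure P]
  {W : ℕ → Ωp → EucSp d × ℝ} {μ : Measure (EucSp d)} [IsProbabilityMeasure μ]
  {ν : Measure ℝ} [IsProbabilityMeasure ν]

lemma no_tie (hs : ∀ x r, μ (Metric.sphere x r) = 0) (hW : ∀ i, Measurable (W i)) (hind : iIndepFun W P)
    (hlaw : ∀ i, P.map (W i) = μ.prod ν) {i l l' : ℕ} (h1 : i ≠ l) (h2 : i ≠ l') (h3 : l ≠ l') :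
    ∀ᵐ ω ∂P, dist (W l' ω).1 (W i ω).1 ≠ dist (W l ω).1 (W i ω).1 := by
  have hset : MeasurableSet {z : ((EucSp d × ℝ) × (EucSp d × ℝ)) × (EucSp d × ℝ) |
      dist z.2.1 z.1.1.1 = dist z.1.2.1 z.1.1.1} :=
    measurableSet_eq_fun (by fun_prop) (by fun_prop)
  have hVm : Measurable fun ω => (W i ω, W l ω) := (hW i).prodMk (hW l)
  have h4 := fub hW hind hlaw {l'} hVm (indep_pair_rest hW hind {l'} (by simpa using h2) (by simpa using h3))
    (fun _ z u => if dist u.1 z.1.1 = dist z.2.1 z.1.1 then 1 else 0)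
    (fun _ => Measurable.ite hset measurable_const measurable_const) (f := fun _ => 1) measurable_const
  simp only [one_mul, Finset.prod_singleton] at h4
  have h5 : ∀ z : (EucSp d × ℝ) × (EucSp d × ℝ), ∫⁻ u : EucSp d × ℝ,
      (if dist u.1 z.1.1 = dist z.2.1 z.1.1 then (1:ENNReal) else 0) ∂(μ.prod ν) = 0 := by
    intro z
    have h6 : ∀ u : EucSp d × ℝ, (if dist u.1 z.1.1 = dist z.2.1 z.1.1 then (1:ENNReal) else 0) =
        (Metric.sphere z.1.1 (dist z.2.1 z.1.1)).indicator (fun _ => 1) u.1 := by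
      intro u
      by_cases h : u.1 ∈ Metric.sphere z.1.1 (dist z.2.1 z.1.1)
      · rw [Set.indicator_of_mem h, if_pos (Metric.mem_sphere.1 h)]
      · rw [Set.indicator_of_notMem h, if_neg (fun h' => h (Metric.mem_sphere.2 h'))]
    simp_rw [h6]
    rw [ind_int Metric.isClosed_sphere.measurableSet, hs]
  simp_rw [h5] at h4
  rw [lintegral_zero, lintegral_eq_zero_iff] at h4
  · filter_upwards [h4] with ω hω h7
    simp [h7] at hω
  · exact Measurable.ite (measurableSet_eq_fun ((hW l').fst.dist (hW i).fst) ((hW l).fst.dist (hW i).fst))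
      measurable_const measurable_const

/-- all points but `i` and `l` -/
def others (n i l : ℕ) : Finset ℕ := ((Finset.range n).erase i).erase l

lemma card_others {n i l : ℕ} (hi : i < n) (hl : l < n) (hil : i ≠ l) : (others n i l).card = n - 2 := by
  unfold others
  rw [Finset.card_erase_of_mem (by simp [hl, hil.symm]), Finset.card_erase_of_mem (by simp [hi])]
  simp; omega

lemma cnt_others (n i l : ℕ) (ω : Ωp) : cnt W (others n i l) i l ω =
    ((Finset.range n).filter fun ℓ => ℓ ≠ i ∧
        dist (W ℓ ω).1 (W i ω).1 < dist (W l ω).1 (W i ω).1).card := by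
  unfold cnt others
  congr 1
  ext ℓ
  simp only [Finset.mem_filter, Finset.mem_erase, Finset.mem_range]
  constructor
  · rintro ⟨⟨h1, h2, h3⟩, h4⟩; exact ⟨h3, h2, h4⟩
  · rintro ⟨h3, h2, h4⟩
    refine ⟨⟨?_, h2, h3⟩, h4⟩
    rintro rfl; exact lt_irrefl _ h4

lemma cnt_lt {n i l l' : ℕ} (hl : l < n) (hil : i ≠ l) (ω : Ωp)
    (h : dist (W l ω).1 (W i ω).1 < dist (W l' ω).1 (W i ω).1) :
    cnt W (others n i l) i l ω < cnt W (others n i l') i l' ω := by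
  rw [cnt_others, cnt_others]
  apply Finset.card_lt_card
  refine ⟨fun ℓ hℓ => ?_, fun hsub => ?_⟩
  · rw [Finset.mem_filter] at hℓ ⊢
    exact ⟨hℓ.1, hℓ.2.1, hℓ.2.2.trans h⟩
  · have := hsub (x := l) (by simp [hl, hil.symm, h])
    simp at this

lemma one_point (hs : ∀ x r, μ (Metric.sphere x r) = 0) (hW : ∀ i, Measurable (W i)) (hind : iIndepFun W P)
    (hlaw : ∀ i, P.map (W i) = μ.prod ν) {n i j : ℕ} (hi : i < n) {J : Ωp → ℕ}
    (hJ : ∀ᵐ ω ∂P, J ω < n ∧ J ω ≠ i ∧ cnt W (others n i (J ω)) i (J ω) ω = j)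
    {G : (EucSp d × ℝ) × (EucSp d × ℝ) → ENNReal} (hG : Measurable G) :
    ∫⁻ ω, G (W i ω, W (J ω) ω) ∂P =
      ∫⁻ z, G z * ENNReal.ofReal (wt j (((n - 1 : ℕ) : ℝ) * ((n - 2).choose j : ℝ)) (n - 2 - j)
        (Fm μ z.1.1 z.2.1)) ∂((μ.prod ν).prod (μ.prod ν)) := by
  have htie : ∀ᵐ ω ∂P, ∀ l l' : ℕ, i ≠ l → i ≠ l' → l ≠ l' →
      dist (W l' ω).1 (W i ω).1 ≠ dist (W l ω).1 (W i ω).1 := by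
    rw [ae_all_iff]; intro l
    rw [ae_all_iff]; intro l'
    by_cases h1 : i ≠ l
    · by_cases h2 : i ≠ l'
      · by_cases h3 : l ≠ l'
        · filter_upwards [no_tie hs hW hind hlaw h1 h2 h3] with ω hω _ _ _ using hω
        · exact Eventually.of_forall fun ω _ _ h => absurd h h3
      · exact Eventually.of_forall fun ω _ h _ => absurd h h2
    · exact Eventually.of_forall fun ω h _ _ => absurd h h1
  have h1 : ∫⁻ ω, G (W i ω, W (J ω) ω) ∂P = ∫⁻ ω, ∑ l ∈ (Finset.range n).erase i,
      G (W i ω, W l ω) * (if cnt W (others n i l) i l ω = j then 1 else 0) ∂P := by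
    refine lintegral_congr_ae ?_
    filter_upwards [hJ, htie] with ω hω ht
    rw [Finset.sum_eq_single (J ω)]
    · rw [if_pos hω.2.2, mul_one]
    · intro l hl hlJ
      simp only [Finset.mem_erase, Finset.mem_range] at hl
      rw [if_neg, mul_zero]
      intro hc
      rcases lt_or_gt_of_ne (ht l (J ω) (Ne.symm hl.1) (Ne.symm hω.2.1) hlJ) with h | h
      · have := cnt_lt (W := W) hω.1 (Ne.symm hω.2.1) ω h
        omega
      · have := cnt_lt (W := W) hl.2 (Ne.symm hl.1) ω h
        omega
    · intro h; exact absurd (by simp [hω.1, hω.2.1]) h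
  rw [h1, lintegral_finsetSum']
  · have h2 : ∀ l ∈ (Finset.range n).erase i, ∫⁻ ω, G (W i ω, W l ω) *
        (if cnt W (others n i l) i l ω = j then 1 else 0) ∂P =
        ∫⁻ z, G z * ((n - 2).choose j * (ENNReal.ofReal (Fm μ z.1.1 z.2.1) ^ j *
        ENNReal.ofReal (1 - Fm μ z.1.1 z.2.1) ^ (n - 2 - j))) ∂((μ.prod ν).prod (μ.prod ν)) := by
      intro l hl
      simp only [Finset.mem_erase, Finset.mem_range] at hl
      rw [one_term hW hind hlaw (others n i l) (by simp [others]) (by simp [others]) (Ne.symm hl.1) hG,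
        card_others hi hl.2 (Ne.symm hl.1)]
    rw [Finset.sum_congr rfl h2, Finset.sum_const, Finset.card_erase_of_mem (by simpa using hi),
      Finset.card_range, nsmul_eq_mul, ← lintegral_const_mul' _ _ (ENNReal.natCast_ne_top _)]
    refine lintegral_congr fun z => ?_
    have hF0 := Fm_nonneg μ z.1.1 z.2.1
    have hF1 := Fm_le_one μ z.1.1 z.2.1
    have h3 : 0 ≤ 1 - Fm μ z.1.1 z.2.1 := by linarith
    unfold wt
    rw [ENNReal.ofReal_mul (by positivity), ENNReal.ofReal_mul (by positivity),
      ENNReal.ofReal_mul (by positivity), ENNReal.ofReal_pow hF0, ENNReal.ofReal_pow h3,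
      ENNReal.ofReal_natCast, ENNReal.ofReal_natCast]
    ring
  · intro l hl
    have hGm : Measurable fun ω => G (W i ω, W l ω) := hG.comp ((hW i).prodMk (hW l))
    refine (hGm.mul (Measurable.ite ?_ measurable_const measurable_const)).aemeasurable
    have : Measurable fun ω => cnt W (others n i l) i l ω := by
      unfold cnt
      simp_rw [Finset.card_filter]
      refine Finset.measurable_sum _ fun ℓ _ => Measurable.ite ?_ measurable_const measurable_const
      exact measurableSet_lt ((hW ℓ).fst.dist (hW i).fst) ((hW l).fst.dist (hW i).fst)
    exact this (measurableSet_singleton j)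

end prob3


set_option linter.unusedSectionVars false
section prob4
variable {d : ℕ} {Ωp : Type*} [MeasurableSpace Ωp] {P : Measure Ωp} [IsProbabilityMeasure P]
  {W : ℕ → Ωp → EucSp d × ℝ} {μ : Measure (EucSp d)} [IsProbabilityMeasure μ]
  {ν : Measure ℝ} [IsProbabilityMeasure ν]

lemma prod_three (A B B' : Finset ℕ) (j : ℕ) (hB : B ∈ A.powersetCard j)
    (hB' : B' ∈ (A \ B).powersetCard j) (a b c : ENNReal) :
    ∏ ℓ ∈ A, (if ℓ ∈ B then a else if ℓ ∈ B' then b else c) = a ^ j * (b ^ j * c ^ (A.card - 2 * j)) := by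
  obtain ⟨h1, h2⟩ := Finset.mem_powersetCard.1 hB
  rw [Finset.prod_ite, Finset.prod_const]
  have h3 : A.filter (· ∈ B) = B := by
    ext ℓ; simp only [Finset.mem_filter]; exact ⟨fun h => h.2, fun h => ⟨h1 h, h⟩⟩
  have h4 : A.filter (· ∉ B) = A \ B := by ext ℓ; simp
  rw [h3, h4, prod_two (A \ B) B' j hB', Finset.card_sdiff_of_subset h1, h2]
  congr 3
  omega

lemma count_pair (A : Finset ℕ) (p q : ℕ → Prop) [DecidablePred p] [DecidablePred q]
    (hpq : ∀ ℓ, p ℓ → ¬ q ℓ) (j : ℕ) (hp : (A.filter p).card = j) (hq : (A.filter q).card = j) :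
    1 ≤ ∑ B ∈ A.powersetCard j, ∑ B' ∈ (A \ B).powersetCard j, ∏ ℓ ∈ A,
      (if ℓ ∈ B then (if p ℓ then (1:ENNReal) else 0) else
        if ℓ ∈ B' then (if q ℓ then 1 else 0) else (if p ℓ ∨ q ℓ then 0 else 1)) := by
  have hB : A.filter p ∈ A.powersetCard j := Finset.mem_powersetCard.2 ⟨Finset.filter_subset _ _, hp⟩
  have hB' : A.filter q ∈ (A \ A.filter p).powersetCard j := by
    refine Finset.mem_powersetCard.2 ⟨fun ℓ hℓ => ?_, hq⟩
    rw [Finset.mem_filter] at hℓ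
    simp only [Finset.mem_sdiff, Finset.mem_filter, not_and]
    exact ⟨hℓ.1, fun _ h => hpq ℓ h hℓ.2⟩
  refine le_trans ?_ (Finset.single_le_sum (fun _ _ => bot_le) hB)
  refine le_trans ?_ (Finset.single_le_sum (fun _ _ => bot_le) hB')
  apply le_of_eq
  symm
  refine Finset.prod_eq_one fun ℓ hℓ => ?_
  by_cases h1 : p ℓ <;> by_cases h2 : q ℓ <;> simp [h1, h2, hℓ]

lemma outout_int {x y x' y' : EucSp d}
    (hdis : Disjoint (Metric.ball x (dist y x)) (Metric.ball x' (dist y' x'))) :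
    ∫⁻ u : EucSp d × ℝ, (if dist u.1 x < dist y x ∨ dist u.1 x' < dist y' x' then (0:ENNReal) else 1) ∂(μ.prod ν)
      ≤ ENNReal.ofReal (1 - Fm μ x y) * ENNReal.ofReal (1 - Fm μ x' y') := by
  have h1 : ∀ u : EucSp d × ℝ, (if dist u.1 x < dist y x ∨ dist u.1 x' < dist y' x' then (0:ENNReal) else 1) =
      ((Metric.ball x (dist y x)) ∪ (Metric.ball x' (dist y' x')))ᶜ.indicator (fun _ => 1) u.1 := by
    intro u
    by_cases h : dist u.1 x < dist y x <;> by_cases h' : dist u.1 x' < dist y' x' <;> simp [h, h']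
  simp_rw [h1]
  have hF0 := Fm_nonneg μ x y
  have hF1 := Fm_le_one μ x y
  have hF0' := Fm_nonneg μ x' y'
  have hF1' := Fm_le_one μ x' y'
  rw [ind_int (measurableSet_ball.union measurableSet_ball).compl, ← ofReal_measureReal,
    probReal_compl_eq_one_sub (measurableSet_ball.union measurableSet_ball),
    measureReal_union hdis measurableSet_ball, ← ENNReal.ofReal_mul (by linarith)]
  apply ENNReal.ofReal_le_ofReal
  change 1 - (Fm μ x y + Fm μ x' y') ≤ _
  nlinarith

lemma pair_term (hW : ∀ i, Measurable (W i)) (hind : iIndepFun W P)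
    (hlaw : ∀ i, P.map (W i) = μ.prod ν) (A : Finset ℕ) {i l i' l' : ℕ} (hi : i ∉ A) (hl : l ∉ A)
    (hi' : i' ∉ A) (hl' : l' ∉ A) (hil : i ≠ l) (hil' : i' ≠ l')
    (h1 : i ≠ i') (h2 : i ≠ l') (h3 : l ≠ i') (h4 : l ≠ l')
    {g : (EucSp d × ℝ) × (EucSp d × ℝ) → ENNReal} (hg : Measurable g) {r : ℝ}
    (hgr : ∀ z, r < dist z.2.1 z.1.1 → g z = 0) (j : ℕ) :
    ∫⁻ ω, (if 2 * r < dist (W i' ω).1 (W i ω).1 ∧ cnt W A i l ω = j ∧ cnt W A i' l' ω = j then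
      g (W i ω, W l ω) * g (W i' ω, W l' ω) else 0) ∂P ≤
      (∫⁻ z, g z * (A.card.choose j * (ENNReal.ofReal (Fm μ z.1.1 z.2.1) ^ j *
        ENNReal.ofReal (1 - Fm μ z.1.1 z.2.1) ^ (A.card - 2 * j))) ∂((μ.prod ν).prod (μ.prod ν))) ^ 2 := by
  set f : ((EucSp d × ℝ) × (EucSp d × ℝ)) × ((EucSp d × ℝ) × (EucSp d × ℝ)) → ENNReal :=
    fun z => if 2 * r < dist z.2.1.1 z.1.1.1 then g z.1 * g z.2 else 0 with hf
  have hfm : Measurable f := by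
    refine Measurable.ite (measurableSet_lt measurable_const (by fun_prop)) ?_ measurable_const
    exact (hg.comp measurable_fst).mul (hg.comp measurable_snd)
  have hdis : ∀ z, f z ≠ 0 → Disjoint (Metric.ball z.1.1.1 (dist z.1.2.1 z.1.1.1))
      (Metric.ball z.2.1.1 (dist z.2.2.1 z.2.1.1)) := by
    intro z hz
    simp only [hf] at hz
    split_ifs at hz with h
    · have a1 : dist z.1.2.1 z.1.1.1 ≤ r := by
        by_contra hc; exact hz (by rw [hgr z.1 (not_le.1 hc), zero_mul])
      have a2 : dist z.2.2.1 z.2.1.1 ≤ r := by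
        by_contra hc; exact hz (by rw [hgr z.2 (not_le.1 hc), mul_zero])
      apply Metric.ball_disjoint_ball
      rw [dist_comm] at h
      linarith
    · exact absurd rfl hz
  set φ : Finset ℕ → Finset ℕ → ℕ → (((EucSp d × ℝ) × (EucSp d × ℝ)) × ((EucSp d × ℝ) × (EucSp d × ℝ))) → (EucSp d × ℝ) → ENNReal :=
    fun B B' ℓ z u => if ℓ ∈ B then (if dist u.1 z.1.1.1 < dist z.1.2.1 z.1.1.1 then (1:ENNReal) else 0) else
        if ℓ ∈ B' then (if dist u.1 z.2.1.1 < dist z.2.2.1 z.2.1.1 then 1 else 0) else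
        (if dist u.1 z.1.1.1 < dist z.1.2.1 z.1.1.1 ∨ dist u.1 z.2.1.1 < dist z.2.2.1 z.2.1.1 then 0 else 1)
    with hφ
  have hset1 : MeasurableSet {z : (((EucSp d × ℝ) × (EucSp d × ℝ)) × ((EucSp d × ℝ) × (EucSp d × ℝ))) × (EucSp d × ℝ) |
      dist z.2.1 z.1.1.1.1 < dist z.1.1.2.1 z.1.1.1.1} :=
    measurableSet_lt (by fun_prop) (by fun_prop)
  have hset2 : MeasurableSet {z : (((EucSp d × ℝ) × (EucSp d × ℝ)) × ((EucSp d × ℝ) × (EucSp d × ℝ))) × (EucSp d × ℝ) |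
      dist z.2.1 z.1.2.1.1 < dist z.1.2.2.1 z.1.2.1.1} :=
    measurableSet_lt (by fun_prop) (by fun_prop)
  have hφm : ∀ B B' ℓ, Measurable fun z : (((EucSp d × ℝ) × (EucSp d × ℝ)) × ((EucSp d × ℝ) × (EucSp d × ℝ))) × (EucSp d × ℝ) => φ B B' ℓ z.1 z.2 := by
    intro B B' ℓ
    simp only [hφ]
    by_cases hB : ℓ ∈ B
    · simp only [if_pos hB]
      exact Measurable.ite hset1 measurable_const measurable_const
    · by_cases hB' : ℓ ∈ B'
      · simp only [if_neg hB, if_pos hB']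
        exact Measurable.ite hset2 measurable_const measurable_const
      · simp only [if_neg hB, if_neg hB']
        exact Measurable.ite (hset1.union hset2) measurable_const measurable_const
  set V : Ωp → ((EucSp d × ℝ) × (EucSp d × ℝ)) × ((EucSp d × ℝ) × (EucSp d × ℝ)) := fun ω => ((W i ω, W l ω), (W i' ω, W l' ω)) with hV
  have hVm : Measurable V := ((hW i).prodMk (hW l)).prodMk ((hW i').prodMk (hW l'))
  have hpath : ∀ ω, (if 2 * r < dist (W i' ω).1 (W i ω).1 ∧ cnt W A i l ω = j ∧ cnt W A i' l' ω = j then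
      g (W i ω, W l ω) * g (W i' ω, W l' ω) else 0) ≤
      ∑ B ∈ A.powersetCard j, ∑ B' ∈ (A \ B).powersetCard j,
        f (V ω) * ∏ ℓ ∈ A, φ B B' ℓ (V ω) (W ℓ ω) := by
    intro ω
    split_ifs with h
    · by_cases hf0 : f (V ω) = 0
      · have : g (W i ω, W l ω) * g (W i' ω, W l' ω) = 0 := by
          simpa only [hf, hV, if_pos h.1] using hf0
        rw [this]; exact bot_le
      · have hdj := hdis _ hf0
        have hc := count_pair A (fun ℓ => dist (W ℓ ω).1 (W i ω).1 < dist (W l ω).1 (W i ω).1)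
          (fun ℓ => dist (W ℓ ω).1 (W i' ω).1 < dist (W l' ω).1 (W i' ω).1)
          (fun ℓ ha hb => Set.disjoint_left.1 hdj (Metric.mem_ball.2 ha) (Metric.mem_ball.2 hb))
          j h.2.1 h.2.2
        have hfv : f (V ω) = g (W i ω, W l ω) * g (W i' ω, W l' ω) := by
          simp only [hf, hV, if_pos h.1]
        simp_rw [← Finset.mul_sum]
        rw [← hfv]
        exact le_mul_of_one_le_right bot_le hc
    · exact bot_le
  refine (lintegral_mono hpath).trans ?_
  have hterm : ∀ B ∈ A.powersetCard j, ∀ B' ∈ (A \ B).powersetCard j,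
      ∫⁻ ω, f (V ω) * ∏ ℓ ∈ A, φ B B' ℓ (V ω) (W ℓ ω) ∂P ≤
      (∫⁻ z, g z * (ENNReal.ofReal (Fm μ z.1.1 z.2.1) ^ j *
        ENNReal.ofReal (1 - Fm μ z.1.1 z.2.1) ^ (A.card - 2 * j)) ∂((μ.prod ν).prod (μ.prod ν))) ^ 2 := by
    intro B hB B' hB'
    rw [fub hW hind hlaw A hVm (indep_quad_rest hW hind A hi hl hi' hl') (φ B B') (hφm B B') hfm,
      law_quad hW hind hlaw hil hil' h1 h2 h3 h4, sq, ← lintegral_prod_mul]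
    · refine lintegral_mono fun z => ?_
      by_cases hf0 : f z = 0
      · simp only [hf0, zero_mul]; exact bot_le
      · have hfz : f z = g z.1 * g z.2 := by
          simp only [hf] at hf0 ⊢
          split_ifs at hf0 ⊢ with h
          · rfl
          · exact absurd rfl hf0
        have hb : ∏ ℓ ∈ A, ∫⁻ u, φ B B' ℓ z u ∂(μ.prod ν) ≤
            ENNReal.ofReal (Fm μ z.1.1.1 z.1.2.1) ^ j * (ENNReal.ofReal (Fm μ z.2.1.1 z.2.2.1) ^ j *
            (ENNReal.ofReal (1 - Fm μ z.1.1.1 z.1.2.1) * ENNReal.ofReal (1 - Fm μ z.2.1.1 z.2.2.1)) ^ (A.card - 2 * j)) := by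
          rw [← prod_three A B B' j hB hB']
          refine Finset.prod_le_prod' fun ℓ _ => ?_
          by_cases hB : ℓ ∈ B
          · simp only [hφ, if_pos hB]; exact (in_int _ _).le
          · by_cases hB' : ℓ ∈ B'
            · simp only [hφ, if_neg hB, if_pos hB']; exact (in_int _ _).le
            · simp only [hφ, if_neg hB, if_neg hB']; exact outout_int (hdis z hf0)
        rw [hfz]
        refine (mul_le_mul_right hb _).trans (le_of_eq ?_)
        rw [mul_pow]
        ring
    · have hFm : Measurable fun z : (EucSp d × ℝ) × (EucSp d × ℝ) => Fm μ z.1.1 z.2.1 := by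
        have := (measurable_Fm2 μ).comp (f := fun z : (EucSp d × ℝ) × (EucSp d × ℝ) => (z.1.1, z.2.1)) (by fun_prop)
        simpa only [Function.comp_def] using this
      exact (hg.mul ((hFm.ennreal_ofReal.pow_const _).mul ((measurable_const.sub hFm).ennreal_ofReal.pow_const _))).aemeasurable
    · have hFm : Measurable fun z : (EucSp d × ℝ) × (EucSp d × ℝ) => Fm μ z.1.1 z.2.1 := by
        have := (measurable_Fm2 μ).comp (f := fun z : (EucSp d × ℝ) × (EucSp d × ℝ) => (z.1.1, z.2.1)) (by fun_prop)
        simpa only [Function.comp_def] using this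
      exact (hg.mul ((hFm.ennreal_ofReal.pow_const _).mul ((measurable_const.sub hFm).ennreal_ofReal.pow_const _))).aemeasurable
  have hmeasT : ∀ B B', Measurable fun ω => f (V ω) * ∏ ℓ ∈ A, φ B B' ℓ (V ω) (W ℓ ω) := by
    intro B B'
    refine (hfm.comp hVm).mul (Finset.measurable_prod _ fun ℓ _ => ?_)
    have h5 := (hφm B B' ℓ).comp (hVm.prodMk (hW ℓ))
    exact h5
  rw [lintegral_finsetSum _ fun B _ => Finset.measurable_sum _ fun B' _ => hmeasT B B']
  set I := ∫⁻ z, g z * (ENNReal.ofReal (Fm μ z.1.1 z.2.1) ^ j *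
        ENNReal.ofReal (1 - Fm μ z.1.1 z.2.1) ^ (A.card - 2 * j)) ∂((μ.prod ν).prod (μ.prod ν)) with hI
  have hfin : (∫⁻ z, g z * (A.card.choose j * (ENNReal.ofReal (Fm μ z.1.1 z.2.1) ^ j *
        ENNReal.ofReal (1 - Fm μ z.1.1 z.2.1) ^ (A.card - 2 * j))) ∂((μ.prod ν).prod (μ.prod ν))) =
      A.card.choose j * I := by
    rw [hI, ← lintegral_const_mul' _ _ (ENNReal.natCast_ne_top _)]
    refine lintegral_congr fun z => ?_
    ring
  rw [hfin]
  calc ∑ B ∈ A.powersetCard j, ∫⁻ ω, ∑ B' ∈ (A \ B).powersetCard j,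
        f (V ω) * ∏ ℓ ∈ A, φ B B' ℓ (V ω) (W ℓ ω) ∂P
      ≤ ∑ B ∈ A.powersetCard j, (A.card.choose j * I ^ 2) := by
        refine Finset.sum_le_sum fun B hB => ?_
        rw [lintegral_finsetSum _ fun B' _ => hmeasT B B']
        refine (Finset.sum_le_sum (hterm B hB)).trans ?_
        rw [Finset.sum_const, Finset.card_powersetCard, nsmul_eq_mul]
        gcongr
        exact Finset.sdiff_subset
    _ = _ := by
        rw [Finset.sum_const, Finset.card_powersetCard, nsmul_eq_mul]
        ring

end prob4


set_option linter.unusedSectionVars false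
section prob5
variable {d : ℕ} {Ωp : Type*} [MeasurableSpace Ωp] {P : Measure Ωp} [IsProbabilityMeasure P]
  {W : ℕ → Ωp → EucSp d × ℝ} {μ : Measure (EucSp d)} [IsProbabilityMeasure μ]
  {ν : Measure ℝ} [IsProbabilityMeasure ν]

/-- all points but `i`, `l`, `i'`, `l'` -/
def others4 (n i l i' l' : ℕ) : Finset ℕ := ((others n i l).erase i').erase l'

lemma card_others4 {n i l i' l' : ℕ} (hi : i < n) (hl : l < n) (hi' : i' < n) (hl' : l' < n) (hil : i ≠ l)
    (hil' : i' ≠ l') (h1 : i ≠ i') (h2 : i ≠ l') (h3 : l ≠ i') (h4 : l ≠ l') :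
    (others4 n i l i' l').card = n - 4 := by
  unfold others4
  rw [Finset.card_erase_of_mem, Finset.card_erase_of_mem, card_others hi hl hil]
  · omega
  · simp [others, hi', h1.symm, h3.symm]
  · simp [others, hl', h2.symm, h4.symm, hil'.symm]

lemma cnt_meas (hW : ∀ i, Measurable (W i)) (A : Finset ℕ) (i l : ℕ) :
    Measurable fun ω => cnt W A i l ω := by
  unfold cnt
  simp_rw [Finset.card_filter]
  refine Finset.measurable_sum _ fun ℓ _ => Measurable.ite ?_ measurable_const measurable_const
  exact measurableSet_lt ((hW ℓ).fst.dist (hW i).fst) ((hW l).fst.dist (hW i).fst)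

lemma cnt_others4 {n i l i' l' : ℕ} (ω : Ωp)
    (h1 : ¬ dist (W i' ω).1 (W i ω).1 < dist (W l ω).1 (W i ω).1)
    (h2 : ¬ dist (W l' ω).1 (W i ω).1 < dist (W l ω).1 (W i ω).1) :
    cnt W (others4 n i l i' l') i l ω = cnt W (others n i l) i l ω := by
  unfold cnt others4
  congr 1
  ext ℓ
  simp only [Finset.mem_filter, Finset.mem_erase]
  constructor
  · rintro ⟨⟨_, _, h3⟩, h4⟩; exact ⟨h3, h4⟩
  · rintro ⟨h3, h4⟩
    refine ⟨⟨?_, ?_, h3⟩, h4⟩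
    · rintro rfl; exact h2 h4
    · rintro rfl; exact h1 h4

lemma others4_symm (n i l i' l' : ℕ) : others4 n i l i' l' = others4 n i' l' i l := by
  unfold others4 others
  ext ℓ; simp only [Finset.mem_erase]; tauto

lemma pair_bound (hW : ∀ i, Measurable (W i)) (hind : iIndepFun W P)
    (hlaw : ∀ i, P.map (W i) = μ.prod ν) {n i i' j : ℕ} (hi : i < n) (hi' : i' < n) (hii : i ≠ i')
    {J J' : Ωp → ℕ}
    (hJ : ∀ᵐ ω ∂P, J ω < n ∧ J ω ≠ i ∧ cnt W (others n i (J ω)) i (J ω) ω = j)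
    (hJ' : ∀ᵐ ω ∂P, J' ω < n ∧ J' ω ≠ i' ∧ cnt W (others n i' (J' ω)) i' (J' ω) ω = j)
    {g : (EucSp d × ℝ) × (EucSp d × ℝ) → ENNReal} (hg : Measurable g) {r : ℝ}
    (hgr : ∀ z, r < dist z.2.1 z.1.1 → g z = 0) {C : ENNReal} (hC : ∀ z, g z ≤ C) :
    ∫⁻ ω, g (W i ω, W (J ω) ω) * g (W i' ω, W (J' ω) ω) ∂P ≤
      C ^ 2 * P {ω | dist (W i' ω).1 (W i ω).1 ≤ 2 * r} +
      (∫⁻ z, g z * ENNReal.ofReal (wt j ((n:ℝ) ^ (j + 1) / (j.factorial : ℝ)) (n - 4 - 2 * j)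
        (Fm μ z.1.1 z.2.1)) ∂((μ.prod ν).prod (μ.prod ν))) ^ 2 := by
  classical
  set D : ℕ → ℕ → Prop := fun l l' => i ≠ l ∧ i' ≠ l' ∧ i ≠ l' ∧ l ≠ i' ∧ l ≠ l' with hD
  set N : Set Ωp := {ω | dist (W i' ω).1 (W i ω).1 ≤ 2 * r} with hN
  have hNm : MeasurableSet N := measurableSet_le ((hW i').fst.dist (hW i).fst) measurable_const
  set T : ℕ → ℕ → Ωp → ENNReal := fun l l' ω =>
    if D l l' then
      (if 2 * r < dist (W i' ω).1 (W i ω).1 ∧ cnt W (others4 n i l i' l') i l ω = j ∧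
        cnt W (others4 n i l i' l') i' l' ω = j then
      g (W i ω, W l ω) * g (W i' ω, W l' ω) else 0) else 0 with hT
  have hTm : ∀ l l', Measurable (T l l') := by
    intro l l'
    by_cases h : D l l'
    · simp only [hT, if_pos h]
      refine Measurable.ite ?_ ?_ measurable_const
      · refine (measurableSet_lt measurable_const ((hW i').fst.dist (hW i).fst)).inter ?_
        exact ((cnt_meas hW _ i l) (measurableSet_singleton j)).inter
          ((cnt_meas hW _ i' l') (measurableSet_singleton j))
      · exact (hg.comp ((hW i).prodMk (hW l))).mul (hg.comp ((hW i').prodMk (hW l')))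
    · simp only [hT, if_neg h]; exact measurable_const
  have hpath : ∀ᵐ ω ∂P, g (W i ω, W (J ω) ω) * g (W i' ω, W (J' ω) ω) ≤
      N.indicator (fun _ => C ^ 2) ω + ∑ l ∈ Finset.range n, ∑ l' ∈ Finset.range n, T l l' ω := by
    filter_upwards [hJ, hJ'] with ω h1 h2
    by_cases hω : ω ∈ N
    · rw [Set.indicator_of_mem hω, sq]
      exact (mul_le_mul' (hC _) (hC _)).trans le_self_add
    · by_cases hz : g (W i ω, W (J ω) ω) = 0
      · rw [hz, zero_mul]; exact bot_le
      by_cases hz' : g (W i' ω, W (J' ω) ω) = 0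
      · rw [hz', mul_zero]; exact bot_le
      have hfar : 2 * r < dist (W i' ω).1 (W i ω).1 := not_le.1 hω
      have hr : dist (W (J ω) ω).1 (W i ω).1 ≤ r := by
        by_contra hc; exact hz (hgr _ (not_le.1 hc))
      have hr' : dist (W (J' ω) ω).1 (W i' ω).1 ≤ r := by
        by_contra hc; exact hz' (hgr _ (not_le.1 hc))
      have hr0 : 0 ≤ r := dist_nonneg.trans hr
      have t1 := dist_triangle_left (W i' ω).1 (W i ω).1 (W (J' ω) ω).1
      have t2 := dist_triangle_left (W i' ω).1 (W i ω).1 (W (J ω) ω).1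
      have e2 : i ≠ J' ω := by
        intro h; rw [← h, dist_comm] at hr'; linarith
      have e3 : J ω ≠ i' := by
        intro h; rw [h] at hr; linarith
      have e4 : J ω ≠ J' ω := by
        intro h; rw [h] at hr; linarith
      have hDD : D (J ω) (J' ω) := ⟨h1.2.1.symm, h2.2.1.symm, e2, e3, e4⟩
      refine le_trans ?_ le_add_self
      refine le_trans ?_ (Finset.single_le_sum (f := fun l => ∑ l' ∈ Finset.range n, T l l' ω)
        (fun _ _ => bot_le) (Finset.mem_range.2 h1.1))
      refine le_trans ?_ (Finset.single_le_sum (f := fun l' => T (J ω) l' ω)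
        (fun _ _ => bot_le) (Finset.mem_range.2 h2.1))
      have c1 : cnt W (others4 n i (J ω) i' (J' ω)) i (J ω) ω = j := by
        rw [cnt_others4 ω (by linarith) (by linarith), h1.2.2]
      have c2 : cnt W (others4 n i (J ω) i' (J' ω)) i' (J' ω) ω = j := by
        rw [others4_symm, cnt_others4 ω (by rw [dist_comm]; linarith) (by linarith), h2.2.2]
      simp only [hT]
      rw [if_pos hDD, if_pos ⟨hfar, c1, c2⟩]
  set I := ∫⁻ z, g z * ((n - 4).choose j * (ENNReal.ofReal (Fm μ z.1.1 z.2.1) ^ j *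
        ENNReal.ofReal (1 - Fm μ z.1.1 z.2.1) ^ (n - 4 - 2 * j))) ∂((μ.prod ν).prod (μ.prod ν)) with hI
  have hTI : ∀ l ∈ Finset.range n, ∀ l' ∈ Finset.range n, ∫⁻ ω, T l l' ω ∂P ≤ I ^ 2 := by
    intro l hl l' hl'
    rw [Finset.mem_range] at hl hl'
    by_cases h : D l l'
    · simp only [hT, if_pos h]
      obtain ⟨a1, a2, a3, a4, a5⟩ := h
      have hcard := card_others4 hi hl hi' hl' a1 a2 hii a3 a4 a5
      refine (pair_term hW hind hlaw (others4 n i l i' l') (by simp [others4, others]) (by simp [others4, others])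
        (by simp [others4, others]) (by simp [others4, others]) a1 a2 hii a3 a4 a5 hg hgr j).trans ?_
      rw [hcard]
    · simp only [hT, if_neg h, lintegral_zero]; exact bot_le
  have hnI : (n : ENNReal) * I ≤ ∫⁻ z, g z * ENNReal.ofReal (wt j ((n:ℝ) ^ (j + 1) / (j.factorial : ℝ)) (n - 4 - 2 * j)
        (Fm μ z.1.1 z.2.1)) ∂((μ.prod ν).prod (μ.prod ν)) := by
    rw [hI, ← lintegral_const_mul' _ _ (ENNReal.natCast_ne_top _)]
    refine lintegral_mono fun z => ?_
    have hF0 := Fm_nonneg μ z.1.1 z.2.1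
    have hF1 := Fm_le_one μ z.1.1 z.2.1
    have h3 : 0 ≤ 1 - Fm μ z.1.1 z.2.1 := by linarith
    unfold wt
    rw [ENNReal.ofReal_mul (by positivity), ENNReal.ofReal_mul (by positivity),
      ENNReal.ofReal_pow hF0, ENNReal.ofReal_pow h3]
    have hch : (n : ENNReal) * ((n - 4).choose j : ENNReal) ≤ ENNReal.ofReal ((n:ℝ) ^ (j + 1) / (j.factorial : ℝ)) := by
      rw [← ENNReal.ofReal_natCast, ← ENNReal.ofReal_natCast, ← ENNReal.ofReal_mul (by positivity)]
      apply ENNReal.ofReal_le_ofReal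
      have h4 : (((n - 4).choose j : ℕ) : ℝ) ≤ ((n - 4 : ℕ) : ℝ) ^ j / (j.factorial : ℝ) := Nat.choose_le_pow_div j (n - 4)
      have h5 : ((n - 4 : ℕ) : ℝ) ≤ n := by exact_mod_cast Nat.sub_le _ _
      calc (n:ℝ) * ((n - 4).choose j : ℕ) ≤ n * ((n:ℝ) ^ j / (j.factorial : ℝ)) := by
            refine mul_le_mul_of_nonneg_left (h4.trans ?_) (by positivity)
            gcongr
        _ = _ := by ring
    calc (n : ENNReal) * (g z * ((n - 4).choose j * (ENNReal.ofReal (Fm μ z.1.1 z.2.1) ^ j *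
          ENNReal.ofReal (1 - Fm μ z.1.1 z.2.1) ^ (n - 4 - 2 * j))))
        = g z * ((n * (n - 4).choose j) * ENNReal.ofReal (Fm μ z.1.1 z.2.1) ^ j *
          ENNReal.ofReal (1 - Fm μ z.1.1 z.2.1) ^ (n - 4 - 2 * j)) := by ring
      _ ≤ _ := by gcongr
  refine (lintegral_mono_ae hpath).trans ?_
  rw [lintegral_add_left (measurable_const.indicator hNm), lintegral_indicator_const hNm]
  gcongr
  rw [lintegral_finsetSum _ fun l _ => Finset.measurable_sum _ fun l' _ => hTm l l']
  calc ∑ l ∈ Finset.range n, ∫⁻ ω, ∑ l' ∈ Finset.range n, T l l' ω ∂P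
      ≤ ∑ l ∈ Finset.range n, (n * I ^ 2) := by
        refine Finset.sum_le_sum fun l hl => ?_
        rw [lintegral_finsetSum _ fun l' _ => hTm l l']
        refine (Finset.sum_le_sum (hTI l hl)).trans ?_
        rw [Finset.sum_const, Finset.card_range, nsmul_eq_mul]
    _ = (n * I) ^ 2 := by
        rw [Finset.sum_const, Finset.card_range, nsmul_eq_mul]; ring
    _ ≤ _ := by gcongr

end prob5


set_option linter.unusedSectionVars false

/-- exact weight of the `j+1`-st nearest neighbour -/
def wE (j n : ℕ) (t : ℝ) : ℝ := wt j (((n - 1 : ℕ) : ℝ) * ((n - 2).choose j : ℝ)) (n - 2 - j) t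

/-- upper weight -/
def wU (j n : ℕ) (t : ℝ) : ℝ := wt j ((n:ℝ) ^ (j + 1) / (j.factorial : ℝ)) (n - 4 - 2 * j) t

section prob6
variable {d : ℕ} {Ωp : Type*} [MeasurableSpace Ωp] {P : Measure Ωp} [IsProbabilityMeasure P]
  {W : ℕ → Ωp → EucSp d × ℝ} {μ : Measure (EucSp d)} [IsProbabilityMeasure μ]
  {ν : Measure ℝ} [IsProbabilityMeasure ν]

lemma measurable_wE (j n : ℕ) : Measurable (wE j n) := measurable_wt _ _ _
lemma measurable_wU (j n : ℕ) : Measurable (wU j n) := measurable_wt _ _ _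
lemma wE_nonneg (j n : ℕ) {t : ℝ} (h0 : 0 ≤ t) (h1 : t ≤ 1) : 0 ≤ wE j n t := by
  have : 0 ≤ 1 - t := by linarith
  unfold wE wt; positivity
lemma wU_nonneg (j n : ℕ) {t : ℝ} (h0 : 0 ≤ t) (h1 : t ≤ 1) : 0 ≤ wU j n t := by
  have : 0 ≤ 1 - t := by linarith
  unfold wU wt; positivity

lemma measurable_FF (μ : Measure (EucSp d)) [IsProbabilityMeasure μ] :
    Measurable fun z : (EucSp d × ℝ) × (EucSp d × ℝ) => Fm μ z.1.1 z.2.1 := by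
  have := (measurable_Fm2 μ).comp (f := fun z : (EucSp d × ℝ) × (EucSp d × ℝ) => (z.1.1, z.2.1)) (by fun_prop)
  simpa only [Function.comp_def] using this

lemma lint_pair {ψ : EucSp d × EucSp d → ENNReal} (hψ : Measurable ψ) :
    ∫⁻ z, ψ (z.1.1, z.2.1) ∂((μ.prod ν).prod (μ.prod ν)) = ∫⁻ x, ∫⁻ y, ψ (x, y) ∂μ ∂μ := by
  have h1 : MeasurePreserving (Prod.fst : EucSp d × ℝ → EucSp d) (μ.prod ν) μ := measurePreserving_fst
  have h2 := h1.prod h1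
  have h3 := h2.lintegral_comp hψ
  rw [← lintegral_prod _ hψ.aemeasurable, ← h3]
  rfl

lemma diffF (hs : ∀ x r, μ (Metric.sphere x r) = 0) (j : ℕ) :
    Tendsto (fun n => ∫⁻ z, ENNReal.ofReal |wU j n (Fm μ z.1.1 z.2.1) - wE j n (Fm μ z.1.1 z.2.1)|
      ∂((μ.prod ν).prod (μ.prod ν))) atTop (𝓝 0) := by
  refine ((goodW_upper j).diff (goodW_exact j)).congr' ?_
  filter_upwards [eventually_gt_atTop 0] with n hn
  have hm : Measurable fun t => |wU j n t - wE j n t| := by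
    have h1 := measurable_wU j n
    have h2 := measurable_wE j n
    exact (h1.sub h2).abs
  rw [lint_pair (μ := μ) (ν := ν) (ψ := fun z => ENNReal.ofReal |wU j n (Fm μ z.1 z.2) - wE j n (Fm μ z.1 z.2)|)
    (hm.comp (measurable_Fm2 μ)).ennreal_ofReal]
  have h1 : ∀ x, ∫⁻ y, ENNReal.ofReal |wU j n (Fm μ x y) - wE j n (Fm μ x y)| ∂μ =
      ∫⁻ s in Set.Ioi (0:ℝ), ENNReal.ofReal (if s < n then (1 / (n : ℝ)) * |wU j n (s / n) - wE j n (s / n)| else 0) := by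
    intro x
    have := lint_Fm μ hs x hn (f := fun _ => 1) measurable_const _ hm
    simpa only [one_mul] using this
  simp_rw [h1]
  rw [lintegral_const, measure_univ, mul_one]
  refine lintegral_congr fun s => ?_
  congr 1
  unfold hw wU wE
  split_ifs
  · rw [← mul_sub, abs_mul, abs_of_nonneg (by positivity : (0:ℝ) ≤ 1 / n)]
  · simp

lemma meas_WJ (hW : ∀ i, Measurable (W i)) {J : Ωp → ℕ} (hJm : Measurable J) :
    Measurable fun ω => W (J ω) ω := by
  have h1 : Measurable fun p : ℕ × Ωp => W p.1 p.2 := measurable_from_prod_countable_right fun n => hW n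
  exact h1.comp (hJm.prodMk measurable_id)

lemma one_real (hs : ∀ x r, μ (Metric.sphere x r) = 0) (hW : ∀ i, Measurable (W i)) (hind : iIndepFun W P)
    (hlaw : ∀ i, P.map (W i) = μ.prod ν) {n i j : ℕ} (hi : i < n) {J : Ωp → ℕ} (hJm : Measurable J)
    (hJ : ∀ᵐ ω ∂P, J ω < n ∧ J ω ≠ i ∧ cnt W (others n i (J ω)) i (J ω) ω = j)
    {G : (EucSp d × ℝ) × (EucSp d × ℝ) → ℝ} (hG : Measurable G) (hG0 : ∀ z, 0 ≤ G z) :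
    ∫ ω, G (W i ω, W (J ω) ω) ∂P =
      ∫ z, G z * wE j n (Fm μ z.1.1 z.2.1) ∂((μ.prod ν).prod (μ.prod ν)) := by
  have hF0 := Fm_nonneg μ
  have hF1 := Fm_le_one μ
  rw [integral_eq_lintegral_of_nonneg_ae, integral_eq_lintegral_of_nonneg_ae,
    one_point hs hW hind hlaw hi hJ (G := fun z => ENNReal.ofReal (G z)) hG.ennreal_ofReal]
  · congr 1
    refine lintegral_congr fun z => ?_
    rw [ENNReal.ofReal_mul (hG0 z)]; rfl
  · exact Eventually.of_forall fun z => mul_nonneg (hG0 z) (wE_nonneg _ _ (hF0 _ _) (hF1 _ _))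
  · exact (hG.mul ((measurable_wE j n).comp (measurable_FF μ))).aestronglyMeasurable
  · exact Eventually.of_forall fun ω => hG0 _
  · exact (hG.comp ((hW i).prodMk (meas_WJ hW hJm))).aestronglyMeasurable

lemma near_tendsto (hs : ∀ x r, μ (Metric.sphere x r) = 0) {r : ℕ → ℝ} (hr : Tendsto r atTop (𝓝 0)) :
    Tendsto (fun n => ((μ.prod ν).prod (μ.prod ν)) {z | dist z.2.1 z.1.1 ≤ 2 * r n}) atTop (𝓝 0) := by
  have h0 : ((μ.prod ν).prod (μ.prod ν)) {z | dist z.2.1 z.1.1 = 0} = 0 := by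
    have hm : MeasurableSet {z : EucSp d × EucSp d | dist z.2 z.1 = 0} :=
      measurableSet_eq_fun (by fun_prop) measurable_const
    have hm2 : MeasurableSet {z : (EucSp d × ℝ) × (EucSp d × ℝ) | dist z.2.1 z.1.1 = 0} :=
      measurableSet_eq_fun (by fun_prop) measurable_const
    have h1 := lint_pair (μ := μ) (ν := ν) (ψ := {z : EucSp d × EucSp d | dist z.2 z.1 = 0}.indicator fun _ => 1)
      (measurable_const.indicator hm)
    have h2 : ∀ x, ∫⁻ y, {z : EucSp d × EucSp d | dist z.2 z.1 = 0}.indicator (fun _ => (1:ENNReal)) (x, y) ∂μ = 0 := by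
      intro x
      have h3 : ∀ y, {z : EucSp d × EucSp d | dist z.2 z.1 = 0}.indicator (fun _ => (1:ENNReal)) (x, y) =
          (Metric.sphere x 0).indicator (fun _ => 1) y := by
        intro y
        by_cases h : y ∈ Metric.sphere x 0
        · rw [Set.indicator_of_mem h, Set.indicator_of_mem (by exact h)]
        · rw [Set.indicator_of_notMem h, Set.indicator_of_notMem (by exact h)]
      simp_rw [h3]
      rw [lintegral_indicator Metric.isClosed_sphere.measurableSet]
      simp only [lintegral_const, Measure.restrict_apply_univ, one_mul, hs]
    simp_rw [h2] at h1
    rw [lintegral_zero] at h1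
    rw [← lintegral_indicator_one hm2, ← h1]
    rfl
  rw [← h0]
  refine tendsto_measure_of_ae_tendsto_indicator_of_isFiniteMeasure _
    (measurableSet_eq_fun (by fun_prop) measurable_const)
    (fun n => measurableSet_le (by fun_prop) measurable_const) ?_
  have h4 : ∀ᵐ z ∂((μ.prod ν).prod (μ.prod ν)), z ∉ {z : (EucSp d × ℝ) × (EucSp d × ℝ) | dist z.2.1 z.1.1 = 0} :=
    measure_eq_zero_iff_ae_notMem.1 h0
  filter_upwards [h4] with z hz
  have hz' : 0 < dist z.2.1 z.1.1 := lt_of_le_of_ne dist_nonneg (Ne.symm hz)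
  have h5 : Tendsto (fun n => 2 * r n) atTop (𝓝 0) := by simpa using hr.const_mul 2
  filter_upwards [h5.eventually_lt_const hz'] with n hn
  constructor
  · intro h; exact absurd h (not_le.2 hn)
  · intro h; exact absurd h hz

lemma l1_le_l2 {Y : Ωp → ℝ} (hY : Measurable Y) {B : ℝ} (hB : ∀ ω, |Y ω| ≤ B) :
    (∫ ω, |Y ω| ∂P) ^ 2 ≤ ∫ ω, Y ω ^ 2 ∂P := by
  have hm : MemLp (fun ω => |Y ω|) 2 P := MemLp.of_bound hY.abs.aestronglyMeasurable B
    (Eventually.of_forall fun ω => by simpa using hB ω)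
  have h1 := variance_nonneg (fun ω => |Y ω|) P
  rw [variance_eq_sub hm] at h1
  simp only [Pi.pow_apply, sq_abs] at h1
  linarith

end prob6


set_option linter.unusedSectionVars false

section prob7
variable {d : ℕ} {Ωp : Type*} [MeasurableSpace Ωp] {P : Measure Ωp} [IsProbabilityMeasure P]
  {W : ℕ → Ωp → EucSp d × ℝ} {μ : Measure (EucSp d)} [IsProbabilityMeasure μ]
  {ν : Measure ℝ} [IsProbabilityMeasure ν]

lemma wt_integrable (j : ℕ) {c : ℝ} (hc : 0 ≤ c) (m : ℕ) {g : (EucSp d × ℝ) × (EucSp d × ℝ) → ℝ}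
    (hg : Measurable g) {C : ℝ} (hgC : ∀ z, |g z| ≤ C) :
    Integrable (fun z => g z * wt j c m (Fm μ z.1.1 z.2.1)) ((μ.prod ν).prod (μ.prod ν)) := by
  refine Integrable.of_bound (C := C * c)
    (hg.mul ((measurable_wt j c m).comp (measurable_FF μ))).aestronglyMeasurable
    (Eventually.of_forall fun z => ?_)
  have hF0 := Fm_nonneg μ z.1.1 z.2.1
  have hF1 := Fm_le_one μ z.1.1 z.2.1
  rw [Real.norm_eq_abs, abs_mul, abs_of_nonneg (wt_nonneg hc hF0 hF1)]
  exact mul_le_mul (hgC z) (wt_le hc hF0 hF1) (wt_nonneg hc hF0 hF1) ((abs_nonneg _).trans (hgC z))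

lemma wE_integrable (j n : ℕ) {g : (EucSp d × ℝ) × (EucSp d × ℝ) → ℝ}
    (hg : Measurable g) {C : ℝ} (hgC : ∀ z, |g z| ≤ C) :
    Integrable (fun z => g z * wE j n (Fm μ z.1.1 z.2.1)) ((μ.prod ν).prod (μ.prod ν)) :=
  wt_integrable j (by positivity) _ hg hgC

lemma wU_integrable (j n : ℕ) {g : (EucSp d × ℝ) × (EucSp d × ℝ) → ℝ}
    (hg : Measurable g) {C : ℝ} (hgC : ∀ z, |g z| ≤ C) :
    Integrable (fun z => g z * wU j n (Fm μ z.1.1 z.2.1)) ((μ.prod ν).prod (μ.prod ν)) :=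
  wt_integrable j (by positivity) _ hg hgC

lemma Q_le (j n : ℕ) {g : (EucSp d × ℝ) × (EucSp d × ℝ) → ℝ}
    (hg : Measurable g) {C : ℝ} (hg0 : ∀ z, 0 ≤ g z) (hgC : ∀ z, g z ≤ C) :
    ∫ z, g z * wU j n (Fm μ z.1.1 z.2.1) ∂((μ.prod ν).prod (μ.prod ν)) ≤
    ∫ z, g z * wE j n (Fm μ z.1.1 z.2.1) ∂((μ.prod ν).prod (μ.prod ν)) +
    C * (∫⁻ z, ENNReal.ofReal |wU j n (Fm μ z.1.1 z.2.1) - wE j n (Fm μ z.1.1 z.2.1)|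
      ∂((μ.prod ν).prod (μ.prod ν))).toReal := by
  have hgC' : ∀ z, |g z| ≤ C := fun z => by rw [abs_of_nonneg (hg0 z)]; exact hgC z
  have i1 := wU_integrable (μ := μ) (ν := ν) j n hg hgC'
  have i2 := wE_integrable (μ := μ) (ν := ν) j n hg hgC'
  have o1 := wU_integrable (μ := μ) (ν := ν) j n (g := fun _ => 1) measurable_const (C := 1) (by simp)
  have o2 := wE_integrable (μ := μ) (ν := ν) j n (g := fun _ => 1) measurable_const (C := 1) (by simp)
  have o3 := (o1.sub o2).abs
  simp only [one_mul, Pi.sub_apply] at o3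
  have e1 : (∫⁻ z, ENNReal.ofReal |wU j n (Fm μ z.1.1 z.2.1) - wE j n (Fm μ z.1.1 z.2.1)|
      ∂((μ.prod ν).prod (μ.prod ν))).toReal = ∫ z, |wU j n (Fm μ z.1.1 z.2.1) - wE j n (Fm μ z.1.1 z.2.1)|
      ∂((μ.prod ν).prod (μ.prod ν)) := by
    rw [integral_eq_lintegral_of_nonneg_ae (Eventually.of_forall fun z => abs_nonneg _) o3.1]
  rw [e1, ← integral_const_mul, ← integral_add i2 (o3.const_mul C)]
  refine integral_mono i1 (i2.add (o3.const_mul C)) fun z => ?_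
  change g z * wU j n (Fm μ z.1.1 z.2.1) ≤ g z * wE j n (Fm μ z.1.1 z.2.1) +
    C * |wU j n (Fm μ z.1.1 z.2.1) - wE j n (Fm μ z.1.1 z.2.1)|
  have h1 := le_abs_self (wU j n (Fm μ z.1.1 z.2.1) - wE j n (Fm μ z.1.1 z.2.1))
  have h2 := mul_le_mul_of_nonneg_left h1 (hg0 z)
  have h3 := mul_le_mul_of_nonneg_right (hgC z) (abs_nonneg (wU j n (Fm μ z.1.1 z.2.1) - wE j n (Fm μ z.1.1 z.2.1)))
  linarith

lemma pair_real (hW : ∀ i, Measurable (W i)) (hind : iIndepFun W P)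
    (hlaw : ∀ i, P.map (W i) = μ.prod ν) {n i i' j : ℕ} (hi : i < n) (hi' : i' < n) (hii : i ≠ i')
    {J J' : Ωp → ℕ} (hJm : Measurable J) (hJm' : Measurable J')
    (hJ : ∀ᵐ ω ∂P, J ω < n ∧ J ω ≠ i ∧ cnt W (others n i (J ω)) i (J ω) ω = j)
    (hJ' : ∀ᵐ ω ∂P, J' ω < n ∧ J' ω ≠ i' ∧ cnt W (others n i' (J' ω)) i' (J' ω) ω = j)
    {g : (EucSp d × ℝ) × (EucSp d × ℝ) → ℝ} (hg : Measurable g) {r : ℝ}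
    (hgr : ∀ z, r < dist z.2.1 z.1.1 → g z = 0) {C : ℝ} (hg0 : ∀ z, 0 ≤ g z) (hC : ∀ z, g z ≤ C) :
    ∫ ω, g (W i ω, W (J ω) ω) * g (W i' ω, W (J' ω) ω) ∂P ≤
      C ^ 2 * (((μ.prod ν).prod (μ.prod ν)) {z | dist z.2.1 z.1.1 ≤ 2 * r}).toReal +
      (∫ z, g z * wU j n (Fm μ z.1.1 z.2.1) ∂((μ.prod ν).prod (μ.prod ν))) ^ 2 := by
  have hgC' : ∀ z, |g z| ≤ C := fun z => by rw [abs_of_nonneg (hg0 z)]; exact hC z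
  have i1 := wU_integrable (μ := μ) (ν := ν) j n hg hgC'
  have hC0 : 0 ≤ C := (hg0 ((0, 0), (0, 0))).trans (hC _)
  have hn0 : ∀ z : (EucSp d × ℝ) × (EucSp d × ℝ), 0 ≤ g z * wU j n (Fm μ z.1.1 z.2.1) := fun z =>
    mul_nonneg (hg0 z) (wU_nonneg _ _ (Fm_nonneg μ _ _) (Fm_le_one μ _ _))
  have hpb := pair_bound hW hind hlaw hi hi' hii hJ hJ' (g := fun z => ENNReal.ofReal (g z)) hg.ennreal_ofReal
    (r := r) (fun z hz => by rw [hgr z hz]; simp) (C := ENNReal.ofReal C)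
    (fun z => ENNReal.ofReal_le_ofReal (hC z))
  have e1 : P {ω | dist (W i' ω).1 (W i ω).1 ≤ 2 * r} =
      ((μ.prod ν).prod (μ.prod ν)) {z | dist z.2.1 z.1.1 ≤ 2 * r} := by
    rw [← law_pair hW hind hlaw hii, Measure.map_apply ((hW i).prodMk (hW i'))]
    · rfl
    · exact measurableSet_le (by fun_prop) measurable_const
  have e2 : ∫⁻ z, ENNReal.ofReal (g z) * ENNReal.ofReal (wt j ((n:ℝ) ^ (j + 1) / (j.factorial : ℝ)) (n - 4 - 2 * j)
        (Fm μ z.1.1 z.2.1)) ∂((μ.prod ν).prod (μ.prod ν)) =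
      ENNReal.ofReal (∫ z, g z * wU j n (Fm μ z.1.1 z.2.1) ∂((μ.prod ν).prod (μ.prod ν))) := by
    rw [ofReal_integral_eq_lintegral_ofReal i1 (Eventually.of_forall hn0)]
    refine lintegral_congr fun z => ?_
    rw [ENNReal.ofReal_mul (hg0 z)]; rfl
  rw [e1, e2] at hpb
  rw [integral_eq_lintegral_of_nonneg_ae (Eventually.of_forall fun ω => mul_nonneg (hg0 _) (hg0 _))]
  · apply ENNReal.toReal_le_of_le_ofReal
    · positivity
    · have hQ0 : 0 ≤ ∫ z, g z * wU j n (Fm μ z.1.1 z.2.1) ∂((μ.prod ν).prod (μ.prod ν)) := integral_nonneg hn0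
      rw [ENNReal.ofReal_add (by positivity) (by positivity), ENNReal.ofReal_mul (by positivity),
        ENNReal.ofReal_pow hC0, ENNReal.ofReal_pow hQ0, ENNReal.ofReal_toReal (measure_ne_top _ _)]
      refine le_trans (le_of_eq ?_) hpb
      refine lintegral_congr fun ω => ?_
      rw [ENNReal.ofReal_mul (hg0 _)]
  · exact ((hg.comp ((hW i).prodMk (meas_WJ hW hJm))).mul
      (hg.comp ((hW i').prodMk (meas_WJ hW hJm')))).aestronglyMeasurable

lemma var_bound (hs : ∀ x r, μ (Metric.sphere x r) = 0) (hW : ∀ i, Measurable (W i)) (hind : iIndepFun W P)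
    (hlaw : ∀ i, P.map (W i) = μ.prod ν) {n j : ℕ} (hn : 0 < n)
    {J : ℕ → Ωp → ℕ} (hJm : ∀ i, Measurable (J i))
    (hJ : ∀ i < n, ∀ᵐ ω ∂P, J i ω < n ∧ J i ω ≠ i ∧ cnt W (others n i (J i ω)) i (J i ω) ω = j)
    {g : (EucSp d × ℝ) × (EucSp d × ℝ) → ℝ} (hg : Measurable g) {r : ℝ}
    (hgr : ∀ z, r < dist z.2.1 z.1.1 → g z = 0) {C : ℝ} (hg0 : ∀ z, 0 ≤ g z) (hC : ∀ z, g z ≤ C) :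
    (∫ ω, |(n:ℝ)⁻¹ * ∑ i ∈ Finset.range n, g (W i ω, W (J i ω) ω) -
      ∫ z, g z * wE j n (Fm μ z.1.1 z.2.1) ∂((μ.prod ν).prod (μ.prod ν))| ∂P) ^ 2 ≤
    C ^ 2 * (n:ℝ)⁻¹ + C ^ 2 * (((μ.prod ν).prod (μ.prod ν)) {z | dist z.2.1 z.1.1 ≤ 2 * r}).toReal +
    (2 * C ^ 2 * (∫⁻ z, ENNReal.ofReal |wU j n (Fm μ z.1.1 z.2.1) - wE j n (Fm μ z.1.1 z.2.1)|
      ∂((μ.prod ν).prod (μ.prod ν))).toReal + C ^ 2 *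
      (∫⁻ z, ENNReal.ofReal |wU j n (Fm μ z.1.1 z.2.1) - wE j n (Fm μ z.1.1 z.2.1)|
      ∂((μ.prod ν).prod (μ.prod ν))).toReal ^ 2) := by
  have hn' : (0:ℝ) < n := by exact_mod_cast hn
  have hQ := Q_le (μ := μ) (ν := ν) j n hg hg0 hC
  set p := (((μ.prod ν).prod (μ.prod ν)) {z : (EucSp d × ℝ) × (EucSp d × ℝ) | dist z.2.1 z.1.1 ≤ 2 * r}).toReal with hp
  set δ := (∫⁻ z, ENNReal.ofReal |wU j n (Fm μ z.1.1 z.2.1) - wE j n (Fm μ z.1.1 z.2.1)|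
      ∂((μ.prod ν).prod (μ.prod ν))).toReal with hδ
  have hδ0 : 0 ≤ δ := ENNReal.toReal_nonneg
  have hp0 : 0 ≤ p := ENNReal.toReal_nonneg
  set Q := ∫ z, g z * wU j n (Fm μ z.1.1 z.2.1) ∂((μ.prod ν).prod (μ.prod ν)) with hQd
  set t := ∫ z, g z * wE j n (Fm μ z.1.1 z.2.1) ∂((μ.prod ν).prod (μ.prod ν)) with ht
  have hC0 : 0 ≤ C := (hg0 ((0, 0), (0, 0))).trans (hC _)
  have hQ0 : 0 ≤ Q := integral_nonneg fun z =>
    mul_nonneg (hg0 z) (wU_nonneg _ _ (Fm_nonneg μ _ _) (Fm_le_one μ _ _))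
  have ht0 : 0 ≤ t := integral_nonneg fun z =>
    mul_nonneg (hg0 z) (wE_nonneg _ _ (Fm_nonneg μ _ _) (Fm_le_one μ _ _))
  set Z : ℕ → Ωp → ℝ := fun i ω => g (W i ω, W (J i ω) ω) with hZ
  have hZm : ∀ i, Measurable (Z i) := fun i => hg.comp ((hW i).prodMk (meas_WJ hW (hJm i)))
  have hZ0 : ∀ i ω, 0 ≤ Z i ω := fun i ω => hg0 _
  have hZC : ∀ i ω, Z i ω ≤ C := fun i ω => hC _
  have hZi : ∀ i, Integrable (Z i) P := fun i => Integrable.of_bound (hZm i).aestronglyMeasurable C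
    (Eventually.of_forall fun ω => by rw [Real.norm_eq_abs, abs_of_nonneg (hZ0 i ω)]; exact hZC i ω)
  have hZZC : ∀ i i' ω, Z i ω * Z i' ω ≤ C ^ 2 := fun i i' ω => by
    rw [sq]; exact mul_le_mul (hZC i ω) (hZC i' ω) (hZ0 i' ω) hC0
  have hZZ : ∀ i i', Integrable (fun ω => Z i ω * Z i' ω) P := fun i i' =>
    Integrable.of_bound ((hZm i).mul (hZm i')).aestronglyMeasurable (C ^ 2)
    (Eventually.of_forall fun ω => by
      rw [Real.norm_eq_abs, abs_of_nonneg (mul_nonneg (hZ0 i ω) (hZ0 i' ω))]; exact hZZC i i' ω)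
  have hEZ : ∀ i ∈ Finset.range n, ∫ ω, Z i ω ∂P = t := fun i hi =>
    one_real hs hW hind hlaw (Finset.mem_range.1 hi) (hJm i) (hJ i (Finset.mem_range.1 hi)) hg hg0
  have htC : t ≤ C := by
    rw [← hEZ 0 (Finset.mem_range.2 hn)]
    calc ∫ ω, Z 0 ω ∂P ≤ ∫ ω, C ∂P := integral_mono (hZi 0) (integrable_const _) (hZC 0)
      _ = C := by simp
  have hEZZ : ∀ i ∈ Finset.range n, ∀ i' ∈ Finset.range n, ∫ ω, Z i ω * Z i' ω ∂P ≤
      (if i = i' then C ^ 2 else 0) + (C ^ 2 * p + Q ^ 2) := by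
    intro i hi i' hi'
    rw [Finset.mem_range] at hi hi'
    split_ifs with h
    · have : ∫ ω, Z i ω * Z i' ω ∂P ≤ ∫ ω, C ^ 2 ∂P := integral_mono (hZZ i i') (integrable_const _) (hZZC i i')
      simp at this
      have h2 : 0 ≤ C ^ 2 * p + Q ^ 2 := by positivity
      linarith
    · rw [zero_add]
      exact pair_real hW hind hlaw hi hi' h (hJm i) (hJm i') (hJ i hi) (hJ i' hi') hg hgr hg0 hC
  set T : Ωp → ℝ := fun ω => (n:ℝ)⁻¹ * ∑ i ∈ Finset.range n, Z i ω with hT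
  have hTm : Measurable T := (Finset.measurable_sum _ fun i _ => hZm i).const_mul _
  have hT0 : ∀ ω, 0 ≤ T ω := fun ω => mul_nonneg (by positivity) (Finset.sum_nonneg fun i _ => hZ0 i ω)
  have hTC : ∀ ω, T ω ≤ C := by
    intro ω
    have : ∑ i ∈ Finset.range n, Z i ω ≤ n * C := by
      calc ∑ i ∈ Finset.range n, Z i ω ≤ ∑ i ∈ Finset.range n, C := Finset.sum_le_sum fun i _ => hZC i ω
        _ = n * C := by simp
    calc T ω ≤ (n:ℝ)⁻¹ * (n * C) := mul_le_mul_of_nonneg_left this (by positivity)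
      _ = C := by field_simp
  have hTi : Integrable T P := (integrable_finsetSum _ fun i _ => hZi i).const_mul _
  have hET : ∫ ω, T ω ∂P = t := by
    rw [hT, integral_const_mul, integral_finsetSum _ fun i _ => hZi i, Finset.sum_congr rfl hEZ]
    simp only [Finset.sum_const, Finset.card_range, nsmul_eq_mul]
    field_simp
  have hT2i : Integrable (fun ω => T ω ^ 2) P := Integrable.of_bound (hTm.pow_const 2).aestronglyMeasurable (C ^ 2)
    (Eventually.of_forall fun ω => by
      rw [Real.norm_eq_abs, abs_of_nonneg (sq_nonneg _)]; exact pow_le_pow_left₀ (hT0 ω) (hTC ω) 2)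
  have hET2 : ∫ ω, T ω ^ 2 ∂P ≤ C ^ 2 * (n:ℝ)⁻¹ + (C ^ 2 * p + Q ^ 2) := by
    have e : ∀ ω, T ω ^ 2 = ((n:ℝ)⁻¹) ^ 2 * ∑ i ∈ Finset.range n, ∑ i' ∈ Finset.range n, Z i ω * Z i' ω := by
      intro ω
      rw [hT]; simp only
      rw [mul_pow, sq (∑ i ∈ Finset.range n, Z i ω), Finset.sum_mul_sum]
    simp_rw [e]
    rw [integral_const_mul, integral_finsetSum _ fun i _ => integrable_finsetSum _ fun i' _ => hZZ i i']
    have h1 : ∑ i ∈ Finset.range n, ∫ ω, ∑ i' ∈ Finset.range n, Z i ω * Z i' ω ∂P ≤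
        ∑ i ∈ Finset.range n, (C ^ 2 + n * (C ^ 2 * p + Q ^ 2)) := by
      refine Finset.sum_le_sum fun i hi => ?_
      rw [integral_finsetSum _ fun i' _ => hZZ i i']
      refine (Finset.sum_le_sum (hEZZ i hi)).trans (le_of_eq ?_)
      rw [Finset.sum_add_distrib, Finset.sum_ite_eq, if_pos hi, Finset.sum_const, Finset.card_range,
        nsmul_eq_mul]
    calc _ ≤ ((n:ℝ)⁻¹) ^ 2 * ∑ i ∈ Finset.range n, (C ^ 2 + n * (C ^ 2 * p + Q ^ 2)) :=
          mul_le_mul_of_nonneg_left h1 (by positivity)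
      _ = _ := by
        simp only [Finset.sum_const, Finset.card_range, nsmul_eq_mul]
        field_simp
  have hfin : ∫ ω, (T ω - t) ^ 2 ∂P = ∫ ω, T ω ^ 2 ∂P - t ^ 2 := by
    have e : ∀ ω, (T ω - t) ^ 2 = T ω ^ 2 - (2 * t * T ω - t ^ 2) := fun ω => by ring
    simp_rw [e]
    have i3 : Integrable (fun ω => 2 * t * T ω) P := hTi.const_mul _
    have i4 : Integrable (fun ω => 2 * t * T ω - t ^ 2) P := i3.sub (integrable_const _)
    rw [integral_sub hT2i i4, integral_sub i3 (integrable_const _),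
      integral_const_mul, hET]
    simp
    ring
  refine (l1_le_l2 (Y := fun ω => T ω - t) (hTm.sub measurable_const) (B := C) fun ω => ?_).trans ?_
  · rw [abs_le]; constructor <;> linarith [hT0 ω, hTC ω]
  · rw [hfin]
    have : Q ^ 2 ≤ (t + C * δ) ^ 2 := pow_le_pow_left₀ hQ0 hQ 2
    have h6 : t * (C * δ) ≤ C * (C * δ) := mul_le_mul_of_nonneg_right htC (by positivity)
    nlinarith

lemma var_lim (hs : ∀ x r, μ (Metric.sphere x r) = 0) (hW : ∀ i, Measurable (W i)) (hind : iIndepFun W P)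
    (hlaw : ∀ i, P.map (W i) = μ.prod ν) {j : ℕ}
    {J : ℕ → ℕ → Ωp → ℕ} (hJm : ∀ i n, Measurable (J i n))
    (hJ : ∀ n, j + 1 < n → ∀ i < n, ∀ᵐ ω ∂P, J i n ω < n ∧ J i n ω ≠ i ∧
      cnt W (others n i (J i n ω)) i (J i n ω) ω = j)
    {g : ℕ → (EucSp d × ℝ) × (EucSp d × ℝ) → ℝ} (hg : ∀ n, Measurable (g n)) {r : ℕ → ℝ}
    (hr : Tendsto r atTop (𝓝 0))
    (hgr : ∀ n z, r n < dist z.2.1 z.1.1 → g n z = 0) {C : ℝ} (hg0 : ∀ n z, 0 ≤ g n z) (hC : ∀ n z, g n z ≤ C) :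
    Tendsto (fun n : ℕ => ∫ ω, |(n:ℝ)⁻¹ * ∑ i ∈ Finset.range n, g n (W i ω, W (J i n ω) ω) -
      ∫ z, g n z * wE j n (Fm μ z.1.1 z.2.1) ∂((μ.prod ν).prod (μ.prod ν))| ∂P) atTop (𝓝 0) := by
  have hp := (ENNReal.tendsto_toReal ENNReal.zero_ne_top).comp (near_tendsto (μ := μ) (ν := ν) hs hr)
  have hδ := (ENNReal.tendsto_toReal ENNReal.zero_ne_top).comp (diffF (μ := μ) (ν := ν) hs j)
  simp only [Function.comp_def, ENNReal.toReal_zero] at hp hδ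
  have hn : Tendsto (fun n : ℕ => (n:ℝ)⁻¹) atTop (𝓝 0) := tendsto_inv_atTop_nhds_zero_nat
  have hB := ((hn.const_mul (C ^ 2)).add (hp.const_mul (C ^ 2))).add
    ((hδ.const_mul (2 * C ^ 2)).add ((hδ.pow 2).const_mul (C ^ 2)))
  simp only [mul_zero, add_zero, ne_eq, OfNat.ofNat_ne_zero, not_false_eq_true, zero_pow] at hB
  have hsq : Tendsto (fun n : ℕ => (∫ ω, |(n:ℝ)⁻¹ * ∑ i ∈ Finset.range n, g n (W i ω, W (J i n ω) ω) -
      ∫ z, g n z * wE j n (Fm μ z.1.1 z.2.1) ∂((μ.prod ν).prod (μ.prod ν))| ∂P) ^ 2) atTop (𝓝 0) := by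
    refine tendsto_of_tendsto_of_tendsto_of_le_of_le' tendsto_const_nhds hB
      (Eventually.of_forall fun n => sq_nonneg _) ?_
    filter_upwards [eventually_gt_atTop (j + 1)] with n hn
    exact var_bound hs hW hind hlaw (by omega) (fun i => hJm i n) (hJ n hn) (hg n) (hgr n) (hg0 n) (hC n)
  have := hsq.sqrt
  rw [Real.sqrt_zero] at this
  refine this.congr fun n => ?_
  rw [Real.sqrt_sq (integral_nonneg fun ω => abs_nonneg _)]

end prob7


set_option linter.unusedSectionVars false

section swap
variable {d : ℕ} {μ : Measure (EucSp d)} [IsProbabilityMeasure μ]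
  {ν : Measure ℝ} [IsProbabilityMeasure ν]

/-- regroup the four coordinates -/
def swap4 (z : (EucSp d × ℝ) × (EucSp d × ℝ)) : (EucSp d × EucSp d) × (ℝ × ℝ) :=
  ((z.1.1, z.2.1), (z.1.2, z.2.2))

lemma measurable_swap4 : Measurable (swap4 (d := d)) := by unfold swap4; fun_prop

lemma mp_swap4 : MeasurePreserving (swap4 (d := d)) ((μ.prod ν).prod (μ.prod ν))
    ((μ.prod μ).prod (ν.prod ν)) := by
  refine ⟨measurable_swap4, ?_⟩
  refine Measure.ext_of_lintegral _ fun f hf => ?_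
  rw [lintegral_map hf measurable_swap4]
  have hm : Measurable fun z : (EucSp d × ℝ) × (EucSp d × ℝ) => f (swap4 z) := hf.comp measurable_swap4
  rw [lintegral_prod _ hm.aemeasurable, lintegral_prod _ hf.aemeasurable,
    lintegral_prod _ hm.lintegral_prod_right'.aemeasurable, lintegral_prod _ hf.lintegral_prod_right'.aemeasurable]
  refine lintegral_congr fun x => ?_
  have h1 : ∀ a, ∫⁻ w : EucSp d × ℝ, f (swap4 ((x, a), w)) ∂(μ.prod ν) =
      ∫⁻ y, ∫⁻ b, f ((x, y), (a, b)) ∂ν ∂μ := by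
    intro a
    have hm' : Measurable fun w : EucSp d × ℝ => f (swap4 ((x, a), w)) := hm.comp measurable_prodMk_left
    rw [lintegral_prod _ hm'.aemeasurable]
    rfl
  have h2 : ∀ y, ∫⁻ w : ℝ × ℝ, f ((x, y), w) ∂(ν.prod ν) =
      ∫⁻ a, ∫⁻ b, f ((x, y), (a, b)) ∂ν ∂ν := by
    intro y
    have hf' : Measurable fun w : ℝ × ℝ => f ((x, y), w) := hf.comp measurable_prodMk_left
    rw [lintegral_prod _ hf'.aemeasurable]
  simp_rw [h1, h2]
  rw [lintegral_lintegral_swap]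
  have h3 : Measurable fun p : (ℝ × EucSp d) × ℝ => f ((x, p.1.2), (p.1.1, p.2)) :=
    hf.comp (by fun_prop)
  exact h3.lintegral_prod_right'.aemeasurable

lemma lint_quad (hs : ∀ x r, μ (Metric.sphere x r) = 0) {n : ℕ} (hn : 0 < n)
    {Ψ : ℝ × (ℝ × ℝ) → ENNReal} (hΨ : Measurable Ψ) (j : ℕ) (c : ℝ) (m : ℕ) :
    ∫⁻ z, Ψ (n * Fm μ z.1.1 z.2.1, (z.1.2, z.2.2)) * ENNReal.ofReal (wt j c m (Fm μ z.1.1 z.2.1))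
      ∂((μ.prod ν).prod (μ.prod ν)) =
    ∫⁻ p, Ψ (p.2, p.1) * ENNReal.ofReal (hw j c m n p.2) ∂((ν.prod ν).prod (volume.restrict (Set.Ioi 0))) := by
  have hF2 := measurable_Fm2 μ
  have hFF : Measurable fun w : (EucSp d × EucSp d) × (ℝ × ℝ) => Fm μ w.1.1 w.1.2 := by
    have := hF2.comp (f := fun w : (EucSp d × EucSp d) × (ℝ × ℝ) => w.1) (by fun_prop)
    simpa only [Function.comp_def] using this
  have hm : Measurable fun w : (EucSp d × EucSp d) × (ℝ × ℝ) => Ψ (n * Fm μ w.1.1 w.1.2, w.2) *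
      ENNReal.ofReal (wt j c m (Fm μ w.1.1 w.1.2)) := by
    have e1 := hΨ.comp ((hFF.const_mul (n:ℝ)).prodMk measurable_snd)
    have e2 := ((measurable_wt j c m).comp hFF).ennreal_ofReal
    simp only [Function.comp_def] at e1 e2
    exact e1.mul e2
  have h1 := (mp_swap4 (μ := μ) (ν := ν)).lintegral_comp hm
  have h2 : Measurable fun p : (ℝ × ℝ) × ℝ => Ψ (p.2, p.1) * ENNReal.ofReal (hw j c m n p.2) := by
    have e1 := hΨ.comp (f := fun p : (ℝ × ℝ) × ℝ => (p.2, p.1)) (by fun_prop)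
    have e2 := ((measurable_hw j c m n).comp (f := fun p : (ℝ × ℝ) × ℝ => p.2) (by fun_prop)).ennreal_ofReal
    simp only [Function.comp_def] at e1 e2
    exact e1.mul e2
  rw [lintegral_prod_symm _ hm.aemeasurable] at h1
  simp only [swap4] at h1
  rw [h1, lintegral_prod _ h2.aemeasurable]
  refine lintegral_congr fun w => ?_
  have h3 : Measurable fun v : EucSp d × EucSp d => Ψ (n * Fm μ v.1 v.2, w) *
      ENNReal.ofReal (wt j c m (Fm μ v.1 v.2)) := by
    have e1 := hm.comp (f := fun v : EucSp d × EucSp d => (v, w)) (measurable_id.prodMk measurable_const)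
    simpa only [Function.comp_def] using e1
  rw [lintegral_prod _ h3.aemeasurable]
  have h5 : Measurable fun s : ℝ => Ψ (s, w) := hΨ.comp (measurable_id.prodMk measurable_const)
  have h4 : ∀ x, ∫⁻ y, Ψ (n * Fm μ x y, w) * ENNReal.ofReal (wt j c m (Fm μ x y)) ∂μ = 
      ∫⁻ s in Set.Ioi (0:ℝ), Ψ (s, w) * ENNReal.ofReal (hw j c m n s) := fun x =>
    lint_wt μ hs x hn h5 j c m
  simp_rw [h4]
  rw [lintegral_const, measure_univ, mul_one]

lemma dom_bound (hs : ∀ x r, μ (Metric.sphere x r) = 0) (j : ℕ) : ∃ K : ℝ, 0 < K ∧ ∀ᶠ n : ℕ in atTop,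
    ∀ Ψ : ℝ × (ℝ × ℝ) → ENNReal, Measurable Ψ →
    ∫⁻ z, Ψ (n * Fm μ z.1.1 z.2.1, (z.1.2, z.2.2)) * ENNReal.ofReal (wE j n (Fm μ z.1.1 z.2.1))
      ∂((μ.prod ν).prod (μ.prod ν)) ≤
    ∫⁻ p, Ψ (p.2, p.1) * ENNReal.ofReal (K * (p.2 ^ j * Real.exp (-(p.2 / 2))))
      ∂((ν.prod ν).prod (volume.restrict (Set.Ioi 0))) := by
  obtain ⟨K, hK, hb⟩ := (goodW_exact j).bound
  refine ⟨K, hK, ?_⟩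
  filter_upwards [hb, eventually_gt_atTop 0] with n hn hn0 Ψ hΨ
  unfold wE
  rw [lint_quad hs hn0 hΨ]
  refine lintegral_mono_ae ?_
  have h1 : ∀ᵐ s ∂(volume.restrict (Set.Ioi (0:ℝ))), s ∈ Set.Ioi (0:ℝ) := ae_restrict_mem measurableSet_Ioi
  have h2 := (Measure.quasiMeasurePreserving_snd (μ := ν.prod ν) (ν := volume.restrict (Set.Ioi (0:ℝ)))).ae h1
  filter_upwards [h2] with p hp
  gcongr
  exact hn p.2 (le_of_lt hp)

/-- dominating function -/
def Hf (C q : ℝ) (p : ℝ × (ℝ × ℝ)) : ℝ := C * p.1 ^ q + 4 * p.2.1 ^ 2 + 4 * p.2.2 ^ 2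

/-- tail of the dominating function -/
def Hr (C q A R : ℝ) (p : ℝ × (ℝ × ℝ)) : ENNReal :=
  if p.1 < A ∧ |p.2.1| ≤ R ∧ |p.2.2| ≤ R then 0 else ENNReal.ofReal (Hf C q p)

lemma measurable_Hf (C q : ℝ) : Measurable (Hf C q) := by unfold Hf; fun_prop

lemma measurable_Hr (C q A R : ℝ) : Measurable (Hr C q A R) := by
  unfold Hr
  refine Measurable.ite ?_ measurable_const (measurable_Hf C q).ennreal_ofReal
  have h1 : MeasurableSet {p : ℝ × (ℝ × ℝ) | p.1 < A} := measurableSet_lt measurable_fst measurable_const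
  have h2 : MeasurableSet {p : ℝ × (ℝ × ℝ) | |p.2.1| ≤ R} := measurableSet_le (by fun_prop) measurable_const
  have h3 : MeasurableSet {p : ℝ × (ℝ × ℝ) | |p.2.2| ≤ R} := measurableSet_le (by fun_prop) measurable_const
  exact h1.inter (h2.inter h3)

lemma Hf_fin (hν : Integrable (fun a => a ^ 2) ν) (j : ℕ) (C : ℝ) {q : ℝ} (hq : 0 ≤ q) {K : ℝ} (hK : 0 ≤ K) :
    ∫⁻ p, ENNReal.ofReal (Hf C q (p.2, p.1)) * ENNReal.ofReal (K * (p.2 ^ j * Real.exp (-(p.2 / 2))))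
      ∂((ν.prod ν).prod (volume.restrict (Set.Ioi (0:ℝ)))) < ⊤ := by
  have i0 := integrable_zero j
  have i1 := integrable_gam2 j hq
  have o : Integrable (fun _ : ℝ => (1:ℝ)) ν := integrable_const _
  have a1 := ((o.mul_prod o).mul_prod i1).const_mul (C * K)
  have a2 := ((hν.mul_prod o).mul_prod i0).const_mul (4 * K)
  have a3 := ((o.mul_prod hν).mul_prod i0).const_mul (4 * K)
  have a4 := ((a1.add a2).add a3).lintegral_lt_top
  refine lt_of_le_of_lt (lintegral_mono_ae ?_) a4
  have h1 : ∀ᵐ s ∂(volume.restrict (Set.Ioi (0:ℝ))), s ∈ Set.Ioi (0:ℝ) := ae_restrict_mem measurableSet_Ioi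
  have h2 := (Measure.quasiMeasurePreserving_snd (μ := ν.prod ν) (ν := volume.restrict (Set.Ioi (0:ℝ)))).ae h1
  filter_upwards [h2] with p hp
  have hp : 0 < p.2 := hp
  rw [← ENNReal.ofReal_mul' (by positivity)]
  apply ENNReal.ofReal_le_ofReal
  apply le_of_eq
  simp only [Pi.add_apply, Hf]
  ring

lemma Hr_tendsto (hν : Integrable (fun a => a ^ 2) ν) (j : ℕ) (C : ℝ) {q : ℝ} (hq : 0 ≤ q) {K : ℝ} (hK : 0 ≤ K)
    {A : ℕ → ℝ} (hA : Tendsto A atTop atTop) :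
    Tendsto (fun N : ℕ => ∫⁻ p, Hr C q (A N) N (p.2, p.1) * ENNReal.ofReal (K * (p.2 ^ j * Real.exp (-(p.2 / 2))))
      ∂((ν.prod ν).prod (volume.restrict (Set.Ioi (0:ℝ))))) atTop (𝓝 0) := by
  have h0 : (0 : ENNReal) = ∫⁻ p : (ℝ × ℝ) × ℝ, 0 ∂((ν.prod ν).prod (volume.restrict (Set.Ioi (0:ℝ)))) := by simp
  rw [h0]
  refine tendsto_lintegral_of_dominated_convergence
    (fun p => ENNReal.ofReal (Hf C q (p.2, p.1)) * ENNReal.ofReal (K * (p.2 ^ j * Real.exp (-(p.2 / 2)))))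
    (fun N => ?_) (fun N => Eventually.of_forall fun p => ?_) (Hf_fin hν j C hq hK).ne
    (Eventually.of_forall fun p => ?_)
  · refine ((measurable_Hr C q (A N) N).comp (measurable_snd.prodMk measurable_fst)).mul ?_
    fun_prop
  · refine mul_le_mul_left ?_ _
    unfold Hr
    split_ifs
    · exact bot_le
    · exact le_rfl
  · refine tendsto_const_nhds.congr' ?_
    filter_upwards [hA.eventually_gt_atTop p.2, (tendsto_natCast_atTop_atTop (R := ℝ)).eventually_ge_atTop |p.1.1|,
      (tendsto_natCast_atTop_atTop (R := ℝ)).eventually_ge_atTop |p.1.2|] with N h1 h2 h3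
    unfold Hr
    rw [if_pos ⟨h1, h2, h3⟩, zero_mul]

end swap


set_option linter.unusedSectionVars false

section trunc
variable {d : ℕ} {Ωp : Type*} [MeasurableSpace Ωp] {P : Measure Ωp} [IsProbabilityMeasure P]
  {W : ℕ → Ωp → EucSp d × ℝ} {μ : Measure (EucSp d)} [IsProbabilityMeasure μ]
  {ν : Measure ℝ} [IsProbabilityMeasure ν]

lemma one_int (hs : ∀ x r, μ (Metric.sphere x r) = 0) (hW : ∀ i, Measurable (W i)) (hind : iIndepFun W P)
    (hlaw : ∀ i, P.map (W i) = μ.prod ν) {n i j : ℕ} (hi : i < n) {J : Ωp → ℕ} (hJm : Measurable J)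
    (hJ : ∀ᵐ ω ∂P, J ω < n ∧ J ω ≠ i ∧ cnt W (others n i (J ω)) i (J ω) ω = j)
    {G : (EucSp d × ℝ) × (EucSp d × ℝ) → ℝ} (hG : Measurable G) (hG0 : ∀ z, 0 ≤ G z)
    (hGi : Integrable (fun z => G z * wE j n (Fm μ z.1.1 z.2.1)) ((μ.prod ν).prod (μ.prod ν))) :
    Integrable (fun ω => G (W i ω, W (J ω) ω)) P := by
  refine ⟨(hG.comp ((hW i).prodMk (meas_WJ hW hJm))).aestronglyMeasurable, ?_⟩
  rw [hasFiniteIntegral_iff_ofReal (Eventually.of_forall fun ω => hG0 _)]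
  rw [one_point hs hW hind hlaw hi hJ (G := fun z => ENNReal.ofReal (G z)) hG.ennreal_ofReal]
  refine lt_of_le_of_lt (le_of_eq ?_) hGi.lintegral_lt_top
  refine lintegral_congr fun z => ?_
  rw [ENNReal.ofReal_mul (hG0 z)]; rfl

lemma trunc_step (hs : ∀ x r, μ (Metric.sphere x r) = 0) (hW : ∀ i, Measurable (W i)) (hind : iIndepFun W P)
    (hlaw : ∀ i, P.map (W i) = μ.prod ν) {n j : ℕ} (hn : 0 < n)
    {J : ℕ → Ωp → ℕ} (hJm : ∀ i, Measurable (J i))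
    (hJ : ∀ i < n, ∀ᵐ ω ∂P, J i ω < n ∧ J i ω ≠ i ∧ cnt W (others n i (J i ω)) i (J i ω) ω = j)
    {G g : (EucSp d × ℝ) × (EucSp d × ℝ) → ℝ} (hG : Measurable G) (hg : Measurable g)
    (hg0 : ∀ z, 0 ≤ g z) (hgG : ∀ z, g z ≤ G z) {C : ℝ} (hC : ∀ z, g z ≤ C) {ε : ℝ} (hε : 0 ≤ ε)
    (hE : ∫⁻ z, ENNReal.ofReal (G z - g z) * ENNReal.ofReal (wE j n (Fm μ z.1.1 z.2.1))
      ∂((μ.prod ν).prod (μ.prod ν)) ≤ ENNReal.ofReal ε) (L : ℝ) :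
    ∫ ω, |(n:ℝ)⁻¹ * ∑ i ∈ Finset.range n, G (W i ω, W (J i ω) ω) - L| ∂P ≤
      ∫ ω, |(n:ℝ)⁻¹ * ∑ i ∈ Finset.range n, g (W i ω, W (J i ω) ω) -
        ∫ z, g z * wE j n (Fm μ z.1.1 z.2.1) ∂((μ.prod ν).prod (μ.prod ν))| ∂P + 2 * ε +
      |∫ z, G z * wE j n (Fm μ z.1.1 z.2.1) ∂((μ.prod ν).prod (μ.prod ν)) - L| := by
  have hF0 := Fm_nonneg μ
  have hF1 := Fm_le_one μ
  have hD0 : ∀ z, 0 ≤ G z - g z := fun z => sub_nonneg.2 (hgG z)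
  have hDm : Measurable fun z => G z - g z := hG.sub hg
  have hw0 : ∀ z : (EucSp d × ℝ) × (EucSp d × ℝ), 0 ≤ wE j n (Fm μ z.1.1 z.2.1) := fun z =>
    wE_nonneg _ _ (hF0 _ _) (hF1 _ _)
  have hE' : ∫⁻ z, ENNReal.ofReal ((G z - g z) * wE j n (Fm μ z.1.1 z.2.1))
      ∂((μ.prod ν).prod (μ.prod ν)) ≤ ENNReal.ofReal ε := by
    refine (le_of_eq (lintegral_congr fun z => ?_)).trans hE
    rw [ENNReal.ofReal_mul (hD0 z)]
  have hDw0 : 0 ≤ᵐ[(μ.prod ν).prod (μ.prod ν)] fun z => (G z - g z) * wE j n (Fm μ z.1.1 z.2.1) :=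
    Eventually.of_forall fun z => mul_nonneg (hD0 z) (hw0 z)
  have hDw : AEStronglyMeasurable (fun z => (G z - g z) * wE j n (Fm μ z.1.1 z.2.1))
      ((μ.prod ν).prod (μ.prod ν)) :=
    (hDm.mul ((measurable_wE j n).comp (measurable_FF μ))).aestronglyMeasurable
  have iD : Integrable (fun z => (G z - g z) * wE j n (Fm μ z.1.1 z.2.1)) ((μ.prod ν).prod (μ.prod ν)) := by
    refine ⟨hDw, ?_⟩
    rw [hasFiniteIntegral_iff_ofReal hDw0]
    exact hE'.trans_lt ENNReal.ofReal_lt_top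
  have ig : Integrable (fun z => g z * wE j n (Fm μ z.1.1 z.2.1)) ((μ.prod ν).prod (μ.prod ν)) :=
    wE_integrable j n hg (C := C) fun z => by rw [abs_of_nonneg (hg0 z)]; exact hC z
  set τ := ∫ z, (G z - g z) * wE j n (Fm μ z.1.1 z.2.1) ∂((μ.prod ν).prod (μ.prod ν)) with hτ
  have hτε : τ ≤ ε := by
    rw [hτ, integral_eq_lintegral_of_nonneg_ae hDw0 hDw]
    exact ENNReal.toReal_le_of_le_ofReal hε hE'
  have hτ0 : 0 ≤ τ := integral_nonneg_of_ae hDw0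
  have hsum : ∫ z, G z * wE j n (Fm μ z.1.1 z.2.1) ∂((μ.prod ν).prod (μ.prod ν)) =
      ∫ z, g z * wE j n (Fm μ z.1.1 z.2.1) ∂((μ.prod ν).prod (μ.prod ν)) + τ := by
    rw [hτ, ← integral_add ig iD]
    refine integral_congr_ae (Eventually.of_forall fun z => ?_)
    simp only; ring
  have jD : ∀ i ∈ Finset.range n, Integrable (fun ω => G (W i ω, W (J i ω) ω) - g (W i ω, W (J i ω) ω)) P :=
    fun i hi => one_int hs hW hind hlaw (Finset.mem_range.1 hi) (hJm i) (hJ i (Finset.mem_range.1 hi))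
      (G := fun z => G z - g z) hDm hD0 iD
  have jg : ∀ i ∈ Finset.range n, Integrable (fun ω => g (W i ω, W (J i ω) ω)) P :=
    fun i hi => one_int hs hW hind hlaw (Finset.mem_range.1 hi) (hJm i) (hJ i (Finset.mem_range.1 hi))
      hg hg0 ig
  have jD' := (integrable_finsetSum _ jD).const_mul (n:ℝ)⁻¹
  have jg' := (integrable_finsetSum _ jg).const_mul (n:ℝ)⁻¹
  have eD : ∫ ω, (n:ℝ)⁻¹ * ∑ i ∈ Finset.range n, (G (W i ω, W (J i ω) ω) - g (W i ω, W (J i ω) ω)) ∂P = τ := by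
    rw [integral_const_mul, integral_finsetSum _ jD]
    have : ∀ i ∈ Finset.range n, ∫ ω, (G (W i ω, W (J i ω) ω) - g (W i ω, W (J i ω) ω)) ∂P = τ := fun i hi =>
      one_real hs hW hind hlaw (Finset.mem_range.1 hi) (hJm i) (hJ i (Finset.mem_range.1 hi))
        (G := fun z => G z - g z) hDm hD0
    rw [Finset.sum_congr rfl this, Finset.sum_const, Finset.card_range, nsmul_eq_mul]
    field_simp
  set t := ∫ z, g z * wE j n (Fm μ z.1.1 z.2.1) ∂((μ.prod ν).prod (μ.prod ν)) with ht
  have jgt : Integrable (fun ω => |(n:ℝ)⁻¹ * ∑ i ∈ Finset.range n, g (W i ω, W (J i ω) ω) - t|) P :=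
    (jg'.sub (integrable_const t)).abs
  calc ∫ ω, |(n:ℝ)⁻¹ * ∑ i ∈ Finset.range n, G (W i ω, W (J i ω) ω) - L| ∂P
      ≤ ∫ ω, ((|(n:ℝ)⁻¹ * ∑ i ∈ Finset.range n, g (W i ω, W (J i ω) ω) - t|) +
        ((n:ℝ)⁻¹ * ∑ i ∈ Finset.range n, (G (W i ω, W (J i ω) ω) - g (W i ω, W (J i ω) ω)) + |t - L|)) ∂P := by
        refine integral_mono_of_nonneg (Eventually.of_forall fun ω => abs_nonneg _)
          (jgt.add (jD'.add (integrable_const _))) (Eventually.of_forall fun ω => ?_)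
        have h0 : 0 ≤ (n:ℝ)⁻¹ * ∑ i ∈ Finset.range n, (G (W i ω, W (J i ω) ω) - g (W i ω, W (J i ω) ω)) :=
          mul_nonneg (by positivity) (Finset.sum_nonneg fun i _ => hD0 _)
        simp only
        have e : (n:ℝ)⁻¹ * ∑ i ∈ Finset.range n, G (W i ω, W (J i ω) ω) - L =
          ((n:ℝ)⁻¹ * ∑ i ∈ Finset.range n, g (W i ω, W (J i ω) ω) - t) +
          ((n:ℝ)⁻¹ * ∑ i ∈ Finset.range n, (G (W i ω, W (J i ω) ω) - g (W i ω, W (J i ω) ω)) + (t - L)) := by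
          rw [Finset.sum_sub_distrib]; ring
        rw [e]
        refine (abs_add_le _ _).trans (add_le_add le_rfl ((abs_add_le _ _).trans (add_le_add (abs_of_nonneg h0).le le_rfl)))
    _ = ∫ ω, |(n:ℝ)⁻¹ * ∑ i ∈ Finset.range n, g (W i ω, W (J i ω) ω) - t| ∂P + (τ + |t - L|) := by
        have hc : Integrable (fun ω => (n:ℝ)⁻¹ * ∑ i ∈ Finset.range n,
            (G (W i ω, W (J i ω) ω) - g (W i ω, W (J i ω) ω)) + |t - L|) P := jD'.add (integrable_const _)
        rw [integral_add jgt hc]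
        congr 1
        have := integral_add jD' (integrable_const (μ := P) |t - L|)
        rw [this, eD]; simp
    _ ≤ _ := by
        rw [hsum]
        have : |t - L| ≤ |t + τ - L| + τ := by
          have : t - L = (t + τ - L) + (-τ) := by ring
          rw [this]
          refine (abs_add_le _ _).trans ?_
          rw [abs_neg, abs_of_nonneg hτ0]
        linarith

lemma trunc_lim (hs : ∀ x r, μ (Metric.sphere x r) = 0) (hW : ∀ i, Measurable (W i)) (hind : iIndepFun W P)
    (hlaw : ∀ i, P.map (W i) = μ.prod ν) {j : ℕ}
    {J : ℕ → ℕ → Ωp → ℕ} (hJm : ∀ i n, Measurable (J i n))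
    (hJ : ∀ n, j + 1 < n → ∀ i < n, ∀ᵐ ω ∂P, J i n ω < n ∧ J i n ω ≠ i ∧
      cnt W (others n i (J i n ω)) i (J i n ω) ω = j)
    {G : ℕ → (EucSp d × ℝ) × (EucSp d × ℝ) → ℝ} (hG : ∀ n, Measurable (G n))
    (hT : ∀ ε : ℝ, 0 < ε → ∃ (g : ℕ → (EucSp d × ℝ) × (EucSp d × ℝ) → ℝ) (r : ℕ → ℝ) (C : ℝ),
      (∀ n, Measurable (g n)) ∧ (Tendsto r atTop (𝓝 0)) ∧
      (∀ n z, r n < dist z.2.1 z.1.1 → g n z = 0) ∧ (∀ n z, 0 ≤ g n z) ∧ (∀ n z, g n z ≤ C) ∧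
      (∀ n z, g n z ≤ G n z) ∧
      ∀ᶠ n in atTop, ∫⁻ z, ENNReal.ofReal (G n z - g n z) * ENNReal.ofReal (wE j n (Fm μ z.1.1 z.2.1))
        ∂((μ.prod ν).prod (μ.prod ν)) ≤ ENNReal.ofReal ε) {L : ℝ}
    (hL : Tendsto (fun n : ℕ => ∫ z, G n z * wE j n (Fm μ z.1.1 z.2.1) ∂((μ.prod ν).prod (μ.prod ν))) atTop (𝓝 L)) :
    Tendsto (fun n : ℕ => ∫ ω, |(n:ℝ)⁻¹ * ∑ i ∈ Finset.range n, G n (W i ω, W (J i n ω) ω) - L| ∂P)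
      atTop (𝓝 0) := by
  rw [Metric.tendsto_atTop']
  intro ε hε
  obtain ⟨g, r, C, hg, hr, hgr, hg0, hC, hgG, hE⟩ := hT (ε / 8) (by positivity)
  have hv := var_lim hs hW hind hlaw hJm hJ hg hr hgr hg0 hC
  have hL' : Tendsto (fun n : ℕ => |∫ z, G n z * wE j n (Fm μ z.1.1 z.2.1) ∂((μ.prod ν).prod (μ.prod ν)) - L|)
      atTop (𝓝 0) := by
    have := (hL.sub_const L).abs
    simpa using this
  have h1 := hv.eventually (gt_mem_nhds (show (0:ℝ) < ε / 4 by positivity))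
  have h2 := hL'.eventually (gt_mem_nhds (show (0:ℝ) < ε / 4 by positivity))
  have h3 : ∀ᶠ n : ℕ in atTop, dist (∫ ω, |(n:ℝ)⁻¹ * ∑ i ∈ Finset.range n, G n (W i ω, W (J i n ω) ω) - L| ∂P) 0 < ε := by
    filter_upwards [h1, h2, hE, eventually_gt_atTop (j + 1)] with n a1 a2 a3 a4
    have := trunc_step hs hW hind hlaw (by omega) (fun i => hJm i n) (hJ n a4) (hG n) (hg n) (hg0 n) (hgG n)
      (hC n) (by positivity) a3 L
    rw [Real.dist_0_eq_abs, abs_of_nonneg (integral_nonneg fun ω => abs_nonneg _)]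
    linarith
  obtain ⟨N, hN⟩ := eventually_atTop.1 h3
  exact ⟨N, fun n hn => hN n hn.le⟩

end trunc


set_option linter.unusedSectionVars false

/-- rescaled squared increment of a pair of marked points -/
def Gf {d : ℕ} (h : EucSp d → ℝ) (n : ℕ) (z : (EucSp d × ℝ) × (EucSp d × ℝ)) : ℝ :=
  (n:ℝ) ^ (2 / (d:ℝ)) * ((h z.2.1 + (n:ℝ) ^ (-1 / (d:ℝ)) * z.2.2) - (h z.1.1 + (n:ℝ) ^ (-1 / (d:ℝ)) * z.1.2)) ^ 2

/-- truncation region -/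
def TrS {d : ℕ} (Ωs : Set (EucSp d)) (N n : ℕ) : Set ((EucSp d × ℝ) × (EucSp d × ℝ)) :=
  {z | dist z.2.1 z.1.1 ≤ N * (n:ℝ) ^ (-1 / (d:ℝ))} ∩ ({z | |z.1.2| ≤ N} ∩ ({z | |z.2.2| ≤ N} ∩
    ({z | z.1.1 ∈ Ωs} ∩ {z | z.2.1 ∈ Ωs})))

section conc
variable {d : ℕ} {μ : Measure (EucSp d)} [IsProbabilityMeasure μ]
  {ν : Measure ℝ} [IsProbabilityMeasure ν] {h : EucSp d → ℝ}

lemma Gf_nonneg (n : ℕ) (z : (EucSp d × ℝ) × (EucSp d × ℝ)) : 0 ≤ Gf h n z := by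
  unfold Gf; positivity

lemma measurable_Gf (hh : Measurable h) (n : ℕ) : Measurable (Gf h n) := by
  unfold Gf; fun_prop

lemma measurable_TrS {Ωs : Set (EucSp d)} (hΩ : MeasurableSet Ωs) (N n : ℕ) : MeasurableSet (TrS Ωs N n) := by
  unfold TrS
  refine MeasurableSet.inter ?_ (MeasurableSet.inter ?_ (MeasurableSet.inter ?_ (MeasurableSet.inter ?_ ?_)))
  · exact measurableSet_le (by fun_prop) measurable_const
  · exact measurableSet_le (by fun_prop) measurable_const
  · exact measurableSet_le (by fun_prop) measurable_const
  · exact (measurable_fst.comp measurable_fst) hΩ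
  · exact (measurable_fst.comp measurable_snd) hΩ

lemma Gf_zero (hd : 1 ≤ d) (z : (EucSp d × ℝ) × (EucSp d × ℝ)) : Gf h 0 z = 0 := by
  unfold Gf
  have : (2:ℝ) / d ≠ 0 := by positivity
  rw [Nat.cast_zero, Real.zero_rpow this, zero_mul]

lemma Gf_le {n : ℕ} (hn : 0 < n) (z : (EucSp d × ℝ) × (EucSp d × ℝ)) :
    Gf h n z ≤ 2 * ((n:ℝ) ^ (2 / (d:ℝ)) * (h z.2.1 - h z.1.1) ^ 2) + 4 * z.1.2 ^ 2 + 4 * z.2.2 ^ 2 := by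
  have h1 := n_sq (d := d) hn
  unfold Gf
  set s := (n:ℝ) ^ (-1 / (d:ℝ))
  have hQ : 0 ≤ (n:ℝ) ^ (2 / (d:ℝ)) := by positivity
  set Q := (n:ℝ) ^ (2 / (d:ℝ))
  set D := h z.2.1 - h z.1.1 with hD
  set b := z.2.2
  set a := z.1.2
  have e : (h z.2.1 + s * b) - (h z.1.1 + s * a) = D + s * (b - a) := by rw [hD]; ring
  rw [e]
  have h2 : Q * (D + s * (b - a)) ^ 2 ≤ Q * (2 * D ^ 2 + 2 * (s * (b - a)) ^ 2) := by
    refine mul_le_mul_of_nonneg_left ?_ hQ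
    nlinarith [sq_nonneg (D - s * (b - a))]
  have h3 : Q * (2 * D ^ 2 + 2 * (s * (b - a)) ^ 2) = 2 * (Q * D ^ 2) + 2 * ((Q * s ^ 2) * (b - a) ^ 2) := by ring
  rw [h3, h1] at h2
  nlinarith [sq_nonneg (a + b)]

lemma Gf_le_Hf (hd : 1 ≤ d) {Ωs : Set (EucSp d)} {c' : ℝ} (hc' : 0 < c')
    (hF : ∀ x ∈ Ωs, ∀ y ∈ Ωs, c' * dist y x ^ d ≤ Fm μ x y) {Λ : ℝ}
    (hΛ : ∀ x ∈ Ωs, ∀ y ∈ Ωs, |h y - h x| ≤ Λ * dist y x) {n : ℕ} (hn : 0 < n)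
    (z : (EucSp d × ℝ) × (EucSp d × ℝ)) (hx : z.1.1 ∈ Ωs) (hy : z.2.1 ∈ Ωs) :
    Gf h n z ≤ Hf (2 * (Λ ^ 2 * (1 / c') ^ (2 / (d:ℝ)))) (2 / (d:ℝ)) (n * Fm μ z.1.1 z.2.1, (z.1.2, z.2.2)) := by
  refine (Gf_le hn z).trans ?_
  unfold Hf
  simp only
  have hF0 := Fm_nonneg μ z.1.1 z.2.1
  have h1 : (h z.2.1 - h z.1.1) ^ 2 ≤ Λ ^ 2 * dist z.2.1 z.1.1 ^ 2 := by
    rw [← sq_abs, ← mul_pow]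
    exact pow_le_pow_left₀ (abs_nonneg _) (hΛ _ hx _ hy) 2
  have h2 := sq_le_rpow hd hc' dist_nonneg (hF _ hx _ hy)
  have h3 : (n * Fm μ z.1.1 z.2.1) ^ (2 / (d:ℝ)) = (n:ℝ) ^ (2 / (d:ℝ)) * (Fm μ z.1.1 z.2.1) ^ (2 / (d:ℝ)) :=
    Real.mul_rpow (by positivity) hF0
  rw [h3]
  have hQ : 0 ≤ (n:ℝ) ^ (2 / (d:ℝ)) := by positivity
  have h4 : (n:ℝ) ^ (2 / (d:ℝ)) * (h z.2.1 - h z.1.1) ^ 2 ≤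
      (n:ℝ) ^ (2 / (d:ℝ)) * (Λ ^ 2 * ((1 / c') ^ (2 / (d:ℝ)) * (Fm μ z.1.1 z.2.1) ^ (2 / (d:ℝ)))) := by
    refine mul_le_mul_of_nonneg_left (h1.trans ?_) hQ
    exact mul_le_mul_of_nonneg_left h2 (sq_nonneg _)
  linarith

lemma Gf_tr_le (hd : 1 ≤ d) {Ωs : Set (EucSp d)} {Λ : ℝ}
    (hΛ : ∀ x ∈ Ωs, ∀ y ∈ Ωs, |h y - h x| ≤ Λ * dist y x) (N n : ℕ)
    (z : (EucSp d × ℝ) × (EucSp d × ℝ)) (hz : z ∈ TrS Ωs N n) :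
    Gf h n z ≤ 2 * (Λ ^ 2 * N ^ 2) + 4 * N ^ 2 + 4 * N ^ 2 := by
  rcases Nat.eq_zero_or_pos n with rfl | hn
  · rw [Gf_zero hd]; positivity
  refine (Gf_le hn z).trans ?_
  obtain ⟨h1, h2, h3, hx, hy⟩ := hz
  have h1 : dist z.2.1 z.1.1 ≤ N * (n:ℝ) ^ (-1 / (d:ℝ)) := h1
  have h2 : |z.1.2| ≤ N := h2
  have h3 : |z.2.2| ≤ N := h3
  have hx : z.1.1 ∈ Ωs := hx
  have hy : z.2.1 ∈ Ωs := hy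
  have e2 : z.1.2 ^ 2 ≤ (N:ℝ) ^ 2 := by rw [← sq_abs]; exact pow_le_pow_left₀ (abs_nonneg _) h2 2
  have e3 : z.2.2 ^ 2 ≤ (N:ℝ) ^ 2 := by rw [← sq_abs]; exact pow_le_pow_left₀ (abs_nonneg _) h3 2
  have e1 : (h z.2.1 - h z.1.1) ^ 2 ≤ Λ ^ 2 * dist z.2.1 z.1.1 ^ 2 := by
    rw [← sq_abs, ← mul_pow]
    exact pow_le_pow_left₀ (abs_nonneg _) (hΛ _ hx _ hy) 2
  have e4 : dist z.2.1 z.1.1 ^ 2 ≤ (N * (n:ℝ) ^ (-1 / (d:ℝ))) ^ 2 := pow_le_pow_left₀ dist_nonneg h1 2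
  have hQ : 0 ≤ (n:ℝ) ^ (2 / (d:ℝ)) := by positivity
  have h4 : (n:ℝ) ^ (2 / (d:ℝ)) * (h z.2.1 - h z.1.1) ^ 2 ≤
      (n:ℝ) ^ (2 / (d:ℝ)) * (Λ ^ 2 * (N * (n:ℝ) ^ (-1 / (d:ℝ))) ^ 2) := by
    refine mul_le_mul_of_nonneg_left (e1.trans ?_) hQ
    exact mul_le_mul_of_nonneg_left e4 (sq_nonneg _)
  have h5 : (n:ℝ) ^ (2 / (d:ℝ)) * (Λ ^ 2 * (N * (n:ℝ) ^ (-1 / (d:ℝ))) ^ 2) =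
      Λ ^ 2 * N ^ 2 * ((n:ℝ) ^ (2 / (d:ℝ)) * ((n:ℝ) ^ (-1 / (d:ℝ))) ^ 2) := by ring
  rw [h5, n_sq hn] at h4
  linarith

lemma tail_le (hd : 1 ≤ d) {Ωs : Set (EucSp d)} {c' : ℝ} (hc' : 0 < c')
    (hF : ∀ x ∈ Ωs, ∀ y ∈ Ωs, c' * dist y x ^ d ≤ Fm μ x y) {Λ : ℝ}
    (hΛ : ∀ x ∈ Ωs, ∀ y ∈ Ωs, |h y - h x| ≤ Λ * dist y x) (N : ℕ) {n : ℕ} (hn : 0 < n)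
    (z : (EucSp d × ℝ) × (EucSp d × ℝ)) (hx : z.1.1 ∈ Ωs) (hy : z.2.1 ∈ Ωs) :
    ENNReal.ofReal (Gf h n z - (TrS Ωs N n).indicator (Gf h n) z) ≤
      Hr (2 * (Λ ^ 2 * (1 / c') ^ (2 / (d:ℝ)))) (2 / (d:ℝ)) (c' * N ^ d) N
        (n * Fm μ z.1.1 z.2.1, (z.1.2, z.2.2)) := by
  by_cases hz : z ∈ TrS Ωs N n
  · rw [Set.indicator_of_mem hz, sub_self, ENNReal.ofReal_zero]; exact bot_le
  rw [Set.indicator_of_notMem hz, sub_zero]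
  unfold Hr
  rw [if_neg]
  · exact ENNReal.ofReal_le_ofReal (Gf_le_Hf hd hc' hF hΛ hn z hx hy)
  rintro ⟨h1, h2, h3⟩
  simp only at h1 h2 h3
  refine hz ⟨?_, h2, h3, hx, hy⟩
  change dist z.2.1 z.1.1 ≤ N * (n:ℝ) ^ (-1 / (d:ℝ))
  have hn' : (0:ℝ) < n := by exact_mod_cast hn
  refine le_of_lt (lt_of_pow_lt_pow_left₀ d (by positivity) ?_)
  rw [mul_pow, n_pow hd hn]
  have h4 := hF _ hx _ hy
  rw [mul_one_div, lt_div_iff₀ hn']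
  have h5 : c' * (dist z.2.1 z.1.1 ^ d * n) < c' * N ^ d := by
    calc c' * (dist z.2.1 z.1.1 ^ d * n) = n * (c' * dist z.2.1 z.1.1 ^ d) := by ring
      _ ≤ n * Fm μ z.1.1 z.2.1 := mul_le_mul_of_nonneg_left h4 hn'.le
      _ < _ := h1
  exact lt_of_mul_lt_mul_left h5 hc'.le

lemma ae_pair {Ωs : Set (EucSp d)} (hΩ : ∀ᵐ y ∂μ, y ∈ Ωs) :
    ∀ᵐ z ∂((μ.prod ν).prod (μ.prod ν)), z.1.1 ∈ Ωs ∧ z.2.1 ∈ Ωs := by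
  have h1 := (Measure.quasiMeasurePreserving_fst (μ := μ) (ν := ν)).ae hΩ
  have h2 := (Measure.quasiMeasurePreserving_fst (μ := μ.prod ν) (ν := μ.prod ν)).ae h1
  have h3 := (Measure.quasiMeasurePreserving_snd (μ := μ.prod ν) (ν := μ.prod ν)).ae h1
  filter_upwards [h2, h3] with z a b
  exact ⟨a, b⟩

lemma trunc_exists (hd : 1 ≤ d) (hs : ∀ x r, μ (Metric.sphere x r) = 0) {Ωs : Set (EucSp d)}
    (hΩm : MeasurableSet Ωs) (hΩ : ∀ᵐ y ∂μ, y ∈ Ωs) {c' : ℝ} (hc' : 0 < c')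
    (hF : ∀ x ∈ Ωs, ∀ y ∈ Ωs, c' * dist y x ^ d ≤ Fm μ x y) (hh : Measurable h) {Λ : ℝ}
    (hΛ : ∀ x ∈ Ωs, ∀ y ∈ Ωs, |h y - h x| ≤ Λ * dist y x)
    (hν : Integrable (fun a => a ^ 2) ν) (j : ℕ) (ε : ℝ) (hε : 0 < ε) :
    ∃ (g : ℕ → (EucSp d × ℝ) × (EucSp d × ℝ) → ℝ) (r : ℕ → ℝ) (C : ℝ),
      (∀ n, Measurable (g n)) ∧ (Tendsto r atTop (𝓝 0)) ∧
      (∀ n z, r n < dist z.2.1 z.1.1 → g n z = 0) ∧ (∀ n z, 0 ≤ g n z) ∧ (∀ n z, g n z ≤ C) ∧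
      (∀ n z, g n z ≤ Gf h n z) ∧
      ∀ᶠ n in atTop, ∫⁻ z, ENNReal.ofReal (Gf h n z - g n z) * ENNReal.ofReal (wE j n (Fm μ z.1.1 z.2.1))
        ∂((μ.prod ν).prod (μ.prod ν)) ≤ ENNReal.ofReal ε := by
  obtain ⟨K, hK, hb⟩ := dom_bound (μ := μ) (ν := ν) hs j
  have hA : Tendsto (fun N : ℕ => c' * (N:ℝ) ^ d) atTop atTop :=
    ((tendsto_pow_atTop (by omega)).comp tendsto_natCast_atTop_atTop).const_mul_atTop hc'
  have hH := Hr_tendsto hν j (2 * (Λ ^ 2 * (1 / c') ^ (2 / (d:ℝ)))) (q := 2 / (d:ℝ)) (by positivity) hK.le hA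
  obtain ⟨N, hN⟩ := (hH.eventually (gt_mem_nhds (ENNReal.ofReal_pos.2 hε))).exists
  refine ⟨fun n => (TrS Ωs N n).indicator (Gf h n), fun n => N * (n:ℝ) ^ (-1 / (d:ℝ)),
    2 * (Λ ^ 2 * N ^ 2) + 4 * N ^ 2 + 4 * N ^ 2, fun n => (measurable_Gf hh n).indicator (measurable_TrS hΩm N n),
    ?_, ?_, ?_, ?_, ?_, ?_⟩
  · simpa using (n_tendsto hd).const_mul (N:ℝ)
  · intro n z hz
    refine Set.indicator_of_notMem (fun hc => ?_) _
    have : dist z.2.1 z.1.1 ≤ N * (n:ℝ) ^ (-1 / (d:ℝ)) := hc.1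
    linarith
  · intro n z
    exact Set.indicator_nonneg (fun z _ => Gf_nonneg n z) z
  · intro n z
    by_cases hz : z ∈ TrS Ωs N n
    · simp only [Set.indicator_of_mem hz]
      exact Gf_tr_le hd hΛ N n z hz
    · simp only [Set.indicator_of_notMem hz]
      positivity
  · intro n z
    exact Set.indicator_le_self' (fun _ _ => Gf_nonneg n _) z
  · filter_upwards [hb, eventually_gt_atTop 0] with n hn hn0
    refine le_trans ?_ hN.le
    refine le_trans ?_ (hn _ (measurable_Hr _ _ _ _))
    refine lintegral_mono_ae ?_
    filter_upwards [ae_pair (μ := μ) (ν := ν) hΩ] with z hz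
    exact mul_le_mul_left (tail_le hd hc' hF hΛ N hn0 z hz.1 hz.2) _

end conc


set_option linter.unusedSectionVars false

section mean
variable {d : ℕ} {μ : Measure (EucSp d)} [IsProbabilityMeasure μ]
  {ν : Measure ℝ} [IsProbabilityMeasure ν] {h : EucSp d → ℝ}

lemma int_swap {f : (EucSp d × EucSp d) × (ℝ × ℝ) → ℝ} (hf : Measurable f) :
    ∫ z, f ((z.1.1, z.2.1), (z.1.2, z.2.2)) ∂((μ.prod ν).prod (μ.prod ν)) =
      ∫ w, f w ∂((μ.prod μ).prod (ν.prod ν)) := by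
  rw [← (mp_swap4 (μ := μ) (ν := ν)).map_eq, integral_map measurable_swap4.aemeasurable hf.aestronglyMeasurable]
  rfl

lemma mark_mean (h1 : Integrable (fun a => a) ν) (h0 : ∫ a, a ∂ν = 0) :
    Integrable (fun p : ℝ × ℝ => p.2 - p.1) (ν.prod ν) ∧ ∫ p : ℝ × ℝ, (p.2 - p.1) ∂(ν.prod ν) = 0 := by
  have o : Integrable (fun _ : ℝ => (1:ℝ)) ν := integrable_const _
  have i1 : Integrable (fun p : ℝ × ℝ => p.1 * 1) (ν.prod ν) := h1.mul_prod o
  have i2 : Integrable (fun p : ℝ × ℝ => 1 * p.2) (ν.prod ν) := o.mul_prod h1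
  have e1 : ∫ p : ℝ × ℝ, p.1 * 1 ∂(ν.prod ν) = 0 := by
    rw [integral_prod_mul (fun a : ℝ => a) (fun _ : ℝ => (1:ℝ)), h0, zero_mul]
  have e2 : ∫ p : ℝ × ℝ, 1 * p.2 ∂(ν.prod ν) = 0 := by
    rw [integral_prod_mul (fun _ : ℝ => (1:ℝ)) (fun a : ℝ => a), h0, mul_zero]
  simp only [mul_one, one_mul] at i1 i2 e1 e2
  refine ⟨i2.sub i1, ?_⟩
  rw [integral_sub i2 i1, e1, e2, sub_zero]

lemma mark_sq (h1 : Integrable (fun a => a) ν) (h0 : ∫ a, a ∂ν = 0)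
    (h2 : Integrable (fun a => a ^ 2) ν) {σ : ℝ} (hσ : ∫ a, a ^ 2 ∂ν = σ ^ 2) :
    Integrable (fun p : ℝ × ℝ => (p.2 - p.1) ^ 2) (ν.prod ν) ∧
      ∫ p : ℝ × ℝ, (p.2 - p.1) ^ 2 ∂(ν.prod ν) = 2 * σ ^ 2 := by
  have o : Integrable (fun _ : ℝ => (1:ℝ)) ν := integrable_const _
  have i1 : Integrable (fun p : ℝ × ℝ => p.1 ^ 2 * 1) (ν.prod ν) := h2.mul_prod o
  have i2 : Integrable (fun p : ℝ × ℝ => 1 * p.2 ^ 2) (ν.prod ν) := o.mul_prod h2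
  have i3 : Integrable (fun p : ℝ × ℝ => p.1 * p.2) (ν.prod ν) := h1.mul_prod h1
  have e1 : ∫ p : ℝ × ℝ, p.1 ^ 2 * 1 ∂(ν.prod ν) = σ ^ 2 := by
    rw [integral_prod_mul (fun a : ℝ => a ^ 2) (fun _ : ℝ => (1:ℝ)), hσ]; simp
  have e2 : ∫ p : ℝ × ℝ, 1 * p.2 ^ 2 ∂(ν.prod ν) = σ ^ 2 := by
    rw [integral_prod_mul (fun _ : ℝ => (1:ℝ)) (fun a : ℝ => a ^ 2), hσ]; simp
  have e3 : ∫ p : ℝ × ℝ, p.1 * p.2 ∂(ν.prod ν) = 0 := by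
    rw [integral_prod_mul (fun a : ℝ => a) (fun a : ℝ => a), h0, zero_mul]
  simp only [mul_one, one_mul] at i1 i2 e1 e2
  have i4 : Integrable (fun p : ℝ × ℝ => p.1 ^ 2 + p.2 ^ 2) (ν.prod ν) := i1.add i2
  have i5 : Integrable (fun p : ℝ × ℝ => 2 * (p.1 * p.2)) (ν.prod ν) := i3.const_mul 2
  have he : (fun p : ℝ × ℝ => (p.2 - p.1) ^ 2) = fun p => (p.1 ^ 2 + p.2 ^ 2) - 2 * (p.1 * p.2) := by
    funext p; ring
  rw [he]
  refine ⟨i4.sub i5, ?_⟩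
  rw [integral_sub i4 i5, integral_add i1 i2, integral_const_mul, e1, e2, e3]; ring

lemma mean_eq {n j : ℕ} (hn : 0 < n) {Ωs : Set (EucSp d)} (hΩ : ∀ᵐ y ∂μ, y ∈ Ωs) (hh : Measurable h) {B0 : ℝ}
    (hB0 : ∀ x ∈ Ωs, ∀ y ∈ Ωs, |h y - h x| ≤ B0)
    (h1 : Integrable (fun a => a) ν) (h0 : ∫ a, a ∂ν = 0)
    (h2 : Integrable (fun a => a ^ 2) ν) {σ : ℝ} (hσ : ∫ a, a ^ 2 ∂ν = σ ^ 2)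
    (hone : ∫ z, wE j n (Fm μ z.1.1 z.2.1) ∂((μ.prod ν).prod (μ.prod ν)) = 1) :
    ∫ z, Gf h n z * wE j n (Fm μ z.1.1 z.2.1) ∂((μ.prod ν).prod (μ.prod ν)) =
      (∫ x, ∫ y, (n:ℝ) ^ (2 / (d:ℝ)) * (h y - h x) ^ 2 * wE j n (Fm μ x y) ∂μ ∂μ) + 2 * σ ^ 2 := by
  have hF0 := Fm_nonneg μ
  have hF1 := Fm_le_one μ
  set s := (n:ℝ) ^ (-1 / (d:ℝ)) with hs
  set Q := (n:ℝ) ^ (2 / (d:ℝ)) with hQ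
  have hQs : Q * s ^ 2 = 1 := n_sq hn
  have mw : Measurable fun v : EucSp d × EucSp d => wE j n (Fm μ v.1 v.2) := by
    have := (measurable_wE j n).comp (measurable_Fm2 μ)
    simpa only [Function.comp_def] using this
  set c := ((n - 1 : ℕ) : ℝ) * ((n - 2).choose j : ℝ) with hc
  have hc0 : 0 ≤ c := by positivity
  have hw0 : ∀ v : EucSp d × EucSp d, |wE j n (Fm μ v.1 v.2)| ≤ c := fun v => by
    rw [abs_of_nonneg (wE_nonneg _ _ (hF0 _ _) (hF1 _ _))]
    exact wt_le hc0 (hF0 _ _) (hF1 _ _)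
  have mA : Measurable fun v : EucSp d × EucSp d => Q * (h v.2 - h v.1) ^ 2 * wE j n (Fm μ v.1 v.2) := by
    have : Measurable fun v : EucSp d × EucSp d => Q * (h v.2 - h v.1) ^ 2 := by fun_prop
    exact this.mul mw
  have mB : Measurable fun v : EucSp d × EucSp d => 2 * Q * s * (h v.2 - h v.1) * wE j n (Fm μ v.1 v.2) := by
    have : Measurable fun v : EucSp d × EucSp d => 2 * Q * s * (h v.2 - h v.1) := by fun_prop
    exact this.mul mw
  have hae : ∀ᵐ v ∂(μ.prod μ), v.1 ∈ Ωs ∧ v.2 ∈ Ωs := by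
    filter_upwards [(Measure.quasiMeasurePreserving_fst (μ := μ) (ν := μ)).ae hΩ,
      (Measure.quasiMeasurePreserving_snd (μ := μ) (ν := μ)).ae hΩ] with v a b
    exact ⟨a, b⟩
  have iC : Integrable (fun v : EucSp d × EucSp d => wE j n (Fm μ v.1 v.2)) (μ.prod μ) :=
    Integrable.of_bound (C := c) mw.aestronglyMeasurable (Eventually.of_forall fun v => hw0 v)
  have iA : Integrable (fun v : EucSp d × EucSp d => Q * (h v.2 - h v.1) ^ 2 * wE j n (Fm μ v.1 v.2)) (μ.prod μ) := by
    refine Integrable.of_bound (C := |Q| * B0 ^ 2 * c) mA.aestronglyMeasurable ?_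
    filter_upwards [hae] with v hv
    rw [Real.norm_eq_abs, abs_mul, abs_mul, abs_pow]
    have := hB0 _ hv.1 _ hv.2
    have := hw0 v
    gcongr
  have iB : Integrable (fun v : EucSp d × EucSp d => 2 * Q * s * (h v.2 - h v.1) * wE j n (Fm μ v.1 v.2)) (μ.prod μ) := by
    refine Integrable.of_bound (C := |2 * Q * s| * B0 * c) mB.aestronglyMeasurable ?_
    filter_upwards [hae] with v hv
    rw [Real.norm_eq_abs, abs_mul, abs_mul]
    have h3 := hB0 _ hv.1 _ hv.2
    have h4 := hw0 v
    have h5 : 0 ≤ B0 := (abs_nonneg _).trans h3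
    gcongr
  obtain ⟨k1, e1⟩ := mark_mean h1 h0
  obtain ⟨k2, e2⟩ := mark_sq h1 h0 h2 hσ
  have o : Integrable (fun _ : ℝ × ℝ => (1:ℝ)) (ν.prod ν) := integrable_const _
  have I1 : Integrable (fun w : (EucSp d × EucSp d) × (ℝ × ℝ) =>
    (Q * (h w.1.2 - h w.1.1) ^ 2 * wE j n (Fm μ w.1.1 w.1.2)) * 1) ((μ.prod μ).prod (ν.prod ν)) := iA.mul_prod o
  have I2 : Integrable (fun w : (EucSp d × EucSp d) × (ℝ × ℝ) =>
    (2 * Q * s * (h w.1.2 - h w.1.1) * wE j n (Fm μ w.1.1 w.1.2)) * (w.2.2 - w.2.1)) ((μ.prod μ).prod (ν.prod ν)) :=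
    iB.mul_prod k1
  have I3 : Integrable (fun w : (EucSp d × EucSp d) × (ℝ × ℝ) =>
    wE j n (Fm μ w.1.1 w.1.2) * (w.2.2 - w.2.1) ^ 2) ((μ.prod μ).prod (ν.prod ν)) := iC.mul_prod k2
  have mw' : Measurable fun w : (EucSp d × EucSp d) × (ℝ × ℝ) => wE j n (Fm μ w.1.1 w.1.2) := by
    have := mw.comp (f := fun w : (EucSp d × EucSp d) × (ℝ × ℝ) => w.1) (by fun_prop)
    simpa only [Function.comp_def] using this
  have mG : Measurable fun w : (EucSp d × EucSp d) × (ℝ × ℝ) =>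
      Gf h n ((w.1.1, w.2.1), (w.1.2, w.2.2)) * wE j n (Fm μ w.1.1 w.1.2) := by
    have := (measurable_Gf hh n).comp (f := fun w : (EucSp d × EucSp d) × (ℝ × ℝ) => ((w.1.1, w.2.1), (w.1.2, w.2.2)))
      (by fun_prop)
    simp only [Function.comp_def] at this
    exact this.mul mw'
  have hone' : ∫ v, wE j n (Fm μ v.1 v.2) ∂(μ.prod μ) = 1 := by
    have a1 := int_swap (μ := μ) (ν := ν) mw'
    simp only at a1
    rw [hone] at a1
    have a2 := integral_prod_mul (μ := μ.prod μ) (ν := ν.prod ν) (fun v : EucSp d × EucSp d => wE j n (Fm μ v.1 v.2))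
      (fun _ : ℝ × ℝ => (1:ℝ))
    simp only [mul_one] at a2
    rw [a2] at a1
    simpa using a1.symm
  have a0 := int_swap (μ := μ) (ν := ν) mG
  simp only [Prod.mk.eta] at a0
  rw [a0]
  have hexp : ∀ w : (EucSp d × EucSp d) × (ℝ × ℝ),
      Gf h n ((w.1.1, w.2.1), (w.1.2, w.2.2)) * wE j n (Fm μ w.1.1 w.1.2) =
      ((Q * (h w.1.2 - h w.1.1) ^ 2 * wE j n (Fm μ w.1.1 w.1.2)) * 1 +
      (2 * Q * s * (h w.1.2 - h w.1.1) * wE j n (Fm μ w.1.1 w.1.2)) * (w.2.2 - w.2.1)) +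
      wE j n (Fm μ w.1.1 w.1.2) * (w.2.2 - w.2.1) ^ 2 := by
    intro w
    unfold Gf
    simp only [← hs, ← hQ]
    linear_combination (wE j n (Fm μ w.1.1 w.1.2) * (w.2.2 - w.2.1) ^ 2) * hQs
  have I12 : Integrable (fun w : (EucSp d × EucSp d) × (ℝ × ℝ) =>
      (Q * (h w.1.2 - h w.1.1) ^ 2 * wE j n (Fm μ w.1.1 w.1.2)) * 1 +
      (2 * Q * s * (h w.1.2 - h w.1.1) * wE j n (Fm μ w.1.1 w.1.2)) * (w.2.2 - w.2.1))
      ((μ.prod μ).prod (ν.prod ν)) := I1.add I2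
  rw [integral_congr_ae (Eventually.of_forall hexp), integral_add I12 I3, integral_add I1 I2]
  have b1 := integral_prod_mul (μ := μ.prod μ) (ν := ν.prod ν)
    (fun v : EucSp d × EucSp d => Q * (h v.2 - h v.1) ^ 2 * wE j n (Fm μ v.1 v.2)) (fun _ : ℝ × ℝ => (1:ℝ))
  have b2 := integral_prod_mul (μ := μ.prod μ) (ν := ν.prod ν)
    (fun v : EucSp d × EucSp d => 2 * Q * s * (h v.2 - h v.1) * wE j n (Fm μ v.1 v.2)) (fun p : ℝ × ℝ => p.2 - p.1)
  have b3 := integral_prod_mul (μ := μ.prod μ) (ν := ν.prod ν)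
    (fun v : EucSp d × EucSp d => wE j n (Fm μ v.1 v.2)) (fun p : ℝ × ℝ => (p.2 - p.1) ^ 2)
  have b4 := integral_prod _ iA
  rw [b1, b2, b3, e1, e2, hone', b4]
  simp

end mean


set_option linter.unusedSectionVars false

section setup
variable {d : ℕ} {Ωp : Type*} [MeasurableSpace Ωp] {P : Measure Ωp} [IsProbabilityMeasure P]
  {X : ℕ → Ωp → EucSp d} {e : ℕ → Ωp → ℝ}

lemma pair_indep (hX : ∀ i, Measurable (X i)) (he : ∀ i, Measurable (e i)) (hi : iIndepFun X P)
    (hei : iIndepFun e P) (hXe : IndepFun (fun ω i => X i ω) (fun ω i => e i ω) P) :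
    iIndepFun (fun i ω => (X i ω, e i ω)) P := by
  rw [iIndepFun_iff_iIndep]
  have hrect : ∀ (s : Finset ℕ) (A : ℕ → Set (EucSp d)) (B : ℕ → Set ℝ), (∀ i ∈ s, MeasurableSet (A i)) →
      (∀ i ∈ s, MeasurableSet (B i)) →
      P (⋂ i ∈ s, (X i ⁻¹' A i ∩ e i ⁻¹' B i)) = (∏ i ∈ s, P (X i ⁻¹' A i)) * ∏ i ∈ s, P (e i ⁻¹' B i) := by
    intro s A B hA hB
    rw [← hi.measure_inter_preimage_eq_mul s hA, ← hei.measure_inter_preimage_eq_mul s hB]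
    have h1 : MeasurableSet {x : ℕ → EucSp d | ∀ i ∈ s, x i ∈ A i} := by
      have : {x : ℕ → EucSp d | ∀ i ∈ s, x i ∈ A i} = ⋂ i ∈ s, (fun x : ℕ → EucSp d => x i) ⁻¹' A i := by ext; simp
      rw [this]
      exact Finset.measurableSet_biInter s fun i hi => measurable_pi_apply i (hA i hi)
    have h2 : MeasurableSet {x : ℕ → ℝ | ∀ i ∈ s, x i ∈ B i} := by
      have : {x : ℕ → ℝ | ∀ i ∈ s, x i ∈ B i} = ⋂ i ∈ s, (fun x : ℕ → ℝ => x i) ⁻¹' B i := by ext; simp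
      rw [this]
      exact Finset.measurableSet_biInter s fun i hi => measurable_pi_apply i (hB i hi)
    have h3 := hXe.measure_inter_preimage_eq_mul _ _ h1 h2
    have e1 : (fun ω i => X i ω) ⁻¹' {x : ℕ → EucSp d | ∀ i ∈ s, x i ∈ A i} = ⋂ i ∈ s, X i ⁻¹' A i := by ext; simp
    have e2 : (fun ω i => e i ω) ⁻¹' {x : ℕ → ℝ | ∀ i ∈ s, x i ∈ B i} = ⋂ i ∈ s, e i ⁻¹' B i := by ext; simp
    rw [e1, e2] at h3
    rw [← h3]
    congr 1
    ext ω; simp [forall_and]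
  refine iIndepSets.iIndep (fun i => ((hX i).prodMk (he i)).comap_le)
    (fun i => {S | ∃ t ∈ Set.image2 (fun (s : Set (EucSp d)) (t : Set ℝ) => s ×ˢ t) {s | MeasurableSet s} {t | MeasurableSet t},
      (fun ω => (X i ω, e i ω)) ⁻¹' t = S}) (fun i => ?_) (fun i => ?_) ?_
  · exact IsPiSystem.comap isPiSystem_prod _
  · have : (Prod.instMeasurableSpace : MeasurableSpace (EucSp d × ℝ)) = MeasurableSpace.generateFrom
      (Set.image2 (fun (s : Set (EucSp d)) (t : Set ℝ) => s ×ˢ t) {s | MeasurableSet s} {t | MeasurableSet t}) :=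
      generateFrom_prod.symm
    rw [this, MeasurableSpace.comap_generateFrom]
    rfl
  · rw [iIndepSets_iff]
    intro s f hf
    have hf' : ∀ i, ∃ A B, i ∈ s → MeasurableSet A ∧ MeasurableSet B ∧ f i = X i ⁻¹' A ∩ e i ⁻¹' B := by
      intro i
      by_cases his : i ∈ s
      · obtain ⟨t, ⟨A, hA, B, hB, rfl⟩, ht⟩ := hf i his
        exact ⟨A, B, fun _ => ⟨hA, hB, by rw [← ht]; rfl⟩⟩
      · exact ⟨∅, ∅, fun h => absurd h his⟩
    choose A B hAB using hf'
    have e1 : (⋂ i ∈ s, f i) = ⋂ i ∈ s, (X i ⁻¹' A i ∩ e i ⁻¹' B i) :=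
      Set.iInter₂_congr fun i hi => (hAB i hi).2.2
    rw [e1, hrect s A B (fun i hi => (hAB i hi).1) (fun i hi => (hAB i hi).2.1), ← Finset.prod_mul_distrib]
    refine Finset.prod_congr rfl fun i hi => ?_
    rw [(hAB i hi).2.2]
    have := hrect {i} A B (by simpa using (hAB i hi).1) (by simpa using (hAB i hi).2.1)
    simpa using this.symm

lemma pair_law (hX : ∀ i, Measurable (X i)) (he : ∀ i, Measurable (e i))
    (hXe : IndepFun (fun ω i => X i ω) (fun ω i => e i ω) P) (i : ℕ) :
    P.map (fun ω => (X i ω, e i ω)) = (P.map (X i)).prod (P.map (e i)) := by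
  have h1 : IndepFun (X i) (e i) P := by
    have := hXe.comp (measurable_pi_apply i) (measurable_pi_apply i)
    exact this
  exact (indepFun_iff_map_prod_eq_prod_map_map (hX i).aemeasurable (he i).aemeasurable).1 h1

lemma lip_exists {Ωs : Set (EucSp d)} (hΩb : Bornology.IsBounded Ωs) {h : EucSp d → ℝ} (hh : ContDiff ℝ 2 h) :
    ∃ Λ : ℝ, 0 ≤ Λ ∧ ∀ x ∈ Ωs, ∀ y ∈ Ωs, |h y - h x| ≤ Λ * dist y x := by
  obtain ⟨R, hR⟩ := hΩb.subset_closedBall (0 : EucSp d)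
  have hc : Continuous (fderiv ℝ h) := hh.continuous_fderiv (by norm_num)
  obtain ⟨C, hC⟩ := (isCompact_closedBall (0 : EucSp d) R).exists_bound_of_continuousOn hc.continuousOn
  refine ⟨max C 0, le_max_right _ _, fun x hx y hy => ?_⟩
  have := (convex_closedBall (0 : EucSp d) R).norm_image_sub_le_of_norm_fderiv_le (𝕜 := ℝ) (f := h) (C := max C 0)
    (fun x _ => (hh.differentiable (by norm_num)).differentiableAt) (fun x hx => (hC x hx).trans (le_max_left _ _))
    (hR hx) (hR hy)
  rw [dist_eq_norm]; exact this

lemma ball_lower (hd : 1 ≤ d) {κ : EucSp d → ℝ} (hκm : Measurable κ) (hκ0 : ∀ x, 0 ≤ κ x)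
    (μ : Measure (EucSp d)) [IsProbabilityMeasure μ]
    (hμ : μ = volume.withDensity fun x => ENNReal.ofReal (κ x)) (hs : ∀ x r, μ (Metric.sphere x r) = 0)
    {Ωs : Set (EucSp d)} (hΩb : Bornology.IsBounded Ωs) {c : ℝ} (hc : 0 < c)
    (hball : ∀ x ∈ Ωs, ∀ r : ℝ, 0 < r → r ≤ 1 → c * r ^ d ≤ ∫ y in Metric.closedBall x r, κ y) :
    ∃ c' : ℝ, 0 < c' ∧ ∀ x ∈ Ωs, ∀ y ∈ Ωs, c' * dist y x ^ d ≤ Fm μ x y := by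
  obtain ⟨D0, hD0⟩ := Metric.isBounded_iff.1 hΩb
  set D := max D0 1 with hD
  have hD1 : 1 ≤ D := le_max_right _ _
  have hDp : 0 < D := by linarith
  refine ⟨c / D ^ d, by positivity, fun x hx y hy => ?_⟩
  rcases eq_or_lt_of_le (dist_nonneg (x := y) (y := x)) with h0 | h0
  · rw [← h0, zero_pow (by omega), mul_zero]; exact Fm_nonneg _ _ _
  have hr : dist y x ≤ D := (hD0 hy hx).trans (le_max_left _ _)
  have h1 := hball x hx (dist y x / D) (by positivity) ((div_le_one hDp).2 hr)
  rw [← real_cb_eq hκm hκ0 μ hμ _ measurableSet_closedBall] at h1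
  have h2 : μ.real (Metric.closedBall x (dist y x / D)) ≤ μ.real (Metric.closedBall x (dist y x)) :=
    measureReal_mono (Metric.closedBall_subset_closedBall (div_le_self h0.le hD1))
  unfold Fm
  rw [real_ball_eq μ hs x]
  calc c / D ^ d * dist y x ^ d = c * (dist y x / D) ^ d := by rw [div_pow]; ring
    _ ≤ _ := h1.trans h2

lemma sphere_null (hd : 1 ≤ d) {κ : EucSp d → ℝ} (μ : Measure (EucSp d))
    (hμ : μ = volume.withDensity fun x => ENNReal.ofReal (κ x)) (x : EucSp d) (r : ℝ) :
    μ (Metric.sphere x r) = 0 := by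
  have : Nonempty (Fin d) := ⟨⟨0, by omega⟩⟩
  rw [hμ]
  exact withDensity_absolutelyContinuous _ _ (Measure.addHaar_sphere volume x r)

lemma mem_ae {κ : EucSp d → ℝ} (hκm : Measurable κ) (hκ0 : ∀ x, 0 ≤ κ x)
    (μ : Measure (EucSp d)) [IsProbabilityMeasure μ]
    (hμ : μ = volume.withDensity fun x => ENNReal.ofReal (κ x)) {Ωs : Set (EucSp d)} (hΩ : MeasurableSet Ωs)
    (h1 : ∫ x in Ωs, κ x = 1) : ∀ᵐ y ∂μ, y ∈ Ωs := by
  rw [← real_cb_eq hκm hκ0 μ hμ _ hΩ] at h1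
  have h2 : μ Ωs = 1 := by
    rw [measureReal_def] at h1
    rw [← ENNReal.ofReal_toReal (measure_ne_top μ Ωs), h1, ENNReal.ofReal_one]
  exact (prob_compl_eq_zero_iff hΩ).2 h2

end setup

/-- The intermediate `L¹` limit in the proof of Theorem 5.3: for fixed `k`,
`n^{2/d} γ_{n,k} → σ² + (c_k/(2d)) ∫_Ω |∇h|² κ^{1−2/d}` in `L¹`. -/
theorem stmt12 {d : ℕ} (hd : 1 ≤ d)
    {Ωp : Type*} [MeasureSpace Ωp] [IsProbabilityMeasure (ℙ : Measure Ωp)]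
    (Ωs : Set (EucSp d)) (hΩo : IsOpen Ωs) (hΩb : Bornology.IsBounded Ωs)
    (κ : EucSp d → ℝ) (hκmeas : Measurable κ) (hκnn : ∀ x, 0 ≤ κ x)
    (hκ1 : ∫ x in Ωs, κ x = 1)
    (hκball : ∃ c > 0, ∀ x ∈ Ωs, ∀ r : ℝ, 0 < r → r ≤ 1 →
      c * r ^ d ≤ ∫ y in Metric.closedBall x r, κ y)
    (h : EucSp d → ℝ) (hh : ContDiff ℝ 2 h)
    (hgrad : ∃ M, ∀ x ∈ Ωs, ‖gradient h x‖ ≤ M)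
    (X : ℕ → Ωp → EucSp d) (hXmeas : ∀ i, Measurable (X i))
    (hiid : iIndepFun X ℙ)
    (hlaw : ∀ i, Measure.map (X i) ℙ
      = volume.withDensity fun x => ENNReal.ofReal (κ x))
    (e : ℕ → Ωp → ℝ) (σ : ℝ) (hemeas : ∀ i, Measurable (e i))
    (heiid : iIndepFun e ℙ)
    (heid : ∀ i, Measure.map (e i) ℙ = Measure.map (e 0) ℙ)
    (heL2 : ∀ i, MemLp (e i) 2 ℙ)
    (hemean : ∀ i, ∫ ω, e i ω ∂ℙ = 0)
    (hevar : ∀ i, ∫ ω, (e i ω) ^ 2 ∂ℙ = σ ^ 2)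
    (hXe : IndepFun (fun ω i => X i ω) (fun ω i => e i ω) ℙ)
    (J : ℕ → ℕ → ℕ → Ωp → ℕ) (hJmeas : ∀ i n k, Measurable (J i n k))
    (hJ : IsNNIndex X J) (k : ℕ) (hk : 1 ≤ k) :
    Tendsto (fun n : ℕ => ∫ ω,
        |(n : ℝ) ^ (2 / (d : ℝ)) * gammaStat h X e J n k ω -
          (σ ^ 2 + (nnMoment d k / (2 * d)) *
            ∫ x in Ωs, ‖gradient h x‖ ^ 2 * κ x ^ (1 - 2 / (d : ℝ)))| ∂ℙ)
      atTop (𝓝 0) := by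
  obtain ⟨j, rfl⟩ : ∃ j, k = j + 1 := ⟨k - 1, by omega⟩
  set μ : Measure (EucSp d) := volume.withDensity fun x => ENNReal.ofReal (κ x) with hμ
  have hμP : IsProbabilityMeasure μ := by
    rw [← hlaw 0]; exact Measure.isProbabilityMeasure_map (hXmeas 0).aemeasurable
  set ν : Measure ℝ := Measure.map (e 0) ℙ with hν
  have hνP : IsProbabilityMeasure ν := Measure.isProbabilityMeasure_map (hemeas 0).aemeasurable
  have hΩm : MeasurableSet Ωs := hΩo.measurableSet
  have hs : ∀ x r, μ (Metric.sphere x r) = 0 := sphere_null hd μ hμ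
  have hΩ : ∀ᵐ y ∂μ, y ∈ Ωs := mem_ae hκmeas hκnn μ hμ hΩm hκ1
  obtain ⟨c1, hc1, hball⟩ := hκball
  obtain ⟨c', hc', hF⟩ := ball_lower hd hκmeas hκnn μ hμ hs hΩb hc1 hball
  obtain ⟨Λ, hΛ0, hΛ⟩ := lip_exists hΩb hh
  have hhm : Measurable h := hh.continuous.measurable
  have hB0 : ∃ B0 : ℝ, ∀ x ∈ Ωs, ∀ y ∈ Ωs, |h y - h x| ≤ B0 := by
    obtain ⟨D, hD⟩ := Metric.isBounded_iff.1 hΩb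
    exact ⟨Λ * D, fun x hx y hy => (hΛ x hx y hy).trans (mul_le_mul_of_nonneg_left (hD hy hx) hΛ0)⟩
  obtain ⟨B0, hB0⟩ := hB0
  have a1 : Integrable (fun a : ℝ => a) ν :=
    (integrable_map_measure measurable_id.aestronglyMeasurable (hemeas 0).aemeasurable).2
      ((heL2 0).integrable (by norm_num))
  have a2 : ∫ a, a ∂ν = 0 := 
    (integral_map (f := fun a : ℝ => a) (hemeas 0).aemeasurable measurable_id.aestronglyMeasurable).trans (hemean 0)
  have msq : Measurable fun a : ℝ => a ^ 2 := by fun_prop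
  have a3 : Integrable (fun a : ℝ => a ^ 2) ν :=
    (integrable_map_measure msq.aestronglyMeasurable (hemeas 0).aemeasurable).2 (heL2 0).integrable_sq
  have a4 : ∫ a, a ^ 2 ∂ν = σ ^ 2 := by
    rw [hν, integral_map (hemeas 0).aemeasurable msq.aestronglyMeasurable]; exact hevar 0
  set W : ℕ → Ωp → EucSp d × ℝ := fun i ω => (X i ω, e i ω) with hWdef
  have hW : ∀ i, Measurable (W i) := fun i => (hXmeas i).prodMk (hemeas i)
  have hind : iIndepFun W ℙ := pair_indep hXmeas hemeas hiid heiid hXe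
  have hlawW : ∀ i, Measure.map (W i) ℙ = μ.prod ν := fun i => by
    rw [hWdef, pair_law hXmeas hemeas hXe i, hlaw i, heid i]
  have hJm : ∀ i n, Measurable ((fun i n => J i n (j + 1)) i n) := fun i n => hJmeas i n (j + 1)
  have hJ' : ∀ n, j + 1 < n → ∀ i < n, ∀ᵐ ω ∂(ℙ : Measure Ωp), (fun i n => J i n (j + 1)) i n ω < n ∧
      (fun i n => J i n (j + 1)) i n ω ≠ i ∧
      cnt W (others n i ((fun i n => J i n (j + 1)) i n ω)) i ((fun i n => J i n (j + 1)) i n ω) ω = j := by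
    intro n hn i hi
    filter_upwards [hJ i n (j + 1) hi (by omega) hn] with ω hω
    refine ⟨hω.1, hω.2.1, ?_⟩
    rw [cnt_others]
    exact hω.2.2
  have hone : ∀ n, j + 1 < n → ∫ z, wE j n (Fm μ z.1.1 z.2.1) ∂((μ.prod ν).prod (μ.prod ν)) = 1 := by
    intro n hn
    have := one_real hs hW hind hlawW (i := 0) (by omega) (hJm 0 n) (hJ' n hn 0 (by omega))
      (G := fun _ => 1) measurable_const (fun _ => zero_le_one)
    simp only [one_mul] at this
    rw [← this]; simp
  have hO := outer_lim hd (goodW_exact j) hκmeas hκnn μ hμ hs hΩm hΩ hc' hF hc1 hball hh hΛ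
  have hL := hO.add_const (2 * σ ^ 2)
  have hL' := hL.congr' (f₂ := fun n : ℕ => ∫ z, Gf h n z * wE j n (Fm μ z.1.1 z.2.1) ∂((μ.prod ν).prod (μ.prod ν))) (by
    filter_upwards [eventually_gt_atTop (j + 1)] with n hn
    rw [mean_eq (by omega) hΩ hhm hB0 a1 a2 a3 a4 (hone n hn)]
    rfl)
  have hfin := trunc_lim hs hW hind hlawW hJm hJ' (G := fun n => Gf h n) (fun n => measurable_Gf hhm n)
    (trunc_exists hd hs hΩm hΩ hc' hF hhm hΛ a3 j) hL'
  have hfin2 := hfin.const_mul (1 / 2 : ℝ)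
  rw [mul_zero] at hfin2
  refine hfin2.congr fun n => ?_
  rw [← integral_const_mul]
  refine integral_congr_ae (Eventually.of_forall fun ω => ?_)
  simp only
  have habs : ∀ y : ℝ, 1 / 2 * |y| = |1 / 2 * y| := fun y => by
    rw [abs_mul, abs_of_nonneg (show (0:ℝ) ≤ 1 / 2 by norm_num)]
  rw [habs]
  congr 1
  have hsumeq : ∑ i ∈ Finset.range n, Gf h n (W i ω, W (J i n (j + 1) ω) ω) =
      (n:ℝ) ^ (2 / (d:ℝ)) * ∑ i ∈ Finset.range n,
      ((h (X (J i n (j + 1) ω) ω) + (n : ℝ) ^ (-1 / (d : ℝ)) * e (J i n (j + 1) ω) ω)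
      - (h (X i ω) + (n : ℝ) ^ (-1 / (d : ℝ)) * e i ω)) ^ 2 := by
    rw [Finset.mul_sum]; rfl
  rw [hsumeq]
  unfold gammaStat nnMoment omg
  rw [mul_inv]
  push_cast
  ring
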